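/- arXiv:2201.00367 — 3 statements merged into one kernel-verified Lean document; each statement's English description precedes it below -/
import Mathlib

section
/- Let F be a finite field and let Q be a quadratic form on F⁸ whose polar form B(u,v) = Q(u+v) − Q(u) − Q(v) is nondegenerate and which has a totally singular subspace of dimension 3 but no totally singular subspace of dimension 4 (i.e., Q is of minus type, Witt index 3). Let O(Q) be the group of F-linear automorphisms g of F⁸ with Q(g(v)) = Q(v) for all v, let Ω₈⁻(q) be the derived subgroup of O(Q) where q = |F|, and let PΩ₈⁻(q) be the quotient of Ω₈⁻(q) by its center. Then PΩ₈⁻(q) is (2,3)-generated for every prime power q ≥ 2. -/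
open Matrix

/-- A group is `(2,3)`-generated if it is generated by an element of order 2
together with an element of order 3. -/
def IsTwoThreeGenerated (G : Type*) [Group G] : Prop :=
  ∃ x y : G, orderOf x = 2 ∧ orderOf y = 3 ∧ Subgroup.closure {x, y} = ⊤

/-- The plus-type quadratic form `Q⁺(v) = v₁v₅ + v₂v₆ + v₃v₇ + v₄v₈` on `F⁸`. -/
def QPlus (F : Type*) [Field F] (v : Fin 8 → F) : F :=
  v 0 * v 4 + v 1 * v 5 + v 2 * v 6 + v 3 * v 7

/-- The group of linear automorphisms of `F⁸` preserving the form `Q`,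
as a subgroup of `GL₈(F)`. -/
def orthogonalGroupOf (F : Type*) [Field F] (Q : (Fin 8 → F) → F) :
    Subgroup (GL (Fin 8) F) where
  carrier := {g | ∀ v, Q ((g : Matrix (Fin 8) (Fin 8) F).mulVec v) = Q v}
  one_mem' := by
    intro v
    simp
  mul_mem' := by
    intro a b ha hb v
    have h : ((a * b : GL (Fin 8) F) : Matrix (Fin 8) (Fin 8) F).mulVec v
        = (a : Matrix (Fin 8) (Fin 8) F).mulVec
            ((b : Matrix (Fin 8) (Fin 8) F).mulVec v) := by
      simp [Matrix.mulVec_mulVec]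
    rw [h, ha, hb]
  inv_mem' := by
    intro a ha v
    have h1 : (a : Matrix (Fin 8) (Fin 8) F).mulVec
        (((a⁻¹ : GL (Fin 8) F) : Matrix (Fin 8) (Fin 8) F).mulVec v) = v := by
      rw [Matrix.mulVec_mulVec, ← Units.val_mul, mul_inv_cancel]
      simp
    calc Q (((a⁻¹ : GL (Fin 8) F) : Matrix (Fin 8) (Fin 8) F).mulVec v)
        = Q ((a : Matrix (Fin 8) (Fin 8) F).mulVec
            (((a⁻¹ : GL (Fin 8) F) : Matrix (Fin 8) (Fin 8) F).mulVec v)) := (ha _).symm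
      _ = Q v := by rw [h1]

namespace OrthEight

variable {F : Type*} [Field F] {b c : F}

/-- The model form of minus type in the coordinates `(e₁, e₂, e₃, f₁, f₂, f₃, v₁, w)`: three
hyperbolic planes together with the binary form `-s² + b s t + c t²`. -/
def qf (b c : F) (v : Fin 8 → F) : F :=
  v 0 * v 3 + v 1 * v 4 + v 2 * v 5 - v 6 ^ 2 + b * v 6 * v 7 + c * v 7 ^ 2

/-- The polar form of `qf`. -/
def bf (b c : F) (u v : Fin 8 → F) : F :=
  u 0 * v 3 + u 3 * v 0 + (u 1 * v 4 + u 4 * v 1) + (u 2 * v 5 + u 5 * v 2)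
    - 2 * u 6 * v 6 + b * (u 6 * v 7 + u 7 * v 6) + 2 * c * u 7 * v 7

theorem bf_comm (u v : Fin 8 → F) : bf b c u v = bf b c v u := by simp only [bf]; ring

theorem bf_self (u : Fin 8 → F) : bf b c u u = 2 * qf b c u := by simp only [bf, qf]; ring

@[simp] theorem bf_add_left (u u' v : Fin 8 → F) :
    bf b c (u + u') v = bf b c u v + bf b c u' v := by simp only [bf, Pi.add_apply]; ring

@[simp] theorem bf_add_right (u v v' : Fin 8 → F) :
    bf b c u (v + v') = bf b c u v + bf b c u v' := by simp only [bf, Pi.add_apply]; ring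

@[simp] theorem bf_sub_left (u u' v : Fin 8 → F) :
    bf b c (u - u') v = bf b c u v - bf b c u' v := by simp only [bf, Pi.sub_apply]; ring

@[simp] theorem bf_sub_right (u v v' : Fin 8 → F) :
    bf b c u (v - v') = bf b c u v - bf b c u v' := by simp only [bf, Pi.sub_apply]; ring

@[simp] theorem bf_neg_right (u v : Fin 8 → F) : bf b c u (-v) = -bf b c u v := by
  simp only [bf, Pi.neg_apply]; ring

@[simp] theorem bf_smul_left (t : F) (u v : Fin 8 → F) : bf b c (t • u) v = t * bf b c u v := by
  simp only [bf, Pi.smul_apply, smul_eq_mul]; ring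

@[simp] theorem bf_smul_right (t : F) (u v : Fin 8 → F) : bf b c u (t • v) = t * bf b c u v := by
  simp only [bf, Pi.smul_apply, smul_eq_mul]; ring

@[simp] theorem bf_zero_right (v : Fin 8 → F) : bf b c v 0 = 0 := by simp [bf]

theorem qf_add (u v : Fin 8 → F) : qf b c (u + v) = qf b c u + qf b c v + bf b c u v := by
  simp only [bf, qf, Pi.add_apply]; ring

theorem qf_sub (u v : Fin 8 → F) : qf b c (u - v) = qf b c u + qf b c v - bf b c u v := by
  simp only [bf, qf, Pi.sub_apply]; ring

@[simp] theorem qf_neg (u : Fin 8 → F) : qf b c (-u) = qf b c u := by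
  simp only [qf, Pi.neg_apply]; ring

@[simp] theorem qf_smul (t : F) (u : Fin 8 → F) : qf b c (t • u) = t ^ 2 * qf b c u := by
  simp only [qf, Pi.smul_apply, smul_eq_mul]; ring

@[simp] theorem qf_zero : qf b c 0 = 0 := by simp [qf]

/-- The isometry group of the model form. -/
abbrev OG (b c : F) := ↥(orthogonalGroupOf F (qf b c))

/-- The natural action of the isometry group on `F⁸`. -/
def act (b c : F) : OG b c →* Module.End F (Fin 8 → F) :=
  ((Matrix.toLinAlgEquiv' (R := F) (n := Fin 8)).toAlgHom : Matrix (Fin 8) (Fin 8) F →*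
    Module.End F (Fin 8 → F)).comp
    ((Units.coeHom (Matrix (Fin 8) (Fin 8) F)).comp (orthogonalGroupOf F (qf b c)).subtype)

theorem act_apply (g : OG b c) (v : Fin 8 → F) :
    act b c g v = (g.1 : Matrix (Fin 8) (Fin 8) F).mulVec v := by
  simp [act, Matrix.toLinAlgEquiv'_apply]

theorem act_mul_apply (g h : OG b c) (v : Fin 8 → F) :
    act b c (g * h) v = act b c g (act b c h v) := by
  rw [map_mul, Module.End.mul_apply]

@[simp] theorem act_one_apply (v : Fin 8 → F) : act b c 1 v = v := by
  rw [map_one, Module.End.one_apply]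

@[simp] theorem act_inv_act (g : OG b c) (v : Fin 8 → F) : act b c g⁻¹ (act b c g v) = v := by
  rw [← act_mul_apply, inv_mul_cancel, act_one_apply]

@[simp] theorem act_act_inv (g : OG b c) (v : Fin 8 → F) : act b c g (act b c g⁻¹ v) = v := by
  rw [← act_mul_apply, mul_inv_cancel, act_one_apply]

@[simp] theorem qf_act (g : OG b c) (v : Fin 8 → F) : qf b c (act b c g v) = qf b c v := by
  rw [act_apply]; exact g.2 v

@[simp] theorem bf_act (g : OG b c) (u v : Fin 8 → F) :
    bf b c (act b c g u) (act b c g v) = bf b c u v := by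
  have h := qf_add (b := b) (c := c) (act b c g u) (act b c g v)
  rw [← map_add, qf_act, qf_act, qf_act, qf_add] at h
  linear_combination -h

theorem bf_act_left (g : OG b c) (u v : Fin 8 → F) :
    bf b c (act b c g u) v = bf b c u (act b c g⁻¹ v) := by
  rw [← bf_act g u, act_act_inv]

theorem ext_act {g h : OG b c} (hgh : ∀ v, act b c g v = act b c h v) : g = h := by
  apply Subtype.ext
  apply Units.ext
  apply Matrix.ext_of_mulVec_single
  intro i
  have := hgh (Pi.single i 1)
  rwa [act_apply, act_apply] at this

theorem exists_act_eq (f g : (Fin 8 → F) →ₗ[F] (Fin 8 → F)) (hfg : ∀ v, f (g v) = v)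
    (hgf : ∀ v, g (f v) = v) (hq : ∀ v, qf b c (f v) = qf b c v) :
    ∃ x : OG b c, ∀ v, act b c x v = f v := by
  have h1 : f ∘ₗ g = LinearMap.id := LinearMap.ext hfg
  have h2 : g ∘ₗ f = LinearMap.id := LinearMap.ext hgf
  refine ⟨⟨⟨LinearMap.toMatrix' f, LinearMap.toMatrix' g, ?_, ?_⟩, ?_⟩, ?_⟩
  · rw [← LinearMap.toMatrix'_comp, h1, LinearMap.toMatrix'_id]
  · rw [← LinearMap.toMatrix'_comp, h2, LinearMap.toMatrix'_id]
  · intro v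
    simp [LinearMap.toMatrix'_mulVec, hq]
  · intro v
    rw [act_apply]
    simp [LinearMap.toMatrix'_mulVec]

/-- The Siegel transformation attached to a singular vector `d` and a vector `r ⊥ d`. -/
def siegel (b c : F) (d r v : Fin 8 → F) : Fin 8 → F :=
  v + bf b c v d • r - bf b c v r • d - (qf b c r * bf b c v d) • d

theorem siegel_add_right {d r r' : Fin 8 → F} (hd : qf b c d = 0) (hr : bf b c d r = 0)
    (hr' : bf b c d r' = 0) (v : Fin 8 → F) :
    siegel b c d r (siegel b c d r' v) = siegel b c d (r + r') v := by
  have hdd : bf b c d d = 0 := by rw [bf_self, hd, mul_zero]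
  have hrd' : bf b c r' d = 0 := by rw [bf_comm, hr']
  ext i
  simp only [siegel, bf_add_left, bf_sub_left, bf_smul_left, bf_add_right, qf_add, hdd, hrd', hr,
    Pi.add_apply, Pi.sub_apply, Pi.smul_apply, smul_eq_mul, bf_comm r' r]
  ring

theorem siegel_zero_right (d v : Fin 8 → F) : siegel b c d 0 v = v := by
  simp [siegel]

theorem siegel_smul_left (t : F) (d r v : Fin 8 → F) :
    siegel b c (t • d) r v = siegel b c d (t • r) v := by
  ext i
  simp only [siegel, bf_smul_right, qf_smul, Pi.add_apply, Pi.sub_apply, Pi.smul_apply,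
    smul_eq_mul]
  ring

theorem siegel_swap {d r : Fin 8 → F} (hd : qf b c d = 0) (hr : qf b c r = 0) (v : Fin 8 → F) :
    siegel b c r (-d) v = siegel b c d r v := by
  ext i
  simp only [siegel, bf_neg_right, qf_neg, hd, hr, Pi.add_apply, Pi.sub_apply, Pi.smul_apply,
    Pi.neg_apply, smul_eq_mul]
  ring

theorem siegel_add_smul {d r : Fin 8 → F} (hd : qf b c d = 0) (hr : bf b c d r = 0) (t : F)
    (v : Fin 8 → F) : siegel b c d (r + t • d) v = siegel b c d r v := by
  have hrd : bf b c r d = 0 := by rw [bf_comm, hr]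
  ext i
  simp only [siegel, bf_add_right, bf_smul_right, qf_add, qf_smul, hd, hrd, Pi.add_apply,
    Pi.sub_apply, Pi.smul_apply, smul_eq_mul]
  ring

theorem qf_siegel {d r : Fin 8 → F} (hd : qf b c d = 0) (hr : bf b c d r = 0) (v : Fin 8 → F) :
    qf b c (siegel b c d r v) = qf b c v := by
  have hdd : bf b c d d = 0 := by rw [bf_self, hd, mul_zero]
  have hrd : bf b c r d = 0 := by rw [bf_comm, hr]
  simp only [siegel, qf_add, qf_sub, qf_smul, bf_add_left, bf_sub_left, bf_smul_left,
    bf_smul_right, hd, hdd, hrd]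
  ring

theorem act_siegel (g : OG b c) (d r v : Fin 8 → F) :
    act b c g (siegel b c d r (act b c g⁻¹ v)) = siegel b c (act b c g d) (act b c g r) v := by
  have h1 : ∀ u, bf b c (act b c g⁻¹ v) u = bf b c v (act b c g u) := fun u => by
    rw [bf_act_left, inv_inv]
  simp only [siegel, map_add, map_sub, map_smul, h1, qf_act, act_act_inv]

theorem exists_siegel {d r : Fin 8 → F} (hd : qf b c d = 0) (hr : bf b c d r = 0) :
    ∃ g : OG b c, ∀ v, act b c g v = siegel b c d r v := by
  have key : ∀ r' : Fin 8 → F, ∃ f : (Fin 8 → F) →ₗ[F] (Fin 8 → F), ∀ v,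
      f v = siegel b c d r' v := fun r' => ⟨
    { toFun := siegel b c d r'
      map_add' := fun u v => by
        ext i
        simp only [siegel, bf_add_left, Pi.add_apply, Pi.sub_apply, Pi.smul_apply, smul_eq_mul]
        ring
      map_smul' := fun t v => by
        ext i
        simp only [siegel, bf_smul_left, Pi.add_apply, Pi.sub_apply, Pi.smul_apply, smul_eq_mul,
          RingHom.id_apply]
        ring }, fun v => rfl⟩
  obtain ⟨f, hf⟩ := key r
  obtain ⟨g, hg⟩ := key (-r)
  have hr' : bf b c d (-r) = 0 := by rw [bf_neg_right, hr, neg_zero]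
  obtain ⟨x, hx⟩ := exists_act_eq (b := b) (c := c) f g
    (fun v => by rw [hf, hg, siegel_add_right hd hr hr', add_neg_cancel, siegel_zero_right])
    (fun v => by rw [hf, hg, siegel_add_right hd hr' hr, neg_add_cancel, siegel_zero_right])
    (fun v => by rw [hf, qf_siegel hd hr])
  exact ⟨x, fun v => by rw [hx, hf]⟩

/-- The subgroup `H` contains the Siegel transformation attached to `d` and `r`. -/
def HasSiegel (H : Subgroup (OG b c)) (d r : Fin 8 → F) : Prop :=
  ∃ g ∈ H, ∀ v, act b c g v = siegel b c d r v

namespace HasSiegel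

variable {H : Subgroup (OG b c)} {d r r' : Fin 8 → F}

theorem congr (h : HasSiegel H d r) {d' r' : Fin 8 → F} (hd : d' = d) (hr : r' = r) :
    HasSiegel H d' r' := by subst hd hr; exact h

theorem of_siegel_eq (h : HasSiegel H d r) {d' r' : Fin 8 → F}
    (heq : ∀ v, siegel b c d' r' v = siegel b c d r v) : HasSiegel H d' r' := by
  obtain ⟨g, hg, hv⟩ := h
  exact ⟨g, hg, fun v => by rw [hv, heq]⟩

theorem zero (d : Fin 8 → F) : HasSiegel H d 0 :=
  ⟨1, H.one_mem, fun v => by rw [siegel_zero_right, act_one_apply]⟩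

theorem add (hd : qf b c d = 0) (hr : bf b c d r = 0) (hr' : bf b c d r' = 0)
    (h : HasSiegel H d r) (h' : HasSiegel H d r') : HasSiegel H d (r + r') := by
  obtain ⟨g, hg, hv⟩ := h
  obtain ⟨g', hg', hv'⟩ := h'
  exact ⟨g * g', H.mul_mem hg hg', fun v => by
    rw [act_mul_apply, hv', hv, siegel_add_right hd hr hr']⟩

theorem neg (hd : qf b c d = 0) (hr : bf b c d r = 0) (h : HasSiegel H d r) :
    HasSiegel H d (-r) := by
  obtain ⟨g, hg, hv⟩ := h
  have hr' : bf b c d (-r) = 0 := by rw [bf_neg_right, hr, neg_zero]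
  refine ⟨g⁻¹, H.inv_mem hg, fun v => ?_⟩
  have : act b c g (siegel b c d (-r) v) = v := by
    rw [hv, siegel_add_right hd hr hr', add_neg_cancel, siegel_zero_right]
  rw [← this, act_inv_act, this]

theorem sub (hd : qf b c d = 0) (hr : bf b c d r = 0) (hr' : bf b c d r' = 0)
    (h : HasSiegel H d r) (h' : HasSiegel H d r') : HasSiegel H d (r - r') := by
  rw [sub_eq_add_neg]
  exact h.add hd hr (by rw [bf_neg_right, hr', neg_zero]) (h'.neg hd hr')

theorem conj (h : HasSiegel H d r) {g : OG b c} (hg : g ∈ H) :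
    HasSiegel H (act b c g d) (act b c g r) := by
  obtain ⟨k, hk, hv⟩ := h
  refine ⟨g * k * g⁻¹, H.mul_mem (H.mul_mem hg hk) (H.inv_mem hg), fun v => ?_⟩
  rw [act_mul_apply, act_mul_apply, hv, act_siegel]

theorem conj_siegel (h : HasSiegel H d r) {d' r' : Fin 8 → F} (h' : HasSiegel H d' r') :
    HasSiegel H (siegel b c d' r' d) (siegel b c d' r' r) := by
  obtain ⟨g, hg, hv⟩ := h'
  rw [← hv, ← hv]
  exact h.conj hg

theorem swap (hd : qf b c d = 0) (hr : qf b c r = 0) (h : HasSiegel H d r) :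
    HasSiegel H r (-d) := h.of_siegel_eq (siegel_swap hd hr)

theorem smul_right {t : F} (h : HasSiegel H (t • d) r) : HasSiegel H d (t • r) :=
  h.of_siegel_eq fun v => (siegel_smul_left t d r v).symm

theorem add_smul (hd : qf b c d = 0) (hr : bf b c d r = 0) (h : HasSiegel H d r) (t : F) :
    HasSiegel H d (r + t • d) := h.of_siegel_eq (siegel_add_smul hd hr t)

end HasSiegel

end OrthEight

namespace OrthEight

variable {F : Type*} [Field F] {b c : F}

/-- The standard basis vectors, in the order `e₁, e₂, e₃, f₁, f₂, f₃, v₁, w`. -/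
def ε (i : Fin 8) : Fin 8 → F := Pi.single i 1

theorem ext8 {F : Type*} {u v : Fin 8 → F} (h0 : u 0 = v 0) (h1 : u 1 = v 1) (h2 : u 2 = v 2)
    (h3 : u 3 = v 3) (h4 : u 4 = v 4) (h5 : u 5 = v 5) (h6 : u 6 = v 6) (h7 : u 7 = v 7) :
    u = v := by
  ext i; fin_cases i <;> assumption

theorem ε_apply (i j : Fin 8) : (ε i : Fin 8 → F) j = if j = i then 1 else 0 := by
  simp [ε, Pi.single_apply]

section basis

variable (v : Fin 8 → F)

theorem bf_ε0 : bf b c v (ε 0) = v 3 := by simp [bf, ε_apply]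
theorem bf_ε1 : bf b c v (ε 1) = v 4 := by simp [bf, ε_apply]
theorem bf_ε2 : bf b c v (ε 2) = v 5 := by simp [bf, ε_apply]
theorem bf_ε3 : bf b c v (ε 3) = v 0 := by simp [bf, ε_apply]
theorem bf_ε4 : bf b c v (ε 4) = v 1 := by simp [bf, ε_apply]
theorem bf_ε5 : bf b c v (ε 5) = v 2 := by simp [bf, ε_apply]
theorem bf_ε6 : bf b c v (ε 6) = -2 * v 6 + b * v 7 := by simp [bf, ε_apply]
theorem bf_ε7 : bf b c v (ε 7) = b * v 6 + 2 * c * v 7 := by simp [bf, ε_apply]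

theorem bf_ε0' : bf b c (ε 0) v = v 3 := by rw [bf_comm, bf_ε0]
theorem bf_ε1' : bf b c (ε 1) v = v 4 := by rw [bf_comm, bf_ε1]
theorem bf_ε2' : bf b c (ε 2) v = v 5 := by rw [bf_comm, bf_ε2]
theorem bf_ε3' : bf b c (ε 3) v = v 0 := by rw [bf_comm, bf_ε3]
theorem bf_ε4' : bf b c (ε 4) v = v 1 := by rw [bf_comm, bf_ε4]
theorem bf_ε5' : bf b c (ε 5) v = v 2 := by rw [bf_comm, bf_ε5]

theorem qf_ε (i : Fin 8) (hi : i < 6) : qf b c (ε i) = 0 := by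
  fin_cases i <;> simp_all [qf, ε_apply]

end basis

/-- The subgroup `H` contains all Siegel transformations attached to the six isotropic basis
vectors. -/
def Full (H : Subgroup (OG b c)) : Prop :=
  ∀ i : Fin 8, i < 6 → ∀ r, bf b c (ε i) r = 0 → HasSiegel H (ε i) r

theorem siegel_self {d r : Fin 8 → F} (hd : qf b c d = 0) (hr : bf b c d r = 0) :
    siegel b c d r d = d := by
  simp [siegel, bf_self, hd, hr]

theorem siegel_fix {d r v : Fin 8 → F} (hd : bf b c v d = 0) (hr : bf b c v r = 0) :
    siegel b c d r v = v := by
  simp [siegel, hd, hr]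

/-- A vector whose `e`-coefficient with respect to a hyperbolic pair `(e, f)` is `1` can be moved
into the hyperbolic plane. -/
theorem exists_move {H : Subgroup (OG b c)} {e f : Fin 8 → F} (he : qf b c e = 0)
    (hf : qf b c f = 0) (hef : bf b c e f = 1)
    (hH : ∀ r, bf b c f r = 0 → HasSiegel H f r) {α : Fin 8 → F} (hα : bf b c α f = 1) :
    ∃ h ∈ H, act b c h α = e + qf b c α • f ∧ act b c h f = f ∧
      ∀ u, bf b c u f = 0 → bf b c u α = 0 → bf b c u e = 0 → act b c h u = u := by
  have hfe : bf b c f e = 1 := by rw [bf_comm, hef]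
  have hfα : bf b c f α = 1 := by rw [bf_comm, hα]
  have hff : bf b c f f = 0 := by rw [bf_self, hf, mul_zero]
  have hr : bf b c f (-(α - e - bf b c α e • f)) = 0 := by simp [hfe, hfα, hff]
  obtain ⟨h, hh, hv⟩ := hH _ hr
  refine ⟨h, hh, ?_, ?_, ?_⟩
  · rw [hv]
    ext i
    simp only [siegel, bf_neg_right, bf_sub_right, bf_smul_right, qf_neg, qf_sub, qf_smul,
      bf_sub_left, hα, hef, he, hf, bf_self, Pi.add_apply, Pi.sub_apply, Pi.smul_apply,
      Pi.neg_apply, smul_eq_mul]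
    ring
  · rw [hv, siegel_self hf hr]
  · intro u h1 h2 h3
    rw [hv, siegel_fix h1]
    simp [h1, h2, h3]

/-- Anisotropy of the binary part of the model form. -/
def Aniso (b c : F) : Prop := ∀ s t : F, -s ^ 2 + b * s * t + c * t ^ 2 = 0 → s = 0 ∧ t = 0

theorem exists_coeff_one {H : Subgroup (OG b c)} (hH : Full H) {u : Fin 8 → F}
    (hu : u 1 ≠ 0 ∨ u 2 ≠ 0 ∨ u 4 ≠ 0 ∨ u 5 ≠ 0) : ∃ h ∈ H, act b c h u 0 = 1 := by
  rcases hu with hu | hu | hu | hu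
  · obtain ⟨h, hh, hv⟩ := hH 0 (by decide) (((u 0 - 1) / u 1) • ε 4) (by simp [bf_ε0', ε_apply])
    exact ⟨h, hh, by rw [hv]; simp [siegel, bf_ε0, bf_ε4, ε_apply, qf_ε]; field_simp; ring⟩
  · obtain ⟨h, hh, hv⟩ := hH 0 (by decide) (((u 0 - 1) / u 2) • ε 5) (by simp [bf_ε0', ε_apply])
    exact ⟨h, hh, by rw [hv]; simp [siegel, bf_ε0, bf_ε5, ε_apply, qf_ε]; field_simp; ring⟩
  · obtain ⟨h, hh, hv⟩ := hH 0 (by decide) (((u 0 - 1) / u 4) • ε 1) (by simp [bf_ε0', ε_apply])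
    exact ⟨h, hh, by rw [hv]; simp [siegel, bf_ε0, bf_ε1, ε_apply, qf_ε]; field_simp; ring⟩
  · obtain ⟨h, hh, hv⟩ := hH 0 (by decide) (((u 0 - 1) / u 5) • ε 2) (by simp [bf_ε0', ε_apply])
    exact ⟨h, hh, by rw [hv]; simp [siegel, bf_ε0, bf_ε2, ε_apply, qf_ε]; field_simp; ring⟩

theorem exists_act_eq_ε0 (hA : Aniso b c) {H : Subgroup (OG b c)} (hH : Full H) {u : Fin 8 → F}
    (hu : u ≠ 0) (hq : qf b c u = 0) : ∃ h ∈ H, act b c h u = ε 0 := by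
  have h1 : ∃ h ∈ H, act b c h u 0 = 1 := by
    by_cases hu' : u 1 ≠ 0 ∨ u 2 ≠ 0 ∨ u 4 ≠ 0 ∨ u 5 ≠ 0
    · exact exists_coeff_one hH hu'
    · push Not at hu'
      obtain ⟨u1, u2, u4, u5⟩ := hu'
      have : ∃ h ∈ H, act b c h u 1 ≠ 0 := by
        by_cases u0 : u 0 = 0
        · have u3 : u 3 ≠ 0 := fun u3 => by
            have h67 := hA (u 6) (u 7) (by simpa [qf, u0, u1, u2] using hq)
            exact hu (ext8 u0 u1 u2 u3 u4 u5 h67.1 h67.2)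
          obtain ⟨h, hh, hv⟩ := hH 1 (by decide) (ε 0) (by simp [bf_ε1', ε_apply])
          exact ⟨h, hh, by rw [hv]; simpa [siegel, bf_ε0, bf_ε1, ε_apply, qf_ε, u1, u4] using u3⟩
        · obtain ⟨h, hh, hv⟩ := hH 1 (by decide) (ε 3) (by simp [bf_ε1', ε_apply])
          exact ⟨h, hh, by rw [hv]; simpa [siegel, bf_ε3, bf_ε1, ε_apply, qf_ε, u1, u4] using u0⟩
      obtain ⟨h, hh, h1⟩ := this
      obtain ⟨k, hk, h2⟩ := exists_coeff_one hH (Or.inl h1)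
      exact ⟨k * h, H.mul_mem hk hh, by rw [act_mul_apply, h2]⟩
  obtain ⟨h, hh, h1⟩ := h1
  obtain ⟨k, hk, h2, -, -⟩ := exists_move (e := ε 0) (f := ε 3) (qf_ε 0 (by decide))
    (qf_ε 3 (by decide)) (by simp [bf_ε3, ε_apply]) (hH 3 (by decide))
    (α := act b c h u) (by rw [bf_ε3, h1])
  exact ⟨k * h, H.mul_mem hk hh, by rw [act_mul_apply, h2, qf_act, hq, zero_smul, add_zero]⟩

theorem exists_act_eq_ε1 (hA : Aniso b c) {H : Subgroup (OG b c)} (hH : Full H) {u : Fin 8 → F}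
    (hu : u ≠ 0) (hq : qf b c u = 0) (u0 : u 0 = 0) (u3 : u 3 = 0) :
    ∃ h ∈ H, act b c h u = ε 1 ∧ act b c h (ε 0) = ε 0 ∧ act b c h (ε 3) = ε 3 := by
  have key : ∀ u : Fin 8 → F, u 2 ≠ 0 ∨ u 5 ≠ 0 → ∃ h ∈ H, act b c h u 1 = 1 ∧
      act b c h (ε 0) = ε 0 ∧ act b c h (ε 3) = ε 3 := by
    rintro u (hu | hu)
    · obtain ⟨h, hh, hv⟩ := hH 1 (by decide) (((u 1 - 1) / u 2) • ε 5) (by simp [bf_ε1', ε_apply])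
      refine ⟨h, hh, ?_, ?_, ?_⟩
      · rw [hv]; simp [siegel, bf_ε1, bf_ε5, ε_apply, qf_ε]; field_simp; ring
      all_goals rw [hv, siegel_fix] <;> simp [bf_ε1, bf_ε5, ε_apply]
    · obtain ⟨h, hh, hv⟩ := hH 1 (by decide) (((u 1 - 1) / u 5) • ε 2) (by simp [bf_ε1', ε_apply])
      refine ⟨h, hh, ?_, ?_, ?_⟩
      · rw [hv]; simp [siegel, bf_ε1, bf_ε2, ε_apply, qf_ε]; field_simp; ring
      all_goals rw [hv, siegel_fix] <;> simp [bf_ε1, bf_ε2, ε_apply]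
  have h1 : ∃ h ∈ H, act b c h u 1 = 1 ∧ act b c h (ε 0) = ε 0 ∧ act b c h (ε 3) = ε 3 := by
    by_cases hu' : u 2 ≠ 0 ∨ u 5 ≠ 0
    · exact key u hu'
    · push Not at hu'
      obtain ⟨u2, u5⟩ := hu'
      have : ∃ h ∈ H, act b c h u 2 ≠ 0 ∧ act b c h (ε 0) = ε 0 ∧ act b c h (ε 3) = ε 3 := by
        by_cases u1 : u 1 = 0
        · have u4 : u 4 ≠ 0 := fun u4 => by
            have h67 := hA (u 6) (u 7) (by simpa [qf, u0, u1, u2] using hq)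
            exact hu (ext8 u0 u1 u2 u3 u4 u5 h67.1 h67.2)
          obtain ⟨h, hh, hv⟩ := hH 2 (by decide) (ε 1) (by simp [bf_ε2', ε_apply])
          refine ⟨h, hh, ?_, ?_, ?_⟩
          · rw [hv]; simpa [siegel, bf_ε1, bf_ε2, ε_apply, qf_ε, u2, u5] using u4
          all_goals rw [hv, siegel_fix] <;> simp [bf_ε1, bf_ε2, ε_apply]
        · obtain ⟨h, hh, hv⟩ := hH 2 (by decide) (ε 4) (by simp [bf_ε2', ε_apply])
          refine ⟨h, hh, ?_, ?_, ?_⟩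
          · rw [hv]; simpa [siegel, bf_ε4, bf_ε2, ε_apply, qf_ε, u2, u5] using u1
          all_goals rw [hv, siegel_fix] <;> simp [bf_ε4, bf_ε2, ε_apply]
      obtain ⟨h, hh, h1, h1', h1''⟩ := this
      obtain ⟨k, hk, h2, h2', h2''⟩ := key _ (Or.inl h1)
      exact ⟨k * h, H.mul_mem hk hh, by rw [act_mul_apply, h2], by rw [act_mul_apply, h1', h2'],
        by rw [act_mul_apply, h1'', h2'']⟩
  obtain ⟨h, hh, h1, h1', h1''⟩ := h1
  obtain ⟨k, hk, h2, -, h3⟩ := exists_move (e := ε 1) (f := ε 4) (qf_ε 1 (by decide))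
    (qf_ε 4 (by decide)) (by simp [bf_ε4, ε_apply]) (hH 4 (by decide))
    (α := act b c h u) (by rw [bf_ε4, h1])
  refine ⟨k * h, H.mul_mem hk hh, by rw [act_mul_apply, h2, qf_act, hq, zero_smul, add_zero], ?_,
    ?_⟩
  · rw [act_mul_apply, h1']
    apply h3
    · simp [bf_ε4, ε_apply]
    · rw [← h1', bf_act, bf_ε0', u3]
    · simp [bf_ε1, ε_apply]
  · rw [act_mul_apply, h1'']
    apply h3
    · simp [bf_ε4, ε_apply]
    · rw [← h1'', bf_act, bf_ε3', u0]
    · simp [bf_ε1, ε_apply]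

/-- The subgroup generated by all Siegel transformations. -/
def siegelSubgroup (b c : F) : Subgroup (OG b c) :=
  Subgroup.closure {g | ∃ d r, qf b c d = 0 ∧ bf b c d r = 0 ∧
    ∀ v, act b c g v = siegel b c d r v}

theorem full_siegelSubgroup : Full (siegelSubgroup b c) := by
  intro i hi r hr
  obtain ⟨g, hg⟩ := exists_siegel (qf_ε i hi) hr
  exact ⟨g, Subgroup.subset_closure ⟨_, _, qf_ε i hi, hr, hg⟩, hg⟩

instance siegelSubgroup_normal : (siegelSubgroup b c).Normal := by
  rw [← Subgroup.normalizer_eq_top_iff, eq_top_iff, siegelSubgroup,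
    Subgroup.le_normalizer_closure_iff]
  rintro h - g ⟨d, r, hd, hr, hg⟩
  refine Subgroup.subset_closure ⟨act b c h d, act b c h r, by simpa using hd, by simpa using hr,
    fun v => ?_⟩
  rw [act_mul_apply, act_mul_apply, hg, act_siegel]

theorem siegelSubgroup_le (hA : Aniso b c) {H : Subgroup (OG b c)} (hH : Full H) :
    siegelSubgroup b c ≤ H := by
  rw [siegelSubgroup, Subgroup.closure_le]
  rintro g ⟨d, r, hd, hr, hg⟩
  by_cases h0 : d = 0
  · have : g = 1 := ext_act fun v => by rw [hg, h0]; simp [siegel]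
    rw [this]; exact H.one_mem
  · obtain ⟨h, hh, he⟩ := exists_act_eq_ε0 hA hH h0 hd
    obtain ⟨k, hk, hv⟩ := hH 0 (by decide) (act b c h r) (by rw [← he, bf_act, hr])
    have : g = h⁻¹ * k * h := ext_act fun v => by
      have h2 := act_siegel h d r (act b c h v)
      rw [act_inv_act, he, ← hv] at h2
      rw [hg, act_mul_apply, act_mul_apply, ← h2, act_inv_act]
    rw [this]
    exact H.mul_mem (H.mul_mem (H.inv_mem hh) hk) hh

end OrthEight

namespace OrthEight

variable {F : Type*} [Field F] {b c : F}

/-- The isometry `g` is the reflection in the nonsingular vector `α`. -/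
def IsReflection (g : OG b c) (α : Fin 8 → F) : Prop :=
  qf b c α ≠ 0 ∧ ∀ v, act b c g v = v - (bf b c v α / qf b c α) • α

theorem exists_reflection {α : Fin 8 → F} (hα : qf b c α ≠ 0) :
    ∃ g : OG b c, IsReflection g α := by
  let f : (Fin 8 → F) →ₗ[F] (Fin 8 → F) :=
    { toFun := fun v => v - (bf b c v α / qf b c α) • α
      map_add' := fun u v => by
        ext i
        simp only [bf_add_left, Pi.add_apply, Pi.sub_apply, Pi.smul_apply, smul_eq_mul]
        ring
      map_smul' := fun t v => by
        ext i
        simp only [bf_smul_left, Pi.sub_apply, Pi.smul_apply, smul_eq_mul, RingHom.id_apply]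
        ring }
  have hf : ∀ v, f v = v - (bf b c v α / qf b c α) • α := fun v => rfl
  have hff : ∀ v, f (f v) = v := fun v => by
    ext i
    simp only [hf, bf_sub_left, bf_smul_left, bf_self, Pi.sub_apply, Pi.smul_apply, smul_eq_mul]
    field_simp
    ring
  obtain ⟨g, hg⟩ := exists_act_eq (b := b) (c := c) f f hff hff fun v => by
    simp only [hf, qf_sub, qf_smul, bf_smul_right]
    field_simp
    ring
  exact ⟨g, hα, fun v => by rw [hg, hf]⟩

namespace IsReflection

variable {g g' : OG b c} {α β : Fin 8 → F}

theorem act_fix (hg : IsReflection g α) {v : Fin 8 → F} (hv : bf b c v α = 0) :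
    act b c g v = v := by simp [hg.2, hv]

theorem act_sub (h : IsReflection g (α - β)) (hαβ : qf b c α = qf b c β) :
    act b c g α = β := by
  have h1 : bf b c α (α - β) = qf b c (α - β) := by
    rw [bf_sub_right, qf_sub, bf_self, ← hαβ]; ring
  rw [h.2, h1, div_self h.1, one_smul, sub_sub_cancel]

theorem conj (hg : IsReflection g α) (h : OG b c) : IsReflection (h * g * h⁻¹) (act b c h α) := by
  refine ⟨by simpa using hg.1, fun v => ?_⟩
  rw [act_mul_apply, act_mul_apply, hg.2, map_sub, map_smul, act_act_inv, qf_act, bf_act_left,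
    inv_inv]

theorem unique (hg : IsReflection g α) (hg' : IsReflection g' α) : g = g' :=
  ext_act fun v => by rw [hg.2, hg'.2]

theorem mul_self (hg : IsReflection g α) : g * g = 1 := ext_act fun v => by
  have := hg.1
  rw [act_mul_apply, hg.2, hg.2, act_one_apply]
  ext i
  simp only [bf_sub_left, bf_smul_left, bf_self, Pi.sub_apply, Pi.smul_apply, smul_eq_mul]
  field_simp
  ring

theorem commute (hg : IsReflection g α) (hg' : IsReflection g' β) (h : bf b c α β = 0) :
    Commute g g' := ext_act fun v => by
  have h' : bf b c β α = 0 := by rw [bf_comm, h]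
  rw [act_mul_apply, act_mul_apply, hg.2, hg'.2, hg.2 v, hg'.2 (v - _)]
  ext i
  simp only [bf_sub_left, bf_smul_left, h, h', Pi.sub_apply, Pi.smul_apply, smul_eq_mul]
  ring

end IsReflection

/-- Reflections in nonsingular vectors orthogonal to the first two hyperbolic planes. -/
def reflectionSet (b c : F) : Set (OG b c) :=
  {g | ∃ α : Fin 8 → F, α 0 = 0 ∧ α 1 = 0 ∧ α 3 = 0 ∧ α 4 = 0 ∧ IsReflection g α}

theorem exists_bf_eq (hn : b ^ 2 + 4 * c ≠ 0) {α : Fin 8 → F} (hα : α ≠ 0) (h0 : α 0 = 0)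
    (h1 : α 1 = 0) (h3 : α 3 = 0) (h4 : α 4 = 0) :
    ∃ r : Fin 8 → F, r 0 = 0 ∧ r 1 = 0 ∧ r 3 = 0 ∧ r 4 = 0 ∧ bf b c α r = -1 := by
  have key : ∀ i : Fin 8, i ≠ 0 → i ≠ 1 → i ≠ 3 → i ≠ 4 → bf b c α (ε i) ≠ 0 →
      ∃ r : Fin 8 → F, r 0 = 0 ∧ r 1 = 0 ∧ r 3 = 0 ∧ r 4 = 0 ∧ bf b c α r = -1 := by
    intro i i0 i1 i3 i4 hi
    refine ⟨(-(bf b c α (ε i))⁻¹) • ε i, ?_, ?_, ?_, ?_, ?_⟩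
    · simp [ε_apply, i0.symm]
    · simp [ε_apply, i1.symm]
    · simp [ε_apply, i3.symm]
    · simp [ε_apply, i4.symm]
    · rw [bf_smul_right, neg_mul, inv_mul_cancel₀ hi]
  by_contra hcon
  have hz : ∀ i : Fin 8, i ≠ 0 → i ≠ 1 → i ≠ 3 → i ≠ 4 → bf b c α (ε i) = 0 :=
    fun i i0 i1 i3 i4 => by_contra fun hi => hcon (key i i0 i1 i3 i4 hi)
  have h5 := hz 2 (by decide) (by decide) (by decide) (by decide)
  have h2 := hz 5 (by decide) (by decide) (by decide) (by decide)
  have h6 := hz 6 (by decide) (by decide) (by decide) (by decide)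
  have h7 := hz 7 (by decide) (by decide) (by decide) (by decide)
  rw [bf_ε2] at h5
  rw [bf_ε5] at h2
  rw [bf_ε6] at h6
  rw [bf_ε7] at h7
  refine hα (ext8 h0 h1 h2 h3 h4 h5 ?_ ?_)
  · exact (mul_eq_zero.1 (show (b ^ 2 + 4 * c) * α 6 = 0 by
      linear_combination (-2 * c) * h6 + b * h7)).resolve_left hn
  · exact (mul_eq_zero.1 (show (b ^ 2 + 4 * c) * α 7 = 0 by
      linear_combination b * h6 + 2 * h7)).resolve_left hn

theorem reflection_normalize (hn : b ^ 2 + 4 * c ≠ 0) {H : Subgroup (OG b c)} (hH : Full H)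
    {α : Fin 8 → F} (hα : α ≠ 0) (h0 : α 0 = 0)
    (h1 : α 1 = 0) (h3 : α 3 = 0) (h4 : α 4 = 0) :
    (∃ h ∈ H, act b c h α = ε 0 + qf b c α • ε 3) ∧
      ∃ h ∈ H, act b c h α = ε 1 + qf b c α • ε 4 := by
  obtain ⟨r, r0, r1, r3, r4, hr⟩ := exists_bf_eq hn hα h0 h1 h3 h4
  constructor
  · obtain ⟨h, hh, hv⟩ := hH 0 (by decide) r (by rw [bf_ε0', r3])
    have hc : act b c h α 0 = 1 := by
      rw [hv]; simp [siegel, bf_ε0, hr, h3, h0, ε_apply]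
    obtain ⟨k, hk, hk', -, -⟩ := exists_move (e := ε 0) (f := ε 3) (qf_ε 0 (by decide))
      (qf_ε 3 (by decide)) (by simp [bf_ε3, ε_apply]) (hH 3 (by decide))
      (α := act b c h α) (by rw [bf_ε3, hc])
    exact ⟨k * h, H.mul_mem hk hh, by rw [act_mul_apply, hk', qf_act]⟩
  · obtain ⟨h, hh, hv⟩ := hH 1 (by decide) r (by rw [bf_ε1', r4])
    have hc : act b c h α 1 = 1 := by
      rw [hv]; simp [siegel, bf_ε1, hr, h4, h1, ε_apply]
    obtain ⟨k, hk, hk', -, -⟩ := exists_move (e := ε 1) (f := ε 4) (qf_ε 1 (by decide))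
      (qf_ε 4 (by decide)) (by simp [bf_ε4, ε_apply]) (hH 4 (by decide))
      (α := act b c h α) (by rw [bf_ε4, hc])
    exact ⟨k * h, H.mul_mem hk hh, by rw [act_mul_apply, hk', qf_act]⟩

theorem reflectionSet_commute (hn : b ^ 2 + 4 * c ≠ 0) {s s' : OG b c}
    (hs : s ∈ reflectionSet b c) (hs' : s' ∈ reflectionSet b c) :
    (s : OG b c ⧸ siegelSubgroup b c) * s' = s' * s := by
  obtain ⟨α, a0, a1, a3, a4, ha⟩ := hs
  obtain ⟨β, b0, b1, b3, b4, hb⟩ := hs'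
  have ne : ∀ {α : Fin 8 → F}, qf b c α ≠ 0 → α ≠ 0 := by rintro _ h rfl; exact h qf_zero
  obtain ⟨h, hh, hα⟩ := (reflection_normalize hn full_siegelSubgroup (ne ha.1) a0 a1 a3 a4).1
  obtain ⟨k, hk, hβ⟩ := (reflection_normalize hn full_siegelSubgroup (ne hb.1) b0 b1 b3 b4).2
  have h1 := ha.conj h
  have h2 := hb.conj k
  rw [hα] at h1
  rw [hβ] at h2
  have hcomm := h1.commute h2 (by simp [bf_ε1, bf_ε4, ε_apply])
  have q1 : (h : OG b c ⧸ siegelSubgroup b c) = 1 := (QuotientGroup.eq_one_iff h).2 hh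
  have q2 : (k : OG b c ⧸ siegelSubgroup b c) = 1 := (QuotientGroup.eq_one_iff k).2 hk
  have := congrArg (fun x : OG b c => (x : OG b c ⧸ siegelSubgroup b c)) hcomm.eq
  simpa [q1, q2] using this

theorem sup_reflectionSet_eq_top (hA : Aniso b c) :
    siegelSubgroup b c ⊔ Subgroup.closure (reflectionSet b c) = ⊤ := by
  set M := siegelSubgroup b c ⊔ Subgroup.closure (reflectionSet b c) with hM
  have hE : ∀ {h}, h ∈ siegelSubgroup b c → h ∈ M := fun hh => le_sup_left (a := siegelSubgroup b c) hh
  have hR : ∀ {h}, h ∈ reflectionSet b c → h ∈ M := fun hh =>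
    le_sup_right (a := siegelSubgroup b c) (Subgroup.subset_closure hh)
  have hFull := full_siegelSubgroup (b := b) (c := c)
  have step : ∀ {h g : OG b c}, h ∈ M → h * g ∈ M → g ∈ M := fun hh hg =>
    (Subgroup.mul_mem_cancel_left M hh).1 hg
  have orth : ∀ (g : OG b c) {u v : Fin 8 → F}, act b c g v = v →
      bf b c (act b c g u) v = bf b c u v := fun g u v hv => by
    conv_lhs => rw [← hv]
    rw [bf_act]
  -- an isometry fixing the basis is trivial
  have s7 : ∀ g : OG b c, act b c g (ε 0) = ε 0 → act b c g (ε 1) = ε 1 → act b c g (ε 2) = ε 2 →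
      act b c g (ε 3) = ε 3 → act b c g (ε 4) = ε 4 → act b c g (ε 5) = ε 5 →
      act b c g (ε 6) = ε 6 → act b c g (ε 7) = ε 7 → g ∈ M := by
    intro g h0 h1 h2 h3 h4 h5 h6 h7
    have : g = 1 := ext_act fun v => by
      have hv : v = v 0 • ε 0 + v 1 • ε 1 + v 2 • ε 2 + v 3 • ε 3 + v 4 • ε 4 + v 5 • ε 5
          + v 6 • ε 6 + v 7 • ε 7 := by apply ext8 <;> simp [ε_apply]
      rw [act_one_apply, hv]
      simp only [map_add, map_smul, h0, h1, h2, h3, h4, h5, h6, h7]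
    rw [this]; exact M.one_mem
  have coords : ∀ (g : OG b c) (u : Fin 8 → F), act b c g (ε 0) = ε 0 → act b c g (ε 1) = ε 1 →
      act b c g (ε 3) = ε 3 → act b c g (ε 4) = ε 4 →
      act b c g u 0 = u 0 ∧ act b c g u 1 = u 1 ∧ act b c g u 3 = u 3 ∧ act b c g u 4 = u 4 := by
    intro g u h0 h1 h3 h4
    have k0 := orth g (u := u) h0
    have k1 := orth g (u := u) h1
    have k3 := orth g (u := u) h3
    have k4 := orth g (u := u) h4
    rw [bf_ε0, bf_ε0] at k0
    rw [bf_ε1, bf_ε1] at k1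
    rw [bf_ε3, bf_ε3] at k3
    rw [bf_ε4, bf_ε4] at k4
    exact ⟨k3, k4, k0, k1⟩
  -- moving `u` to `w` by a reflection
  have move : ∀ u w : Fin 8 → F, u 0 = w 0 → u 1 = w 1 → u 3 = w 3 → u 4 = w 4 → qf b c u = qf b c w → qf b c (u - w) ≠ 0 →
      ∃ s ∈ M, act b c s u = w ∧ ∀ v, bf b c v u = bf b c v w → act b c s v = v := by
    intro u w u0 u1 u3 u4 hq hne
    obtain ⟨s, hs⟩ := exists_reflection hne
    exact ⟨s, hR ⟨_, by simp [u0], by simp [u1], by simp [u3], by simp [u4], hs⟩, hs.act_sub hq,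
      fun v hv => hs.act_fix (by rw [bf_sub_right, hv, sub_self])⟩
  have aniso : ∀ v : Fin 8 → F, v 0 = 0 → v 1 = 0 → v 2 = 0 → v 3 = 0 → v 4 = 0 → v 5 = 0 →
      v ≠ 0 → qf b c v ≠ 0 := by
    intro v h0 h1 h2 h3 h4 h5 hv hq
    have h67 := hA (v 6) (v 7) (by simpa [qf, h0, h1, h2] using hq)
    exact hv (ext8 h0 h1 h2 h3 h4 h5 h67.1 h67.2)
  have coords2 : ∀ (g : OG b c) (u : Fin 8 → F), act b c g (ε 2) = ε 2 → act b c g (ε 5) = ε 5 →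
      act b c g u 2 = u 2 ∧ act b c g u 5 = u 5 := by
    intro g u h2 h5
    have k2 := orth g (u := u) h2
    have k5 := orth g (u := u) h5
    rw [bf_ε2, bf_ε2] at k2
    rw [bf_ε5, bf_ε5] at k5
    exact ⟨k5, k2⟩
  -- a vector orthogonal to the fixed hyperbolic planes can be restored
  have restore : ∀ (g : OG b c) (w : Fin 8 → F), act b c g (ε 0) = ε 0 → act b c g (ε 1) = ε 1 →
      act b c g (ε 2) = ε 2 → act b c g (ε 3) = ε 3 → act b c g (ε 4) = ε 4 →
      act b c g (ε 5) = ε 5 → ∃ s ∈ M, act b c s (act b c g w) = w ∧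
      ∀ v, act b c g v = v → act b c s v = v := by
    intro g w h0 h1 h2 h3 h4 h5
    obtain ⟨c0, c1, c3, c4⟩ := coords g w h0 h1 h3 h4
    obtain ⟨c2, c5⟩ := coords2 g w h2 h5
    by_cases hw : act b c g w - w = 0
    · exact ⟨1, M.one_mem, by rw [act_one_apply, sub_eq_zero.1 hw], fun v _ => act_one_apply v⟩
    · obtain ⟨s, hs, hs1, hs2⟩ := move (act b c g w) w c0 c1 c3 c4 (qf_act g w)
        (aniso _ (by simp [c0]) (by simp [c1]) (by simp [c2]) (by simp [c3]) (by simp [c4])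
          (by simp [c5]) hw)
      exact ⟨s, hs, hs1, fun v hv => hs2 v (by rw [bf_comm, orth g hv, bf_comm])⟩
  have s6 : ∀ g : OG b c, act b c g (ε 0) = ε 0 → act b c g (ε 1) = ε 1 → act b c g (ε 2) = ε 2 →
      act b c g (ε 3) = ε 3 → act b c g (ε 4) = ε 4 → act b c g (ε 5) = ε 5 →
      act b c g (ε 6) = ε 6 → g ∈ M := by
    intro g h0 h1 h2 h3 h4 h5 h6
    obtain ⟨s, hs, hs1, hs2⟩ := restore g (ε 7) h0 h1 h2 h3 h4 h5
    have lift : ∀ v, act b c g v = v → act b c (s * g) v = v := fun v hv => by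
      rw [act_mul_apply, hv, hs2 v hv]
    exact step hs (s7 _ (lift _ h0) (lift _ h1) (lift _ h2) (lift _ h3) (lift _ h4) (lift _ h5)
      (lift _ h6) (by rw [act_mul_apply, hs1]))
  have s5 : ∀ g : OG b c, act b c g (ε 0) = ε 0 → act b c g (ε 1) = ε 1 → act b c g (ε 2) = ε 2 →
      act b c g (ε 3) = ε 3 → act b c g (ε 4) = ε 4 → act b c g (ε 5) = ε 5 → g ∈ M := by
    intro g h0 h1 h2 h3 h4 h5
    obtain ⟨s, hs, hs1, hs2⟩ := restore g (ε 6) h0 h1 h2 h3 h4 h5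
    have lift : ∀ v, act b c g v = v → act b c (s * g) v = v := fun v hv => by
      rw [act_mul_apply, hv, hs2 v hv]
    exact step hs (s6 _ (lift _ h0) (lift _ h1) (lift _ h2) (lift _ h3) (lift _ h4) (lift _ h5)
      (by rw [act_mul_apply, hs1]))
  -- completing a hyperbolic pair
  have complete : ∀ (g : OG b c) (e f : Fin 8 → F), qf b c e = 0 → qf b c f = 0 →
      bf b c f e = 1 → (∀ r, bf b c e r = 0 → HasSiegel (siegelSubgroup b c) e r) →
      act b c g e = e → ∃ s ∈ M, act b c s (act b c g f) = f ∧ act b c s e = e ∧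
      ∀ v, act b c g v = v → bf b c v e = 0 → bf b c v f = 0 → act b c s v = v := by
    intro g e f he hf hfe hfull hge
    obtain ⟨h, hh, k1, k2, k3⟩ := exists_move hf he hfe hfull (α := act b c g f)
      (by rw [orth g hge, hfe])
    refine ⟨h, hE hh, by rw [k1, qf_act, hf, zero_smul, add_zero], k2, fun v hv hve hvf => ?_⟩
    exact k3 v hve (by rw [bf_comm, orth g hv, bf_comm, hvf]) hvf
  have s4 : ∀ g : OG b c, act b c g (ε 0) = ε 0 → act b c g (ε 1) = ε 1 → act b c g (ε 2) = ε 2 →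
      act b c g (ε 3) = ε 3 → act b c g (ε 4) = ε 4 → g ∈ M := by
    intro g h0 h1 h2 h3 h4
    obtain ⟨s, hs, hs1, hs2, hs3⟩ := complete g (ε 2) (ε 5) (qf_ε 2 (by decide))
      (qf_ε 5 (by decide)) (by simp [bf_ε2, ε_apply]) (hFull 2 (by decide)) h2
    have lift : ∀ v, act b c g v = v → bf b c v (ε 2) = 0 → bf b c v (ε 5) = 0 →
        act b c (s * g) v = v := fun v hv k1 k2 => by
      rw [act_mul_apply, hv, hs3 v hv k1 k2]
    exact step hs (s5 _ (lift _ h0 (by simp [bf_ε2, ε_apply]) (by simp [bf_ε5, ε_apply]))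
      (lift _ h1 (by simp [bf_ε2, ε_apply]) (by simp [bf_ε5, ε_apply]))
      (by rw [act_mul_apply, h2, hs2])
      (lift _ h3 (by simp [bf_ε2, ε_apply]) (by simp [bf_ε5, ε_apply]))
      (lift _ h4 (by simp [bf_ε2, ε_apply]) (by simp [bf_ε5, ε_apply]))
      (by rw [act_mul_apply, hs1]))
  have s3' : ∀ g : OG b c, act b c g (ε 0) = ε 0 → act b c g (ε 1) = ε 1 →
      act b c g (ε 3) = ε 3 → act b c g (ε 4) = ε 4 → act b c g (ε 2) 5 ≠ 0 → g ∈ M := by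
    intro g h0 h1 h3 h4 hne
    obtain ⟨c0, c1, c3, c4⟩ := coords g (ε 2) h0 h1 h3 h4
    obtain ⟨s, hs, hs1, hs2⟩ := move (act b c g (ε 2)) (ε 2) c0 c1 c3 c4
      (qf_act g _) (by rw [qf_sub, qf_act, qf_ε 2 (by decide), bf_ε2]; simpa using hne)
    have lift : ∀ v, act b c g v = v → act b c (s * g) v = v := fun v hv => by
      rw [act_mul_apply, hv, hs2 v (by rw [bf_comm, orth g hv, bf_comm])]
    exact step hs (s4 _ (lift _ h0) (lift _ h1) (by rw [act_mul_apply, hs1]) (lift _ h3)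
      (lift _ h4))
  have s3 : ∀ g : OG b c, act b c g (ε 0) = ε 0 → act b c g (ε 1) = ε 1 →
      act b c g (ε 3) = ε 3 → act b c g (ε 4) = ε 4 → g ∈ M := by
    intro g h0 h1 h3 h4
    by_cases hne : act b c g (ε 2) 5 = 0
    · obtain ⟨c0, c1, c3, c4⟩ := coords g (ε 2) h0 h1 h3 h4
      have hq := qf_act g (ε 2)
      simp only [ε_apply] at c0 c1 c3 c4
      have h67 := hA _ _ (by
        have hq' := hq
        rw [qf_ε 2 (by decide)] at hq'
        simpa [qf, c0, c1, hne] using hq')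
      have hne2 : act b c g (ε 2) 2 ≠ 0 := fun h => by
        have hz : act b c g (ε 2) = 0 := ext8 c0 c1 h c3 c4 hne h67.1 h67.2
        have := act_inv_act g (ε 2)
        rw [hz, map_zero] at this
        have := congrFun this 2
        simp [ε_apply] at this
      obtain ⟨s, hs⟩ := exists_reflection (b := b) (c := c) (α := ε 2 - ε 5) (by
        simp [qf, ε_apply])
      have fix : ∀ v, act b c g v = v → bf b c v (ε 2) = 0 → bf b c v (ε 5) = 0 →
          act b c (s * g) v = v := fun v hv k1 k2 => by
        rw [act_mul_apply, hv, hs.act_fix (by rw [bf_sub_right, k1, k2, sub_zero])]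
      refine step (hR ⟨_, by simp [ε_apply], by simp [ε_apply], by simp [ε_apply],
        by simp [ε_apply], hs⟩) (s3' _ (fix _ h0 (by simp [bf_ε2, ε_apply])
          (by simp [bf_ε5, ε_apply])) (fix _ h1 (by simp [bf_ε2, ε_apply])
          (by simp [bf_ε5, ε_apply])) (fix _ h3 (by simp [bf_ε2, ε_apply])
          (by simp [bf_ε5, ε_apply])) (fix _ h4 (by simp [bf_ε2, ε_apply])
          (by simp [bf_ε5, ε_apply])) ?_)
      have e5 : act b c (s * g) (ε 2) 5 = act b c g (ε 2) 2 := by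
        rw [act_mul_apply, hs.2]
        simp [bf_ε2, bf_ε5, qf_sub, qf_ε, ε_apply, hne]
      rw [e5]; exact hne2
    · exact s3' g h0 h1 h3 h4 hne
  have s2 : ∀ g : OG b c, act b c g (ε 0) = ε 0 → act b c g (ε 1) = ε 1 →
      act b c g (ε 3) = ε 3 → g ∈ M := by
    intro g h0 h1 h3
    obtain ⟨s, hs, hs1, hs2, hs3⟩ := complete g (ε 1) (ε 4) (qf_ε 1 (by decide))
      (qf_ε 4 (by decide)) (by simp [bf_ε1, ε_apply]) (hFull 1 (by decide)) h1
    refine step hs (s3 _ ?_ (by rw [act_mul_apply, h1, hs2]) ?_ (by rw [act_mul_apply, hs1]))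
    · rw [act_mul_apply, h0, hs3 _ h0 (by simp [bf_ε1, ε_apply]) (by simp [bf_ε4, ε_apply])]
    · rw [act_mul_apply, h3, hs3 _ h3 (by simp [bf_ε1, ε_apply]) (by simp [bf_ε4, ε_apply])]
  have ne0 : ∀ (g : OG b c) (i : Fin 8), act b c g (ε i) ≠ 0 := fun g i h => by
    have := act_inv_act g (ε i)
    rw [h, map_zero] at this
    have := congrFun this i
    simp [ε_apply] at this
  have s1 : ∀ g : OG b c, act b c g (ε 0) = ε 0 → act b c g (ε 3) = ε 3 → g ∈ M := by
    intro g h0 h3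
    have k0 := orth g (u := ε 1) h0
    have k3 := orth g (u := ε 1) h3
    rw [bf_ε0, bf_ε0] at k0
    rw [bf_ε3, bf_ε3] at k3
    obtain ⟨s, hs, e1, e2, e3⟩ := exists_act_eq_ε1 hA hFull (ne0 g 1)
      (by rw [qf_act, qf_ε 1 (by decide)]) (by rw [k3]; simp [ε_apply])
      (by rw [k0]; simp [ε_apply])
    exact step (hE hs) (s2 _ (by rw [act_mul_apply, h0, e2]) (by rw [act_mul_apply, e1])
      (by rw [act_mul_apply, h3, e3]))
  have s0 : ∀ g : OG b c, act b c g (ε 0) = ε 0 → g ∈ M := by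
    intro g h0
    obtain ⟨s, hs, hs1, hs2, -⟩ := complete g (ε 0) (ε 3) (qf_ε 0 (by decide))
      (qf_ε 3 (by decide)) (by simp [bf_ε0, ε_apply]) (hFull 0 (by decide)) h0
    exact step hs (s1 _ (by rw [act_mul_apply, h0, hs2]) (by rw [act_mul_apply, hs1]))
  rw [eq_top_iff]
  intro g _
  obtain ⟨s, hs, e1⟩ := exists_act_eq_ε0 hA hFull (ne0 g 0) (by rw [qf_act, qf_ε 0 (by decide)])
  exact step (hE hs) (s0 _ (by rw [act_mul_apply, e1]))

theorem commutator_le_siegelSubgroup (hA : Aniso b c) (hn : b ^ 2 + 4 * c ≠ 0) :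
    commutator (OG b c) ≤ siegelSubgroup b c := by
  have hgen : Subgroup.closure ((QuotientGroup.mk' (siegelSubgroup b c)) '' reflectionSet b c) = ⊤ := by
    have h := congrArg (Subgroup.map (QuotientGroup.mk' (siegelSubgroup b c)))
      (sup_reflectionSet_eq_top hA)
    rw [Subgroup.map_sup, QuotientGroup.map_mk'_self, bot_sup_eq, MonoidHom.map_closure,
      Subgroup.map_top_of_surjective _ (QuotientGroup.mk'_surjective _)] at h
    exact h
  have hcomm : ∀ x y : OG b c ⧸ siegelSubgroup b c, x * y = y * x := by
    have h1 : ∀ x y : OG b c ⧸ siegelSubgroup b c, Commute x y := by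
      intro x y
      have hx : x ∈ Subgroup.closure ((QuotientGroup.mk' (siegelSubgroup b c)) '' reflectionSet b c) := by
        rw [hgen]; trivial
      have hy : y ∈ Subgroup.closure ((QuotientGroup.mk' (siegelSubgroup b c)) '' reflectionSet b c) := by
        rw [hgen]; trivial
      induction hx, hy using Subgroup.closure_induction₂ with
      | mem x y hx hy =>
        obtain ⟨s, hs, rfl⟩ := hx
        obtain ⟨s', hs', rfl⟩ := hy
        exact reflectionSet_commute hn hs hs'
      | one_left x _ => exact Commute.one_left x
      | one_right x _ => exact Commute.one_right x
      | mul_left x y z _ _ _ h1 h2 => exact h1.mul_left h2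
      | mul_right y z x _ _ _ h1 h2 => exact h1.mul_right h2
      | inv_left x y _ _ h => exact h.inv_left
      | inv_right x y _ _ h => exact h.inv_right
    exact fun x y => (h1 x y).eq
  rw [commutator_def, Subgroup.commutator_le]
  intro x _ y _
  rw [← QuotientGroup.eq_one_iff, ← QuotientGroup.mk'_apply, map_commutatorElement,
    commutatorElement_eq_one_iff_mul_comm]
  exact hcomm _ _

theorem commutator_le_of_full (hA : Aniso b c) (hn : b ^ 2 + 4 * c ≠ 0) {H : Subgroup (OG b c)}
    (hH : Full H) : commutator (OG b c) ≤ H :=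
  (commutator_le_siegelSubgroup hA hn).trans (siegelSubgroup_le hA hH)

end OrthEight

namespace OrthEight

open Polynomial

variable {F : Type*} [Field F] {b c m d : F}

/-- The involution of the generating pair. -/
def xFun (b c m d : F) (v : Fin 8 → F) : Fin 8 → F :=
  ![m * v 1 - c * v 2 + d * v 3 + v 5 + b * v 6 - (2 * c + b ^ 2) * v 7,
    m * v 2 - v 4,
    v 3,
    v 2,
    -v 1 + m * v 3,
    v 0 + (2 * c + b ^ 2 - d - m ^ 2) * v 2 - c * v 3 + m * v 4 + b * v 6 + 2 * c * v 7,
    -b * v 3 - v 6 + b * v 7,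
    v 2 - v 3 + v 7]

/-- The element of order three of the generating pair. -/
def yFun (v : Fin 8 → F) : Fin 8 → F := ![v 2, v 0, v 1, v 5, v 3, v 4, v 6, v 7]

theorem exists_x (b c m d : F) : ∃ x : OG b c, ∀ v, act b c x v = xFun b c m d v := by
  let f : (Fin 8 → F) →ₗ[F] (Fin 8 → F) :=
    { toFun := xFun b c m d
      map_add' := fun u v => by apply ext8 <;> simp [xFun] <;> ring
      map_smul' := fun t v => by apply ext8 <;> simp [xFun] <;> ring }
  have hff : ∀ v, f (f v) = v := fun v => by
    apply ext8 <;> simp [f, xFun] <;> ring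
  obtain ⟨g, hg⟩ := exists_act_eq (b := b) (c := c) f f hff hff fun v => by
    simp [f, xFun, qf]; ring
  exact ⟨g, hg⟩

theorem exists_y (b c : F) : ∃ y : OG b c, ∀ v, act b c y v = yFun v := by
  let f : (Fin 8 → F) →ₗ[F] (Fin 8 → F) :=
    { toFun := yFun
      map_add' := fun u v => by apply ext8 <;> simp [yFun]
      map_smul' := fun t v => by apply ext8 <;> simp [yFun] }
  obtain ⟨g, hg⟩ := exists_act_eq (b := b) (c := c) f (f ∘ₗ f)
    (fun v => by apply ext8 <;> simp [f, yFun]) (fun v => by apply ext8 <;> simp [f, yFun])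
    fun v => by simp [f, yFun, qf]; ring
  exact ⟨g, hg⟩

theorem isCoprime_of_eq_C {p q u v : F[X]} {k : F} (hk : k ≠ 0) (h : u * p + v * q = C k) :
    IsCoprime p q := by
  refine ⟨C k⁻¹ * u, C k⁻¹ * v, ?_⟩
  rw [mul_assoc, mul_assoc, ← mul_add, h, ← C_mul, inv_mul_cancel₀ hk, C_1]

theorem isCoprime_X_sub_C {p : F[X]} {a : F} (h : p.eval a ≠ 0) : IsCoprime p (X - C a) :=
  ((irreducible_X_sub_C a).coprime_iff_not_dvd.2 fun h' => h (dvd_iff_isRoot.1 h')).symm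

/-- The quadratic factor of the polynomial of `x * y`. -/
noncomputable def quadPoly (m : F) : F[X] := X ^ 2 - C m * X + 1

/-- The quartic factor of the polynomial of `x * y`. -/
noncomputable def quartPoly (b c : F) : F[X] :=
  X ^ 4 + C c * X ^ 3 + C (2 * c + b ^ 2 - 2) * X ^ 2 + C c * X + 1

theorem quadPoly_separable (hm : 4 - m ^ 2 ≠ 0) : (quadPoly m).Separable := by
  refine isCoprime_of_eq_C (u := 4) (v := -(2 * X - C m)) hm ?_
  simp only [quadPoly, derivative_add, derivative_X_pow, derivative_C_mul, derivative_X,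
    derivative_one, map_sub, map_pow]
  have h4 : (C 4 : F[X]) = 4 := rfl
  simp only [h4, Nat.cast_ofNat, map_ofNat]
  ring

theorem quartPoly_separable (hb : b ≠ 0) (hn : b ^ 2 + 4 * c ≠ 0)
    (h : IsCoprime (quartPoly b c) (2 * X ^ 2 + C c * X + 2)) : (quartPoly b c).Separable := by
  have h1 : IsCoprime (quartPoly b c) (X - C 1) := isCoprime_X_sub_C (by
    simp only [quartPoly, eval_add, eval_mul, eval_pow, eval_C, eval_X, eval_one]
    convert hn using 1; ring)
  have h2 : IsCoprime (quartPoly b c) (X - C (-1)) := isCoprime_X_sub_C (by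
    simp only [quartPoly, eval_add, eval_mul, eval_pow, eval_C, eval_X, eval_one]
    convert pow_ne_zero 2 hb using 1; ring)
  have h3 := h.mul_right (h1.mul_right h2)
  have h4 : (2 * X ^ 2 + C c * X + 2) * ((X - C 1) * (X - C (-1))) =
      X * derivative (quartPoly b c) + quartPoly b c * (-2) := by
    simp only [quartPoly, derivative_add, derivative_X_pow, derivative_C_mul, derivative_X,
      derivative_one, Nat.cast_ofNat]
    simp only [map_sub, map_pow, map_neg, map_one, map_add, map_mul, map_ofNat]
    ring
  rw [h4] at h3
  exact (IsCoprime.of_add_mul_left_right h3).of_mul_right_right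

theorem quadPoly_quartPoly_isCoprime (hD : m ^ 2 + c * m + 2 * c + b ^ 2 - 4 ≠ 0) :
    IsCoprime (quadPoly m) (quartPoly b c) := by
  have h1 : IsCoprime (quadPoly m) X := ⟨1, C m - X, by rw [quadPoly]; ring⟩
  have h2 : IsCoprime (quadPoly m) (C (m ^ 2 + c * m + 2 * c + b ^ 2 - 4) * X ^ 2) :=
    IsCoprime.mul_right (isCoprime_of_eq_C (u := 0) (v := 1) hD (by ring)) h1.pow_right
  have h3 : quartPoly b c = C (m ^ 2 + c * m + 2 * c + b ^ 2 - 4) * X ^ 2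
      + quadPoly m * (X ^ 2 + C (m + c) * X + 1) := by
    simp only [quartPoly, quadPoly, map_add, map_sub, map_mul, map_pow, map_ofNat]
    ring
  rw [h3]
  exact h2.add_mul_left_right _

/-- A separable polynomial over a finite field with nonzero constant term divides `X ^ N - 1` for
some `N` prime to the characteristic. -/
theorem exists_dvd_X_pow_sub_one [Finite F] {f : F[X]} (hf : f.Separable) (h0 : f.eval 0 ≠ 0) :
    ∃ N : ℕ, (N : F) ≠ 0 ∧ f ∣ X ^ N - 1 := by
  have hf0 : f ≠ 0 := hf.ne_zero
  obtain ⟨p, hp⟩ := CharP.exists F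
  have : Fact p.Prime := ⟨CharP.char_is_prime F p⟩
  have : Finite (AdjoinRoot f) := by
    have : Module.Finite F (AdjoinRoot f) := PowerBasis.finite (AdjoinRoot.powerBasis hf0)
    exact Module.finite_of_finite F
  have hu : IsUnit (AdjoinRoot.root f) := by
    obtain ⟨u, v, huv⟩ := isCoprime_X_sub_C h0
    rw [C_0, sub_zero] at huv
    have := congrArg (AdjoinRoot.mk f) huv
    rw [map_add, map_mul, map_mul, AdjoinRoot.mk_self, mul_zero, zero_add, AdjoinRoot.mk_X,
      map_one] at this
    exact IsUnit.of_mul_eq_one_right _ this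
  have hdvd : ∀ n : ℕ, f ∣ X ^ n - 1 ↔ hu.unit ^ n = 1 := fun n => by
    rw [← AdjoinRoot.mk_eq_zero, map_sub, map_pow, AdjoinRoot.mk_X, map_one, sub_eq_zero,
      Units.ext_iff, Units.val_pow_eq_pow_val, IsUnit.unit_spec, Units.val_one]
  refine ⟨orderOf hu.unit, fun hN => ?_, (hdvd _).2 (pow_orderOf_eq_one _)⟩
  rw [CharP.cast_eq_zero_iff F p] at hN
  obtain ⟨k, hk⟩ := hN
  have hpos := orderOf_pos hu.unit
  have h1 : f ∣ (X ^ k - 1) ^ p := by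
    have h2 := (hdvd _).2 (pow_orderOf_eq_one hu.unit)
    rwa [hk, mul_comm p k, pow_mul, ← one_pow p, ← sub_pow_char] at h2
  rw [hf.squarefree.dvd_pow_iff_dvd (Fact.out : p.Prime).ne_zero, hdvd] at h1
  have h2 := Nat.le_of_dvd (Nat.pos_of_ne_zero fun h => by simp [hk, h] at hpos)
    (orderOf_dvd_of_pow_eq_one h1)
  have h3 : 2 ≤ p := (Fact.out : p.Prime).two_le
  have h4 : 0 < k := Nat.pos_of_ne_zero fun h => by simp [hk, h] at hpos
  nlinarith

/-- Up to an invertible factor, the polynomial `P R` evaluated at `x * y` has rank two. -/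
theorem aeval_quad_quart {x y : OG b c} (hx : ∀ v, act b c x v = xFun b c m d v)
    (hy : ∀ v, act b c y v = yFun v) {k : F}
    (hk : k = d * (2 * c + b ^ 2 - d - m ^ 2) - m ^ 2 - 3 * c * m - c ^ 2 - (2 * c + b ^ 2))
    (v : Fin 8 → F) :
    aeval (act b c (x * y)) (quadPoly m * quartPoly b c) v =
      act b c (x * y) (act b c (x * y) (act b c (x * y)
        ((k * (m * v 1 - 2 * v 3)) • ε 0 + (k * (m * v 3 - 2 * v 1)) • ε 4))) := by
  set z := x * y with hz
  have hzv : ∀ v, act b c z v = xFun b c m d (yFun v) := fun v => by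
    rw [hz, act_mul_apply, hy, hx]
  have hxx : ∀ v, act b c x (act b c x v) = v := fun v => by
    rw [hx, hx]; apply ext8 <;> simp [xFun] <;> ring
  have hyyy : ∀ v, act b c y (act b c y (act b c y v)) = v := fun v => by
    rw [hy, hy, hy]; apply ext8 <;> simp [yFun]
  have hziv : ∀ v, act b c z⁻¹ v = yFun (yFun (xFun b c m d v)) := fun v => by
    have : v = act b c z (yFun (yFun (xFun b c m d v))) := by
      rw [← hx, ← hy, ← hy, hz, act_mul_apply, hyyy, hxx]
    conv_lhs => rw [this]
    rw [act_inv_act]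
  -- the operator `z + z⁻¹`
  let T : (Fin 8 → F) → (Fin 8 → F) := fun v => act b c z v + act b c z⁻¹ v
  have hT : ∀ v, T v =
      ![m * v 0 - c * v 1 + m * v 2 + d * v 5 + b * v 6 - (2 * c + b ^ 2) * v 7,
        m * v 1,
        m * v 1 - c * v 2 + d * v 3 + 2 * v 5 + b * v 6 - (2 * c + b ^ 2) * v 7,
        m * v 3,
        (2 * c + b ^ 2 - d - m ^ 2) * v 2 - c * v 3 + m * v 4 + m * v 5 + b * v 6 + 2 * c * v 7,
        2 * v 2 + (2 * c + b ^ 2 - d - m ^ 2) * v 1 - c * v 5 + m * v 3 + b * v 6 + 2 * c * v 7,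
        -b * v 3 - b * v 5 - 2 * v 6 + 2 * b * v 7,
        v 1 + v 2 - v 3 - v 5 + 2 * v 7] := fun v => by
    simp only [T, hzv, hziv]
    apply ext8 <;> simp [xFun, yFun] <;> ring
  let S : (Fin 8 → F) → (Fin 8 → F) := fun v => T (T v) + c • T v + (2 * c + b ^ 2 - 4) • v
  have hS : T (S v) - m • S v =
      (k * (m * v 1 - 2 * v 3)) • ε 0 + (k * (m * v 3 - 2 * v 1)) • ε 4 := by
    simp only [S, hT, hk]
    apply ext8 <;> simp [ε_apply, -Matrix.cons_add, -Matrix.add_cons,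
      -Matrix.smul_cons, -Matrix.cons_sub, -Matrix.sub_cons] <;> ring
  have hquad : ∀ u, aeval (act b c z) (quadPoly m) u = act b c z (T u - m • u) := fun u => by
    simp [quadPoly, T, pow_two, Module.algebraMap_end_apply]
    abel
  have hquart : ∀ u, aeval (act b c z) (quartPoly b c) u = act b c z (act b c z (S u)) := fun u => by
    simp [quartPoly, S, T, pow_succ, Module.algebraMap_end_apply]
    module
  have hTz : ∀ u, T (act b c z u) = act b c z (T u) := fun u => by simp [T]
  rw [map_mul, Module.End.mul_apply, hquart, hquad, hTz, hTz, ← map_smul, ← map_smul, ← map_sub,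
    ← map_sub, hS]

/-- A suitable power of `x * y` is a nontrivial long root element. -/
theorem exists_pow_eq_siegel [Finite F] {x y : OG b c} (hx : ∀ v, act b c x v = xFun b c m d v)
    (hy : ∀ v, act b c y v = yFun v)
    (hk : d * (2 * c + b ^ 2 - d - m ^ 2) - m ^ 2 - 3 * c * m - c ^ 2 - (2 * c + b ^ 2) ≠ 0)
    (hm : m ≠ 0 ∨ (2 : F) ≠ 0) (hsep : (quadPoly m * quartPoly b c).Separable) :
    ∃ (N : ℕ) (t : F), (N : F) ≠ 0 ∧ t ≠ 0 ∧
      ∀ v, act b c ((x * y) ^ N) v = siegel b c (ε 0) (t • ε 4) v := by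
  obtain ⟨N, hN, g, hg⟩ := exists_dvd_X_pow_sub_one hsep (by simp [quadPoly, quartPoly])
  set f := quadPoly m * quartPoly b c with hf
  set Z := act b c (x * y) with hZ
  have hK := aeval_quad_quart hx hy rfl
  rw [← hf, ← hZ] at hK
  have hZ0 : Z (ε 0) = m • ε 0 - ε 4 := by
    rw [hZ, act_mul_apply, hy, hx]; apply ext8 <;> simp [xFun, yFun, ε_apply]
  have hZ4 : Z (ε 4) = ε 0 := by
    rw [hZ, act_mul_apply, hy, hx]; apply ext8 <;> simp [xFun, yFun, ε_apply]
  have hspan : ∀ p q : F, ∃ p' q' : F, Z (p • ε 0 + q • ε 4) = p' • ε 0 + q' • ε 4 := fun p q =>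
    ⟨p * m + q, -p, by rw [map_add, map_smul, map_smul, hZ0, hZ4]; module⟩
  have hrange : ∀ v, ∃ p q : F, aeval Z f v = p • ε 0 + q • ε 4 := fun v => by
    rw [hK]
    obtain ⟨p, q, h1⟩ := hspan _ _
    obtain ⟨p', q', h2⟩ := hspan p q
    obtain ⟨p'', q'', h3⟩ := hspan p' q'
    exact ⟨p'', q'', by rw [h1, h2, h3]⟩
  have hker : ∀ v : Fin 8 → F, v 1 = 0 → v 3 = 0 → aeval Z f v = 0 := fun v h1 h3 => by
    rw [hK]; simp [h1, h3]
  have hpow : ∀ v, act b c ((x * y) ^ N) v - v = aeval Z (f * g) v := fun v => by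
    rw [← hg, map_pow, ← hZ]; simp
  have hfg : ∀ v, act b c ((x * y) ^ N) v - v = aeval Z f (aeval Z g v) := fun v => by
    rw [hpow, map_mul, Module.End.mul_apply]
  have hgf : ∀ v, act b c ((x * y) ^ N) v - v = aeval Z g (aeval Z f v) := fun v => by
    rw [hpow, mul_comm f g, map_mul, Module.End.mul_apply]
  have hfix : ∀ v : Fin 8 → F, v 1 = 0 → v 3 = 0 → act b c ((x * y) ^ N) v = v :=
    fun v h1 h3 => sub_eq_zero.1 (by rw [hgf, hker v h1 h3, map_zero])
  obtain ⟨α, β, h1⟩ := hrange (aeval Z g (ε 1))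
  obtain ⟨γ, t, h3⟩ := hrange (aeval Z g (ε 3))
  rw [← hfg, sub_eq_iff_eq_add] at h1 h3
  have hβ : β = 0 := by
    have := qf_act ((x * y) ^ N) (ε 1)
    rw [h1] at this
    simpa [qf, ε_apply] using this
  have hγ : γ = 0 := by
    have := qf_act ((x * y) ^ N) (ε 3)
    rw [h3] at this
    simpa [qf, ε_apply] using this
  have hα : α = -t := by
    have := bf_act ((x * y) ^ N) (ε 1) (ε 3)
    rw [h1, h3] at this
    simp [bf, ε_apply] at this
    linear_combination this
  have hact : ∀ v, act b c ((x * y) ^ N) v = siegel b c (ε 0) (t • ε 4) v := fun v => by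
    have hv : v = (v - v 1 • ε 1 - v 3 • ε 3) + v 1 • ε 1 + v 3 • ε 3 := by abel
    conv_lhs => rw [hv]
    rw [map_add, map_add, map_smul, map_smul, h1, h3, hα, hβ, hγ,
      hfix _ (by simp [ε_apply]) (by simp [ε_apply])]
    simp only [siegel, bf_smul_right, qf_smul, bf_ε0, bf_ε4, qf_ε 4 (by decide)]
    module
  refine ⟨N, t, hN, fun ht => ?_, hact⟩
  have hone : ∀ v, aeval Z g (aeval Z f v) = 0 := fun v => by
    rw [← hgf, hact, ht, zero_smul, siegel_zero_right, sub_self]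
  have hsepN : (X ^ N - 1 : F[X]).Separable := by
    simpa using separable_X_pow_sub_C (1 : F) hN one_ne_zero
  rw [hg] at hsepN
  obtain ⟨u, v, huv⟩ := hsepN.isCoprime
  have hzero : aeval Z f (ε 1) = 0 := by
    have h := congrArg (fun p => aeval Z p (aeval Z f (ε 1))) huv
    simp only [map_add, map_mul, map_one, LinearMap.add_apply, Module.End.mul_apply,
      Module.End.one_apply, hone, map_zero, add_zero] at h
    obtain ⟨p, q, hpq⟩ := hrange (ε 1)
    rw [← h, hpq, hker _ (by simp [ε_apply]) (by simp [ε_apply]), map_zero]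
  rw [hK] at hzero
  have inj : ∀ v, Z v = 0 → v = 0 := fun v hv => by
    rw [← act_inv_act (x * y) v, ← hZ, hv, map_zero]
  have h0 := inj _ (inj _ (inj _ hzero))
  have e0 := congrFun h0 0
  have e4 := congrFun h0 4
  simp [ε_apply] at e0 e4
  rcases hm with hm | hm
  · exact e0.elim hk hm
  · exact e4.elim hk hm

end OrthEight

namespace OrthEight

variable {F : Type*} [Field F] {b c : F}

/-- If conjugation by the Siegel transformation of `(d', r')` fixes `d` and adds `s` to `r`, then
the commutator is the Siegel transformation of `(d, s)`. -/
theorem HasSiegel.comm {H : Subgroup (OG b c)} {d r d' r' s : Fin 8 → F} (h : HasSiegel H d r)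
    (h' : HasSiegel H d' r') (hd : qf b c d = 0) (hr : bf b c d r = 0)
    (e1 : siegel b c d' r' d = d) (e2 : siegel b c d' r' r = r + s) : HasSiegel H d s := by
  have h1 := h.conj_siegel h'
  have hrs : bf b c d (r + s) = 0 := by
    obtain ⟨g, -, hg⟩ := h'
    rw [← e2, ← hg]
    nth_rewrite 1 [← e1]
    rw [← hg, bf_act, hr]
  rw [e1, e2] at h1
  simpa using h1.sub hd hrs hr h

@[simp] theorem yFun_ε0 : yFun (ε 0 : Fin 8 → F) = ε 1 := by apply ext8 <;> simp [yFun, ε_apply]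
@[simp] theorem yFun_ε1 : yFun (ε 1 : Fin 8 → F) = ε 2 := by apply ext8 <;> simp [yFun, ε_apply]
@[simp] theorem yFun_ε2 : yFun (ε 2 : Fin 8 → F) = ε 0 := by apply ext8 <;> simp [yFun, ε_apply]
@[simp] theorem yFun_ε3 : yFun (ε 3 : Fin 8 → F) = ε 4 := by apply ext8 <;> simp [yFun, ε_apply]
@[simp] theorem yFun_ε4 : yFun (ε 4 : Fin 8 → F) = ε 5 := by apply ext8 <;> simp [yFun, ε_apply]
@[simp] theorem yFun_ε5 : yFun (ε 5 : Fin 8 → F) = ε 3 := by apply ext8 <;> simp [yFun, ε_apply]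
@[simp] theorem yFun_ε6 : yFun (ε 6 : Fin 8 → F) = ε 6 := by apply ext8 <;> simp [yFun, ε_apply]
@[simp] theorem yFun_ε7 : yFun (ε 7 : Fin 8 → F) = ε 7 := by apply ext8 <;> simp [yFun, ε_apply]

@[simp] theorem yFun_add (u v : Fin 8 → F) : yFun (u + v) = yFun u + yFun v := by
  apply ext8 <;> simp [yFun]
@[simp] theorem yFun_sub (u v : Fin 8 → F) : yFun (u - v) = yFun u - yFun v := by
  apply ext8 <;> simp [yFun]
@[simp] theorem yFun_neg (u : Fin 8 → F) : yFun (-u) = -yFun u := by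
  apply ext8 <;> simp [yFun]
@[simp] theorem yFun_smul (t : F) (u : Fin 8 → F) : yFun (t • u) = t • yFun u := by
  apply ext8 <;> simp [yFun]

theorem HasSiegel.conj_y {H : Subgroup (OG b c)} {y : OG b c} (hyH : y ∈ H)
    (hy : ∀ v, act b c y v = yFun v) {d r : Fin 8 → F} (h : HasSiegel H d r) :
    HasSiegel H (yFun d) (yFun r) := by
  rw [← hy, ← hy]; exact h.conj hyH

theorem HasSiegel.neg_left {H : Subgroup (OG b c)} {d r : Fin 8 → F} (h : HasSiegel H (-d) r) :
    HasSiegel H d (-r) := by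
  rw [← neg_one_smul F d] at h
  simpa using h.smul_right

/-- For singular basis vectors the two arguments may be exchanged. -/
theorem HasSiegel.swap_smul {H : Subgroup (OG b c)} {d r : Fin 8 → F}
    (hd : qf b c d = 0) (hr : qf b c r = 0) (h : ∀ t : F, HasSiegel H d (t • r)) (t : F) :
    HasSiegel H r (t • d) := by
  have h1 := (h (-t)).swap hd (by simp [hr])
  simpa using h1.smul_right

/-- Siegel transformations attached to a few root groups suffice. -/
theorem full_of_hasSiegel {H : Subgroup (OG b c)} (hb : b ≠ 0) {y : OG b c} (hyH : y ∈ H)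
    (hy : ∀ v, act b c y v = yFun v) (h1 : ∀ t : F, HasSiegel H (ε 0) (t • ε 4))
    (h2 : ∀ t : F, HasSiegel H (ε 0) (t • ε 5)) (h3 : ∀ t : F, HasSiegel H (ε 0) (t • ε 1))
    (h4 : ∀ t : F, HasSiegel H (ε 3) (t • ε 4)) (h5 : ∀ t : F, HasSiegel H (ε 0) (t • ε 7))
    (h6 : ∀ t : F, HasSiegel H (ε 0) (t • (ε 7 + b • ε 6))) : Full H := by
  have q : ∀ i : Fin 8, i < 6 → qf b c (ε i) = 0 := qf_ε
  have h3' : ∀ t : F, HasSiegel H (ε 0) (t • ε 2) := fun t => by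
    have := HasSiegel.swap_smul (q 0 (by decide)) (q 1 (by decide)) h3 t
    simpa using (this.conj_y hyH hy).conj_y hyH hy
  have h4' : ∀ t : F, HasSiegel H (ε 3) (t • ε 5) := fun t => by
    have := HasSiegel.swap_smul (q 3 (by decide)) (q 4 (by decide)) h4 t
    simpa using (this.conj_y hyH hy).conj_y hyH hy
  have h31 : ∀ t : F, HasSiegel H (ε 3) (t • ε 1) := fun t =>
    HasSiegel.swap_smul (q 1 (by decide)) (q 3 (by decide))
      (fun s => by simpa using (h2 s).conj_y hyH hy) t
  have h32 : ∀ t : F, HasSiegel H (ε 3) (t • ε 2) := fun t =>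
    HasSiegel.swap_smul (q 2 (by decide)) (q 3 (by decide))
      (fun s => by simpa using ((h1 s).conj_y hyH hy).conj_y hyH hy) t
  have h06 : ∀ t : F, HasSiegel H (ε 0) (t • ε 6) := fun t => by
    have := (h6 (t / b)).sub (q 0 (by decide)) (by simp [bf_ε0', ε_apply])
      (by simp [bf_ε0', ε_apply]) (h5 (t / b))
    refine this.congr rfl ?_
    apply ext8 <;> simp [ε_apply]
    field_simp
  -- transport from `e₁` to `f₁`
  have hmove : ∀ r : Fin 8 → F, r 0 = 0 → r 1 = 0 → r 3 = 0 → r 4 = 0 → HasSiegel H (ε 0) r →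
      HasSiegel H (ε 4) (-r) := by
    intro r r0 r1 r3 r4 hr
    have k1 : HasSiegel H (ε 4) (ε 3) := by
      simpa using HasSiegel.swap_smul (q 3 (by decide)) (q 4 (by decide)) h4 1
    have k2 : HasSiegel H (ε 0) (-ε 1) := by simpa using h3 (-1)
    have := (hr.conj_siegel k1).conj_siegel k2
    refine HasSiegel.neg_left (this.congr ?_ ?_)
    · apply ext8 <;> simp [siegel, bf, qf, ε_apply]
    · apply ext8 <;> simp [siegel, bf, qf, ε_apply, r0, r1, r3, r4]
  have hy' : ∀ r : Fin 8 → F, HasSiegel H (ε 4) r → HasSiegel H (ε 3) (yFun (yFun r)) := fun r hr => by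
    simpa using (hr.conj_y hyH hy).conj_y hyH hy
  have h36 : ∀ t : F, HasSiegel H (ε 3) (t • ε 6) := fun t => by
    simpa using hy' _ (hmove ((-t) • ε 6) (by simp [ε_apply]) (by simp [ε_apply])
      (by simp [ε_apply]) (by simp [ε_apply]) (h06 (-t)))
  have h37 : ∀ t : F, HasSiegel H (ε 3) (t • ε 7) := fun t => by
    simpa using hy' _ (hmove ((-t) • ε 7) (by simp [ε_apply]) (by simp [ε_apply])
      (by simp [ε_apply]) (by simp [ε_apply]) (h5 (-t)))
  have full0 : ∀ r : Fin 8 → F, r 3 = 0 → HasSiegel H (ε 0) r := by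
    intro r hr
    have hq := q 0 (by decide)
    refine HasSiegel.congr (HasSiegel.add_smul hq ?_ (HasSiegel.add hq ?_ ?_
      (HasSiegel.add hq ?_ ?_ (HasSiegel.add hq ?_ ?_ (HasSiegel.add hq ?_ ?_
      (HasSiegel.add hq ?_ ?_ (h3 (r 1)) (h3' (r 2))) (h1 (r 4))) (h2 (r 5))) (h06 (r 6)))
      (h5 (r 7))) (r 0)) rfl ?_
    on_goal -1 => apply ext8 <;> simp [ε_apply, hr]
    all_goals simp [bf_ε0', ε_apply]
  have full3 : ∀ r : Fin 8 → F, r 0 = 0 → HasSiegel H (ε 3) r := by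
    intro r hr
    have hq := q 3 (by decide)
    refine HasSiegel.congr (HasSiegel.add_smul hq ?_ (HasSiegel.add hq ?_ ?_
      (HasSiegel.add hq ?_ ?_ (HasSiegel.add hq ?_ ?_ (HasSiegel.add hq ?_ ?_
      (HasSiegel.add hq ?_ ?_ (h31 (r 1)) (h32 (r 2))) (h4 (r 4))) (h4' (r 5))) (h36 (r 6)))
      (h37 (r 7))) (r 3)) rfl ?_
    on_goal -1 => apply ext8 <;> simp [ε_apply, hr]
    all_goals simp [bf_ε3', ε_apply]
  have yyy : ∀ r : Fin 8 → F, yFun (yFun (yFun r)) = r := fun r => by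
    apply ext8 <;> simp [yFun]
  have full1 : ∀ r : Fin 8 → F, r 4 = 0 → HasSiegel H (ε 1) r := fun r hr => by
    simpa [yyy] using (full0 (yFun (yFun r)) (by simpa [yFun] using hr)).conj_y hyH hy
  have full2 : ∀ r : Fin 8 → F, r 5 = 0 → HasSiegel H (ε 2) r := fun r hr => by
    simpa [yyy] using (full1 (yFun (yFun r)) (by simpa [yFun] using hr)).conj_y hyH hy
  have full4 : ∀ r : Fin 8 → F, r 1 = 0 → HasSiegel H (ε 4) r := fun r hr => by
    simpa [yyy] using (full3 (yFun (yFun r)) (by simpa [yFun] using hr)).conj_y hyH hy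
  have full5 : ∀ r : Fin 8 → F, r 2 = 0 → HasSiegel H (ε 5) r := fun r hr => by
    simpa [yyy] using (full4 (yFun (yFun r)) (by simpa [yFun] using hr)).conj_y hyH hy
  intro i hi r hr
  fin_cases i
  · exact full0 r (by simpa [bf_ε0'] using hr)
  · exact full1 r (by simpa [bf_ε1'] using hr)
  · exact full2 r (by simpa [bf_ε2'] using hr)
  · exact full3 r (by simpa [bf_ε3'] using hr)
  · exact full4 r (by simpa [bf_ε4'] using hr)
  · exact full5 r (by simpa [bf_ε5'] using hr)
  · exact absurd hi (by decide)
  · exact absurd hi (by decide)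

end OrthEight

namespace OrthEight

variable {F : Type*} [Field F] {b c m d : F}

theorem HasSiegel.conj_x {H : Subgroup (OG b c)} {x : OG b c} (hxH : x ∈ H)
    (hx : ∀ v, act b c x v = xFun b c m d v) {u r : Fin 8 → F} (h : HasSiegel H u r) :
    HasSiegel H (xFun b c m d u) (xFun b c m d r) := by
  rw [← hx, ← hx]; exact h.conj hxH

theorem HasSiegel.swap_coeff {H : Subgroup (OG b c)} {u r : Fin 8 → F} {t : F}
    (hu : qf b c u = 0) (hr : qf b c r = 0) (hur : bf b c u r = 0) (h : HasSiegel H u (t • r)) :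
    HasSiegel H r (t • u) := by
  have h1 := (h.swap hu (by simp [hr])).smul_right
  simpa using h1.neg hr (by simp [bf_comm r u, hur])

/-- The parameters of the root elements attached to `u` and `r` that lie in `H`. -/
def rootParams (H : Subgroup (OG b c)) (u r : Fin 8 → F) (hu : qf b c u = 0)
    (hr : bf b c u r = 0) : AddSubgroup F where
  carrier := {t | HasSiegel H u (t • r)}
  zero_mem' := by simpa using HasSiegel.zero u
  add_mem' := fun {s t} hs ht => by
    have := HasSiegel.add hu (by simp [hr]) (by simp [hr]) hs ht
    rwa [← _root_.add_smul] at this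
  neg_mem' := fun {t} ht => by
    have := HasSiegel.neg hu (by simp [hr]) ht
    rwa [← neg_smul] at this

theorem mem_of_mul_mem [Finite F] (A : AddSubgroup F) {l : F} (hl : l ≠ 0)
    (h : ∀ t ∈ A, l * t ∈ A) {t : F} (ht : l * t ∈ A) : t ∈ A := by
  have hinj : Function.Injective (fun s : A => (⟨l * s.1, h _ s.2⟩ : A)) := fun s s' hs => by
    exact Subtype.ext (mul_left_cancel₀ hl (congrArg Subtype.val hs))
  obtain ⟨s, hs⟩ := (Finite.injective_iff_surjective.mp hinj) ⟨l * t, ht⟩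
  have : s.1 = t := by simpa [hl] using congrArg Subtype.val hs
  exact this ▸ s.2

section

variable {H : Subgroup (OG b c)} {y : OG b c} {s t : F}

theorem HasSiegel.root_mul (hyH : y ∈ H) (hy : ∀ v, act b c y v = yFun v)
    (hs : HasSiegel H (ε 0) (s • ε 4)) (ht : HasSiegel H (ε 0) (t • ε 4)) :
    HasSiegel H (ε 0) ((s * t) • ε 5) := by
  have h' : HasSiegel H (ε 1) (t • ε 5) := by simpa using ht.conj_y hyH hy
  refine hs.comm h' (qf_ε 0 (by decide)) (by simp [bf_ε0', ε_apply]) ?_ ?_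
  · apply ext8 <;> simp [siegel, bf, qf, ε_apply]
  · apply ext8 <;> simp [siegel, bf, qf, ε_apply]

theorem HasSiegel.root_mul' (hyH : y ∈ H) (hy : ∀ v, act b c y v = yFun v)
    (hs : HasSiegel H (ε 0) (s • ε 5)) (ht : HasSiegel H (ε 0) (t • ε 5)) :
    HasSiegel H (ε 0) ((s * t) • ε 4) := by
  have h' : HasSiegel H (ε 2) (t • ε 4) := by simpa using (ht.conj_y hyH hy).conj_y hyH hy
  refine hs.comm h' (qf_ε 0 (by decide)) (by simp [bf_ε0', ε_apply]) ?_ ?_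
  · apply ext8 <;> simp [siegel, bf, qf, ε_apply]
  · apply ext8 <;> simp [siegel, bf, qf, ε_apply]

end

set_option maxHeartbeats 2000000 in
theorem full_of_root_of_two_ne_zero [Finite F] {H : Subgroup (OG b c)} {x y : OG b c} (hb : b ≠ 0)
    (hc : c ≠ 0) (hxH : x ∈ H) (hyH : y ∈ H) (hx : ∀ v, act b c x v = xFun b c 0 0 v)
    (hy : ∀ v, act b c y v = yFun v) {a : F} (ha : a ≠ 0) (hroot : HasSiegel H (ε 0) (a • ε 4))
    (hgen : ∀ A : AddSubgroup F, (∃ t ∈ A, t ≠ 0) → (∀ t ∈ A, (2 * c + b ^ 2) * t ∈ A) → A = ⊤) :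
    Full H := by
  have q : ∀ i : Fin 8, i < 6 → qf b c (ε i) = 0 := qf_ε
  have Y : ∀ {u r : Fin 8 → F}, HasSiegel H u r → HasSiegel H (yFun u) (yFun r) :=
    fun h => h.conj_y hyH hy
  have X : ∀ {u r : Fin 8 → F}, HasSiegel H u r →
      HasSiegel H (xFun b c 0 0 u) (xFun b c 0 0 r) := fun h => h.conj_x hxH hx
  set g := 2 * c + b ^ 2 with hg
  -- the elements attached to `f₂`
  have A1 : ∀ s : F, HasSiegel H (ε 0) (s • ε 5) →
      HasSiegel H (ε 4) (s • (ε 7 + b • ε 6 + c • ε 5)) := by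
    intro s hs
    have h1 : HasSiegel H (ε 1) (s • ε 3) := by simpa using Y hs
    have h2 : HasSiegel H (ε 4) (s • ε 2) :=
      HasSiegel.swap_coeff (q 2 (by decide)) (q 4 (by decide)) (by simp [bf_ε2', ε_apply])
        (by simpa using Y h1)
    have h3 : HasSiegel H (ε 4) (-(s • (ε 2 - ε 7 - b • ε 6 - c • ε 5))) := by
      apply HasSiegel.neg_left
      refine (X h1).congr ?_ ?_
      · apply ext8 <;> simp [xFun, ε_apply]
      · apply ext8 <;> simp [xFun, ε_apply] <;> ring
    refine (h3.add (q 4 (by decide)) ?_ ?_ h2).congr rfl ?_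
    · simp [bf_ε4', ε_apply]
    · simp [bf_ε4', ε_apply]
    · apply ext8 <;> simp [ε_apply]
  have A2 : ∀ s t : F, HasSiegel H (ε 0) (s • ε 5) → HasSiegel H (ε 0) (t • ε 4) →
      HasSiegel H (ε 4) ((c * s * t) • ε 3) := by
    intro s t hs ht
    have h1 : HasSiegel H (ε 2) (t • ε 3) := by simpa using Y (Y ht)
    refine (A1 s hs).comm h1 (q 4 (by decide)) ?_ ?_ ?_
    · simp [bf_ε4', ε_apply]
    · apply ext8 <;> simp [siegel, bf, qf, ε_apply]
    · apply ext8 <;> simp [siegel, bf, qf, ε_apply, mul_comm s c]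
  have A3 : ∀ s t s' : F, HasSiegel H (ε 0) (s • ε 5) → HasSiegel H (ε 0) (t • ε 4) →
      HasSiegel H (ε 0) (s' • ε 5) → HasSiegel H (ε 4) ((c * s * t * s') • ε 5) := by
    intro s t s' hs ht hs'
    refine (A2 s t hs ht).comm hs' (q 4 (by decide)) ?_ ?_ ?_
    · simp [bf_ε4', ε_apply]
    · apply ext8 <;> simp [siegel, bf, qf, ε_apply]
    · apply ext8 <;> simp [siegel, bf, qf, ε_apply]
  have R : ∀ r : F, HasSiegel H (ε 4) (r • ε 3) → HasSiegel H (ε 4) (r • ε 5) := fun r h =>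
    HasSiegel.swap_coeff (q 5 (by decide)) (q 4 (by decide)) (by simp [bf_ε5', ε_apply])
      (by simpa using Y h)
  have A4 : ∀ s t t' : F, HasSiegel H (ε 0) (s • ε 5) → HasSiegel H (ε 0) (t • ε 4) →
      HasSiegel H (ε 0) (t' • ε 4) → HasSiegel H (ε 4) ((c * s * t * t') • ε 5) := by
    intro s t t' hs ht ht'
    have h1 : HasSiegel H (ε 2) (t' • ε 3) := by simpa using Y (Y ht')
    refine R _ ((R _ (A2 s t hs ht)).comm h1 (q 4 (by decide)) ?_ ?_ ?_)
    · simp [bf_ε4', ε_apply]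
    · apply ext8 <;> simp [siegel, bf, qf, ε_apply]
    · apply ext8 <;> simp [siegel, bf, qf, ε_apply]
  have A5 : ∀ s s' t : F, HasSiegel H (ε 0) (s • ε 5) → HasSiegel H (ε 0) (s' • ε 5) →
      HasSiegel H (ε 0) (t • ε 4) → HasSiegel H (ε 0) ((s * s' * t) • ε 5) ∧
      HasSiegel H (ε 4) ((s * s' * t) • (ε 7 + b • ε 6)) := by
    intro s s' t hs hs' ht
    have h1 := (hs.root_mul' hyH hy hs').root_mul hyH hy ht
    refine ⟨h1, ((A1 _ h1).sub (q 4 (by decide)) ?_ ?_ (A3 s t s' hs ht hs')).congr rfl ?_⟩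
    · simp [bf_ε4', ε_apply]
    · simp [bf_ε4', ε_apply]
    · apply ext8 <;> simp [ε_apply]
      ring
  have A6 : ∀ r : F, HasSiegel H (ε 4) (r • (ε 7 + b • ε 6)) →
      HasSiegel H (ε 1) (r • (ε 7 + g • ε 5 - (2 * c) • ε 0)) := by
    intro r h
    have h1 : HasSiegel H (ε 1) (-(r • (ε 7 + g • ε 5 - (2 * c) • ε 0))) := by
      apply HasSiegel.neg_left
      refine (X h).congr ?_ ?_
      · apply ext8 <;> simp [xFun, ε_apply]
      · apply ext8 <;> simp [xFun, ε_apply, hg] <;> ring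
    simpa using h1.neg (q 1 (by decide)) (by simp [bf_ε1', ε_apply])
  have E1 : ∀ r : F, HasSiegel H (ε 4) (r • ε 5) → HasSiegel H (ε 1) (r • ε 0) := by
    intro r h
    have h1 : HasSiegel H (ε 1) (-(r • ε 0)) := by
      apply HasSiegel.neg_left
      refine (X h).congr ?_ ?_
      · apply ext8 <;> simp [xFun, ε_apply]
      · apply ext8 <;> simp [xFun, ε_apply]
    simpa using h1.neg (q 1 (by decide)) (by simp [bf_ε1', ε_apply])
  have E2 : ∀ r : F, HasSiegel H (ε 1) (r • ε 0) → HasSiegel H (ε 1) (r • ε 2) := fun r h =>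
    HasSiegel.swap_coeff (q 2 (by decide)) (q 1 (by decide)) (by simp [bf_ε2', ε_apply])
      (by simpa using Y h)
  have A7 : ∀ s s' t t' : F, HasSiegel H (ε 0) (s • ε 5) → HasSiegel H (ε 0) (s' • ε 5) →
      HasSiegel H (ε 0) (t • ε 4) → HasSiegel H (ε 0) (t' • ε 4) →
      HasSiegel H (ε 0) ((g * (s * s' * t * t')) • ε 5) := by
    intro s s' t t' hs hs' ht ht'
    obtain ⟨h1, h2⟩ := A5 s s' t hs hs' ht
    have h3 := E2 _ (E1 _ (R _ (A2 _ _ h1 ht')))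
    have h4 : HasSiegel H (ε 2) (t' • ε 3) := by simpa using Y (Y ht')
    have h5 : HasSiegel H (ε 1) ((s * s' * t * t') • (g • ε 3 + (2 * c) • ε 2)) := by
      refine (A6 _ h2).comm h4 (q 1 (by decide)) ?_ ?_ ?_
      · simp [bf_ε1', ε_apply]
      · apply ext8 <;> simp [siegel, bf, qf, ε_apply]
      · apply ext8 <;> simp [siegel, bf, qf, ε_apply] <;> ring
    have h6 : HasSiegel H (ε 1) ((g * (s * s' * t * t')) • ε 3) := by
      refine ((h5.sub (q 1 (by decide)) ?_ ?_ h3).sub (q 1 (by decide)) ?_ ?_ h3).congr rfl ?_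
      any_goals simp [bf_ε1', ε_apply]; done
      apply ext8 <;> simp [ε_apply] <;> ring
    simpa using Y (Y h6)
  have M : ∀ r r' : F, HasSiegel H (ε 1) (r' • ε 0) → HasSiegel H (ε 4) (r • ε 5) →
      HasSiegel H (ε 0) ((r' * r) • ε 5) := by
    intro r r' h' h
    have h1 : HasSiegel H (ε 0) (r' • ε 1) :=
      HasSiegel.swap_coeff (q 1 (by decide)) (q 0 (by decide)) (by simp [bf_ε1', ε_apply]) h'
    refine h1.comm h (q 0 (by decide)) ?_ ?_ ?_
    · simp [bf_ε0', ε_apply]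
    · apply ext8 <;> simp [siegel, bf, qf, ε_apply]
    · apply ext8 <;> simp [siegel, bf, qf, ε_apply]
  have haa := hroot.root_mul hyH hy hroot
  set K' := rootParams H (ε 0) (ε 5) (q 0 (by decide)) (by simp [bf_ε0', ε_apply]) with hK'
  have hm : ∀ t, t ∈ K' ↔ HasSiegel H (ε 0) (t • ε 5) := fun t => Iff.rfl
  have hca4 : ∀ t ∈ K', c ^ 2 * a ^ 4 * t ∈ K' := fun t ht => by
    have := M _ _ (E1 _ (R _ (A2 _ _ haa hroot))) (R _ (A2 t a ht hroot))
    refine this.congr rfl ?_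
    congr 1; ring
  have hca5 : ∀ t ∈ K', c ^ 2 * a ^ 4 * (a * t) ∈ K' := fun t ht => by
    have := M _ _ (E1 _ (R _ (A2 _ _ haa hroot))) (A4 t a a ht hroot hroot)
    refine this.congr rfl ?_
    congr 1; ring
  have ha' : ∀ t ∈ K', a * t ∈ K' := fun t ht =>
    mem_of_mul_mem K' (by simp [ha, hc]) hca4 (hca5 t ht)
  have hg' : ∀ t ∈ K', g * t ∈ K' := fun t ht => by
    have h1 : a ^ 4 * (g * t) ∈ K' := by
      refine (A7 t _ _ _ ht haa hroot hroot).congr rfl ?_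
      congr 1; ring
    refine mem_of_mul_mem K' (pow_ne_zero 4 ha) (fun s hs => ?_) h1
    have := ha' _ (ha' _ (ha' _ (ha' _ hs)))
    convert this using 1; ring
  have hK'top := hgen K' ⟨a * a, haa, by simp [ha]⟩ hg'
  have k2 : ∀ t : F, HasSiegel H (ε 0) (t • ε 5) := fun t => (hm t).mp (hK'top ▸ AddSubgroup.mem_top t)
  have k1 : ∀ t : F, HasSiegel H (ε 0) (t • ε 4) := fun t => by
    simpa using (k2 t).root_mul' hyH hy (k2 1)
  have f21 : ∀ t : F, HasSiegel H (ε 4) (t • ε 3) := fun t => by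
    simpa [mul_div_cancel₀ _ hc] using A2 (t / c) 1 (k2 _) (k1 _)
  have e21 : ∀ t : F, HasSiegel H (ε 1) (t • ε 0) := fun t => E1 t (R t (f21 t))
  have e12 : ∀ t : F, HasSiegel H (ε 0) (t • ε 1) :=
    HasSiegel.swap_smul (q 1 (by decide)) (q 0 (by decide)) e21
  have f2w : ∀ t : F, HasSiegel H (ε 4) (t • (ε 7 + b • ε 6)) := fun t => by
    simpa using (A5 t 1 1 (k2 _) (k2 _) (k1 _)).2
  refine full_of_hasSiegel hb hyH hy k1 k2 e12
    (HasSiegel.swap_smul (q 4 (by decide)) (q 3 (by decide)) f21) (fun t => ?_) (fun t => ?_)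
  · have h1 : HasSiegel H (ε 1) ((t * g) • ε 5) := by simpa using Y (k1 (t * g))
    have h2 : HasSiegel H (ε 1) (t • ε 7) := by
      refine (((A6 t (f2w t)).sub (q 1 (by decide)) ?_ ?_ h1).add (q 1 (by decide)) ?_ ?_
        (e21 (2 * c * t))).congr rfl ?_
      any_goals simp [bf_ε1', ε_apply]; done
      apply ext8 <;> simp [ε_apply] <;> ring
    simpa using Y (Y h2)
  · have h1 : HasSiegel H (ε 0) (ε 1) := by simpa using e12 1
    have h2 : HasSiegel H (ε 4) (-ε 3) := by simpa using f21 (-1)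
    have h3 := ((f2w (-t)).conj_siegel h1).conj_siegel h2
    have h4 : HasSiegel H (ε 0) (-((-t) • (ε 7 + b • ε 6))) := by
      refine HasSiegel.neg_left (h3.congr ?_ ?_)
      · apply ext8 <;> simp [siegel, bf, qf, ε_apply]
      · apply ext8 <;> simp [siegel, bf, qf, ε_apply]
    rwa [neg_smul, neg_neg] at h4

end OrthEight

namespace OrthEight

variable {F : Type*} [Field F] {b c d : F}

set_option maxHeartbeats 2000000 in
theorem full_of_root_of_twisted [Finite F] {H : Subgroup (OG b c)} {x y : OG b c} (hb : b ≠ 0)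
    (hθ : (1 - c) ^ 2 - b ^ 2 ≠ 0) (hxH : x ∈ H) (hyH : y ∈ H)
    (hx : ∀ v, act b c x v = xFun b c 1 d v)
    (hy : ∀ v, act b c y v = yFun v) {a : F} (ha : a ≠ 0) (hroot : HasSiegel H (ε 0) (a • ε 4))
    (hgen : ∀ A : AddSubgroup F, (∃ t ∈ A, t ≠ 0) → (∀ t ∈ A, c * t ∈ A) → A = ⊤) :
    Full H := by
  have q : ∀ i : Fin 8, i < 6 → qf b c (ε i) = 0 := qf_ε
  have Y : ∀ {u r : Fin 8 → F}, HasSiegel H u r → HasSiegel H (yFun u) (yFun r) :=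
    fun h => h.conj_y hyH hy
  have X : ∀ {u r : Fin 8 → F}, HasSiegel H u r →
      HasSiegel H (xFun b c 1 d u) (xFun b c 1 d r) := fun h => h.conj_x hxH hx
  have qd : qf b c (ε 0 - ε 4) = 0 := by simp [qf, ε_apply]
  have C1 : ∀ s : F, HasSiegel H (ε 0) (s • ε 5) → HasSiegel H (ε 0 - ε 4)
      (s • ((d + 1) • ε 0 + ε 2 - c • ε 5 - (ε 7 + b • ε 6))) := by
    intro s hs
    have h1 : HasSiegel H (ε 1) (s • ε 3) := by simpa using Y hs
    have h2 : HasSiegel H (ε 0 - ε 4)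
        (s • (d • ε 0 + ε 2 + ε 4 - c • ε 5 - (ε 7 + b • ε 6))) := by
      refine (X h1).congr ?_ ?_
      · apply ext8 <;> simp [xFun, ε_apply]
      · apply ext8 <;> simp [xFun, ε_apply] <;> ring
    refine (h2.add_smul qd ?_ s).congr rfl ?_
    · simp [bf, ε_apply]
    · apply ext8 <;> simp [ε_apply]
      ring
  -- passing between the root groups attached to `e₁ - f₂` and to `e₁`
  have D : ∀ s : F, HasSiegel H (ε 0 - ε 4) (s • ε 4) → HasSiegel H (ε 0) (s • ε 4) := by
    intro s h
    have h1 : HasSiegel H (ε 4) (s • (ε 0 - ε 4)) :=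
      HasSiegel.swap_coeff qd (q 4 (by decide)) (by simp [bf, ε_apply]) h
    have h2 : HasSiegel H (ε 4) (s • ε 0) := by
      refine (h1.add_smul (q 4 (by decide)) (by simp [bf, ε_apply]) s).congr rfl ?_
      apply ext8 <;> simp [ε_apply]
    exact HasSiegel.swap_coeff (q 4 (by decide)) (q 0 (by decide)) (by simp [bf, ε_apply]) h2
  have D' : ∀ s : F, HasSiegel H (ε 0) (s • ε 4) → HasSiegel H (ε 0 - ε 4) (s • ε 0) := by
    intro s h
    have h1 : HasSiegel H (ε 0) (-(s • (ε 0 - ε 4))) := by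
      refine (h.add_smul (q 0 (by decide)) (by simp [bf, ε_apply]) (-s)).congr rfl ?_
      apply ext8 <;> simp [ε_apply]
    have h2 : HasSiegel H (ε 0) (s • (ε 0 - ε 4)) := by
      have := h1.neg (q 0 (by decide)) (by simp [bf, ε_apply])
      rwa [neg_neg] at this
    exact HasSiegel.swap_coeff (q 0 (by decide)) qd (by simp [bf, ε_apply]) h2
  have C2 : ∀ s t : F, HasSiegel H (ε 0) (s • ε 5) → HasSiegel H (ε 0) (t • ε 5) →
      HasSiegel H (ε 0) ((c * (s * t)) • ε 4) := by
    intro s t hs ht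
    have h1 : HasSiegel H (ε 2) (t • ε 4) := by simpa using Y (Y ht)
    have h2 : HasSiegel H (ε 0 - ε 4) (-((c * (s * t)) • ε 4)) := by
      refine (C1 s hs).comm h1 qd ?_ ?_ ?_
      · simp [bf, ε_apply]
      · apply ext8 <;> simp [siegel, bf, qf, ε_apply]
      · apply ext8 <;> simp [siegel, bf, qf, ε_apply] <;> ring
    have h3 := h2.neg qd (by simp [bf, ε_apply])
    rw [neg_neg] at h3
    exact D _ h3
  have haa := hroot.root_mul hyH hy hroot
  set K := rootParams H (ε 0) (ε 4) (q 0 (by decide)) (by simp [bf_ε0', ε_apply]) with hK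
  have hm : ∀ t, t ∈ K ↔ HasSiegel H (ε 0) (t • ε 4) := fun t => Iff.rfl
  have hc' : ∀ t ∈ K, c * t ∈ K := fun t ht => by
    have hta := ((hm t).mp ht).root_mul hyH hy hroot
    refine mem_of_mul_mem K (pow_ne_zero 3 ha) (fun s hs => ?_) (t := c * t) ?_
    · refine ((((hm s).mp hs).root_mul hyH hy hroot).root_mul' hyH hy haa).congr rfl ?_
      congr 1; ring
    · refine (C2 _ _ hta haa).congr rfl ?_
      congr 1; ring
  have hKtop := hgen K ⟨a, hroot, ha⟩ hc'
  have k1 : ∀ t, HasSiegel H (ε 0) (t • ε 4) := fun t => (hm t).mp (hKtop ▸ AddSubgroup.mem_top t)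
  have k2 : ∀ t : F, HasSiegel H (ε 0) (t • ε 5) := fun t => by
    simpa using (k1 t).root_mul hyH hy (k1 1)
  -- the two auxiliary singular vectors
  have R0 : ∀ s : F, HasSiegel H (ε 0 - ε 4) (s • (ε 2 - c • ε 5 - (ε 7 + b • ε 6))) := by
    intro s
    refine ((C1 s (k2 s)).sub qd ?_ ?_ (D' (s * (d + 1)) (k1 _))).congr rfl ?_
    any_goals simp [bf, ε_apply]; done
    apply ext8 <;> simp [ε_apply]
  have qr0 : qf b c (ε 2 - c • ε 5 - (ε 7 + b • ε 6)) = 0 := by simp [qf, ε_apply]; ring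
  have C3 : ∀ s : F, HasSiegel H (ε 2 - c • ε 5 - (ε 7 + b • ε 6)) (s • (ε 1 + ε 3)) := by
    intro s
    have h1 : HasSiegel H (ε 1) ((-1 : F) • ε 3) := by simpa using Y (k2 (-1))
    refine (HasSiegel.swap_coeff qd qr0 (by simp [bf, ε_apply]) (R0 s)).comm h1 qr0 ?_ ?_ ?_
    · simp [bf, ε_apply]
    · apply ext8 <;> simp [siegel, bf, qf, ε_apply]
    · apply ext8 <;> simp [siegel, bf, qf, ε_apply]
  have R1 : ∀ s : F, HasSiegel H (ε 0 - ε 4) (s • (ε 5 + ε 7 - c • ε 2)) := by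
    intro s
    have qd' : qf b c (ε 5 - ε 1) = 0 := by simp [qf, ε_apply]
    have h1 : HasSiegel H (ε 4) (s • ε 2) :=
      HasSiegel.swap_coeff (q 2 (by decide)) (q 4 (by decide)) (by simp [bf, ε_apply])
        (by simpa using Y (Y (k2 s)))
    have h2 : HasSiegel H (ε 5 - ε 1)
        (s • (ε 1 + ε 3 + ε 7 - c • ε 0 + (2 * c + b ^ 2 - d - 1) • ε 5)) := by
      refine (X h1).congr ?_ ?_
      · apply ext8 <;> simp [xFun, ε_apply]
      · apply ext8 <;> simp [xFun, ε_apply] <;> ring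
    have h3 : HasSiegel H (ε 5 - ε 1) ((s * (2 * c + b ^ 2 - d)) • ε 5) := by
      have h4 : HasSiegel H (ε 1) ((s * (2 * c + b ^ 2 - d)) • ε 5) := by
        simpa using Y (k1 (s * (2 * c + b ^ 2 - d)))
      have h5 := HasSiegel.swap_coeff (q 1 (by decide)) (q 5 (by decide))
        (by simp [bf, ε_apply]) h4
      have h6 : HasSiegel H (ε 5) (-((s * (2 * c + b ^ 2 - d)) • (ε 5 - ε 1))) := by
        refine (h5.add_smul (q 5 (by decide)) (by simp [bf, ε_apply])
          (-(s * (2 * c + b ^ 2 - d)))).congr rfl ?_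
        apply ext8 <;> simp [ε_apply]
      have h7 := h6.neg (q 5 (by decide)) (by simp [bf, ε_apply])
      rw [neg_neg] at h7
      exact HasSiegel.swap_coeff (q 5 (by decide)) qd' (by simp [bf, ε_apply]) h7
    have h8 : HasSiegel H (ε 5 - ε 1) (s • (ε 3 + ε 7 - c • ε 0)) := by
      refine ((h2.add_smul qd' ?_ s).sub qd' ?_ ?_ h3).congr rfl ?_
      any_goals simp [bf, ε_apply]; done
      apply ext8 <;> simp [ε_apply]
      ring
    have h9 : HasSiegel H (-(ε 0 - ε 4)) (s • (ε 5 + ε 7 - c • ε 2)) := by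
      refine (Y (Y h8)).congr ?_ ?_ <;> simp
    have h10 := h9.neg_left.neg qd (by simp [bf, ε_apply])
    rwa [neg_neg] at h10
  have C7 : ∀ s : F, HasSiegel H (ε 0 - ε 4) (s • (ε 1 + ε 3)) := by
    have h1 : ∀ s : F,
        HasSiegel H (ε 0 - ε 4) ((s * ((1 - c) ^ 2 - b ^ 2)) • (ε 1 + ε 3)) := by
      intro s
      refine (R1 s).comm (C3 1) qd ?_ ?_ ?_
      · simp [bf, ε_apply]
      · apply ext8 <;> simp [siegel, bf, qf, ε_apply]
      · apply ext8 <;> simp [siegel, bf, qf, ε_apply] <;> ring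
    intro s
    have h2 := h1 (s / ((1 - c) ^ 2 - b ^ 2))
    rwa [div_mul_cancel₀ _ hθ] at h2
  have E3 : ∀ s : F, HasSiegel H (ε 0 - ε 4) (s • ε 2) := by
    intro s
    have h1 : HasSiegel H (ε 2) ((-1 : F) • ε 4) := by simpa using Y (Y (k2 (-1)))
    refine (C7 s).comm h1 qd ?_ ?_ ?_
    · simp [bf, ε_apply]
    · apply ext8 <;> simp [siegel, bf, qf, ε_apply]
    · apply ext8 <;> simp [siegel, bf, qf, ε_apply]
  have F3 : ∀ s : F, HasSiegel H (ε 0 - ε 4) (s • ε 5) := by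
    intro s
    refine (C7 s).comm (k2 1) qd ?_ ?_ ?_
    · simp [bf, ε_apply]
    · apply ext8 <;> simp [siegel, bf, qf, ε_apply]
    · apply ext8 <;> simp [siegel, bf, qf, ε_apply]
  have e31 : ∀ s : F, HasSiegel H (ε 2) (s • ε 0) := by
    intro s
    have h1 : HasSiegel H (ε 2) (s • ε 4) := by simpa using Y (Y (k2 s))
    refine ((HasSiegel.swap_coeff qd (q 2 (by decide)) (by simp [bf, ε_apply]) (E3 s)).add
      (q 2 (by decide)) ?_ ?_ h1).congr rfl ?_
    any_goals simp [bf, ε_apply]; done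
    apply ext8 <;> simp [ε_apply]
  have f32 : ∀ s : F, HasSiegel H (ε 5) (s • ε 4) := by
    intro s
    have h1 := HasSiegel.swap_coeff (q 0 (by decide)) (q 5 (by decide)) (by simp [bf, ε_apply])
      (k2 s)
    refine (h1.sub (q 5 (by decide)) ?_ ?_ (HasSiegel.swap_coeff qd (q 5 (by decide))
      (by simp [bf, ε_apply]) (F3 s))).congr rfl ?_
    any_goals simp [bf, ε_apply]; done
    apply ext8 <;> simp [ε_apply]
  have f12 : ∀ s : F, HasSiegel H (ε 3) (s • ε 4) :=
    HasSiegel.swap_smul (q 4 (by decide)) (q 3 (by decide))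
      fun s => by simpa using Y (Y (f32 s))
  refine full_of_hasSiegel hb hyH hy k1 k2 (fun s => by simpa using Y (e31 s)) f12
    (fun s => ?_) (fun s => ?_)
  · have h1 : HasSiegel H (ε 0 - ε 4) (s • ε 7) := by
      refine (((R1 s).sub qd ?_ ?_ (F3 s)).add qd ?_ ?_ (E3 (s * c))).congr rfl ?_
      any_goals simp [bf, ε_apply]; done
      apply ext8 <;> simp [ε_apply]
    refine (h1.conj_siegel (f12 1)).congr ?_ ?_
    · apply ext8 <;> simp [siegel, bf, qf, ε_apply]
    · apply ext8 <;> simp [siegel, bf, qf, ε_apply]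
  · have h1 : HasSiegel H (ε 0 - ε 4) (s • (ε 7 + b • ε 6)) := by
      refine (((E3 s).sub qd ?_ ?_ (R0 s)).sub qd ?_ ?_ (F3 (s * c))).congr rfl ?_
      any_goals simp [bf, ε_apply]; done
      apply ext8 <;> simp [ε_apply]
    refine (h1.conj_siegel (f12 1)).congr ?_ ?_
    · apply ext8 <;> simp [siegel, bf, qf, ε_apply]
    · apply ext8 <;> simp [siegel, bf, qf, ε_apply]

end OrthEight

namespace OrthEight

variable {F : Type*} [Field F] {b c m d : F}

theorem mem_commutator_iff {G : Type*} [Group G] {g : G} :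
    g ∈ commutator G ↔ Abelianization.of g = 1 :=
  (QuotientGroup.eq_one_iff (N := commutator G) g).symm

theorem yFun_cube (v : Fin 8 → F) : yFun (yFun (yFun v)) = v := by
  apply ext8 <;> simp [yFun]

theorem xFun_sq (v : Fin 8 → F) : xFun b c m d (xFun b c m d v) = v := by
  apply ext8 <;> simp [xFun] <;> ring

theorem x_mul_self {x : OG b c} (hx : ∀ v, act b c x v = xFun b c m d v) : x * x = 1 :=
  ext_act fun v => by rw [act_mul_apply, hx, hx, xFun_sq, act_one_apply]

theorem y_pow_three {y : OG b c} (hy : ∀ v, act b c y v = yFun v) : y ^ 3 = 1 :=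
  ext_act fun v => by
    rw [pow_three, act_mul_apply, act_mul_apply, hy, hy, hy, yFun_cube, act_one_apply]

theorem y_mem_commutator {y : OG b c} (hy : ∀ v, act b c y v = yFun v) :
    y ∈ commutator (OG b c) := by
  let f : (Fin 8 → F) →ₗ[F] (Fin 8 → F) :=
    { toFun := fun v => ![v 1, v 0, v 2, v 4, v 3, v 5, v 6, v 7]
      map_add' := fun u v => by apply ext8 <;> simp
      map_smul' := fun t v => by apply ext8 <;> simp }
  have hf : ∀ v, f v = ![v 1, v 0, v 2, v 4, v 3, v 5, v 6, v 7] := fun v => rfl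
  have hff : ∀ v, f (f v) = v := fun v => by apply ext8 <;> simp [hf]
  obtain ⟨g, hg⟩ := exists_act_eq (b := b) (c := c) f f hff hff
    (fun v => by simp [hf, qf]; ring)
  have h1 : y * g * y = g := ext_act fun v => by
    rw [act_mul_apply, act_mul_apply, hy, hy, hg, hg]
    apply ext8 <;> simp [hf, yFun]
  have h2 := congrArg Abelianization.of h1
  have h3 := congrArg Abelianization.of (y_pow_three hy)
  rw [map_mul, map_mul, mul_right_comm, mul_eq_right] at h2
  rw [pow_three, map_mul, map_mul, h2, mul_one, map_one] at h3
  exact mem_commutator_iff.mpr h3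

theorem HasSiegel.commutator_root (t : F) : HasSiegel (commutator (OG b c)) (ε 0) (t • ε 4) := by
  obtain ⟨g, hg⟩ := exists_siegel (b := b) (c := c) (d := ε 0) (r := t • ε 5) (qf_ε 0 (by decide))
    (by simp [bf_ε0', ε_apply])
  obtain ⟨h, hh⟩ := exists_siegel (b := b) (c := c) (d := ε 2) (r := ε 4) (qf_ε 2 (by decide))
    (by simp [bf_ε2', ε_apply])
  refine ⟨h * g * h⁻¹ * g⁻¹, ?_, fun v => ?_⟩
  · rw [commutator_def]
    exact Subgroup.commutator_mem_commutator (Subgroup.mem_top h) (Subgroup.mem_top g)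
  · have h1 : ∀ u, act b c (h * g * h⁻¹) u = siegel b c (ε 0) (t • ε 5 + t • ε 4) u := fun u => by
      rw [act_mul_apply, act_mul_apply, hg, act_siegel, hh, hh]
      congr 1
      · apply ext8 <;> simp [siegel, bf, qf, ε_apply]
      · apply ext8 <;> simp [siegel, bf, qf, ε_apply]
    rw [act_mul_apply, h1, add_comm, ← siegel_add_right (qf_ε 0 (by decide))
      (by simp [bf_ε0', ε_apply]) (by simp [bf_ε0', ε_apply]), ← hg, act_act_inv]

/-- If an odd power of `x * y` is a root element, then `x` lies in the derived subgroup. -/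
theorem x_mem_commutator_of_odd {x y : OG b c} (hx : ∀ v, act b c x v = xFun b c m d v)
    (hy : ∀ v, act b c y v = yFun v) {N : ℕ} (hN : Odd N) {t : F}
    (hxy : ∀ v, act b c ((x * y) ^ N) v = siegel b c (ε 0) (t • ε 4) v) :
    x ∈ commutator (OG b c) := by
  obtain ⟨g, hg, hgt⟩ := HasSiegel.commutator_root (b := b) (c := c) t
  have h1 : (x * y) ^ N = g := ext_act fun v => by rw [hxy, hgt]
  have hφy := mem_commutator_iff.mp (y_mem_commutator hy)
  have h2 := mem_commutator_iff.mp hg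
  have h3 := congrArg Abelianization.of (x_mul_self hx)
  rw [map_mul, map_one] at h3
  obtain ⟨k, rfl⟩ := hN
  rw [← h1, map_pow, map_mul, hφy, mul_one, pow_succ, pow_mul, pow_two, h3, one_pow, one_mul] at h2
  exact mem_commutator_iff.mpr h2

theorem IsReflection.abelianization_eq {g h : OG b c} {α β : Fin 8 → F} (hg : IsReflection g α)
    (hh : IsReflection h β) (hq : qf b c α = qf b c β) (hαβ : bf b c α β = 0)
    (h2 : (2 : F) ≠ 0) : Abelianization.of g = Abelianization.of h := by
  have h1 : qf b c (α - β) ≠ 0 := by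
    rw [qf_sub, hαβ, hq, sub_zero, ← two_mul]
    exact mul_ne_zero h2 hh.1
  obtain ⟨k, hk⟩ := exists_reflection h1
  have h3 := hg.conj k
  rw [hk.act_sub hq] at h3
  rw [← h3.unique hh, map_mul, map_mul, map_inv, mul_inv_cancel_comm]

theorem x_mem_commutator_of_two_ne_zero (h2 : (2 : F) ≠ 0) {x : OG b c}
    (hx : ∀ v, act b c x v = xFun b c 0 0 v) : x ∈ commutator (OG b c) := by
  set α₁ : Fin 8 → F := ![0, 1, 0, 0, 1, 0, 0, 0] with hα₁
  set α₂ : Fin 8 → F := ![-b / 2, 0, 0, 0, 0, -b / 2, 1, 0] with hα₂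
  set α₃ : Fin 8 → F :=
    ![b ^ 2 / 8 + 1 / 2, 0, -1, 1, 0, c + 3 * b ^ 2 / 8 - 1 / 2, b / 2, 1] with hα₃
  set α₄ : Fin 8 → F :=
    ![b ^ 2 / 8 - 1 / 2, 0, -1, 1, 0, c + 3 * b ^ 2 / 8 + 1 / 2, b / 2, 1] with hα₄
  have h8 : (8 : F) ≠ 0 := by
    have : (8 : F) = 2 ^ 3 := by norm_num
    rw [this]; exact pow_ne_zero 3 h2
  have q1 : qf b c α₁ = 1 := by simp [qf, hα₁]
  have q2 : qf b c α₂ = -1 := by simp [qf, hα₂]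
  have q3 : qf b c α₃ = 1 := by simp [qf, hα₃]; field_simp; ring
  have q4 : qf b c α₄ = -1 := by simp [qf, hα₄]; field_simp; ring
  obtain ⟨r₁, hr₁⟩ := exists_reflection (b := b) (c := c) (α := α₁) (by simp [q1])
  obtain ⟨r₂, hr₂⟩ := exists_reflection (b := b) (c := c) (α := α₂) (by simp [q2])
  obtain ⟨r₃, hr₃⟩ := exists_reflection (b := b) (c := c) (α := α₃) (by simp [q3])
  obtain ⟨r₄, hr₄⟩ := exists_reflection (b := b) (c := c) (α := α₄) (by simp [q4])
  have b13 : bf b c α₁ α₃ = 0 := by simp [bf, hα₁, hα₃]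
  have b24 : bf b c α₂ α₄ = 0 := by simp [bf, hα₂, hα₄]; field_simp; ring
  have e13 := hr₁.abelianization_eq hr₃ (q1.trans q3.symm) b13 h2
  have e24 := hr₂.abelianization_eq hr₄ (q2.trans q4.symm) b24 h2
  have hprod : x = r₁ * r₃ * (r₂ * r₄) := ext_act fun v => by
    have b12 : bf b c α₁ α₂ = 0 := by simp [bf, hα₁, hα₂]
    have b14 : bf b c α₁ α₄ = 0 := by simp [bf, hα₁, hα₄]
    have b32 : bf b c α₃ α₂ = 0 := by simp [bf, hα₃, hα₂]; field_simp; ring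
    have b34 : bf b c α₃ α₄ = 0 := by simp [bf, hα₃, hα₄]; field_simp; ring
    have e : act b c (r₁ * r₃ * (r₂ * r₄)) v = v - bf b c v α₁ • α₁ - bf b c v α₃ • α₃
        + bf b c v α₂ • α₂ + bf b c v α₄ • α₄ := by
      simp only [act_mul_apply, hr₁.2, hr₂.2, hr₃.2, hr₄.2, q1, q2, q3, q4, bf_sub_left,
        bf_smul_left, bf_comm α₃ α₁, bf_comm α₂ α₁, bf_comm α₄ α₁, bf_comm α₂ α₃, bf_comm α₄ α₃,
        bf_comm α₄ α₂, b12, b13, b14, b32, b34, b24]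
      ext i
      simp only [Pi.sub_apply, Pi.add_apply, Pi.smul_apply, smul_eq_mul]
      ring
    rw [e, hx]
    apply ext8 <;> simp only [Pi.add_apply, Pi.sub_apply, Pi.smul_apply, smul_eq_mul] <;>
      simp [xFun, bf, hα₁, hα₂, hα₃, hα₄] <;> field_simp <;> ring
  have hsq : ∀ {r : OG b c} {α : Fin 8 → F}, IsReflection r α →
      Abelianization.of r * Abelianization.of r = 1 := fun hr => by
    rw [← map_mul, hr.mul_self, map_one]
  rw [mem_commutator_iff, hprod, map_mul, map_mul, map_mul, e13, e24, hsq hr₃, hsq hr₄, one_mul]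

end OrthEight

namespace OrthEight

open Polynomial

variable {F : Type*} [Field F] {b c m d : F}

theorem act_mul_ne {x y : OG b c} (hx : ∀ v, act b c x v = xFun b c m d v)
    (hy : ∀ v, act b c y v = yFun v) : x * y ≠ y * x := by
  intro h
  have h1 : act b c (x * y) (ε 0) 3 = act b c (y * x) (ε 0) 3 := by rw [h]
  rw [act_mul_apply, act_mul_apply, hx, hy, hx, hy] at h1
  simp [xFun, yFun, ε_apply] at h1

theorem hasSiegel_closure {x y : OG b c} {N : ℕ} {t : F}
    (h : ∀ v, act b c ((x * y) ^ N) v = siegel b c (ε 0) (t • ε 4) v) :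
    HasSiegel (Subgroup.closure {x, y}) (ε 0) (t • ε 4) :=
  ⟨(x * y) ^ N, Subgroup.pow_mem _ (Subgroup.mul_mem _ (Subgroup.subset_closure (by simp))
    (Subgroup.subset_closure (by simp))) N, h⟩

theorem exists_generator_units (F : Type*) [Field F] [Finite F] :
    ∃ n : F, n ≠ 0 ∧ ∀ u : F, u ≠ 0 → ∃ k : ℕ, u = n ^ k := by
  obtain ⟨g, hg⟩ := IsCyclic.exists_generator (α := Fˣ)
  refine ⟨g, g.ne_zero, fun u hu => ?_⟩
  obtain ⟨k, hk⟩ := (mem_powers_iff_mem_zpowers.mpr (hg (Units.mk0 u hu)))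
  exact ⟨k, by simpa using (congrArg Units.val hk).symm⟩

theorem addSubgroup_eq_top {n : F} (hn : ∀ u : F, u ≠ 0 → ∃ k : ℕ, u = n ^ k) (A : AddSubgroup F)
    (h0 : ∃ t ∈ A, t ≠ 0) (hA : ∀ t ∈ A, n * t ∈ A) : A = ⊤ := by
  obtain ⟨t, ht, ht0⟩ := h0
  have hpow : ∀ k : ℕ, n ^ k * t ∈ A := fun k => by
    induction k with
    | zero => simpa using ht
    | succ k ih => rw [pow_succ', mul_assoc]; exact hA _ ih
  rw [eq_top_iff]
  intro s _
  by_cases hs : s = 0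
  · rw [hs]; exact A.zero_mem
  · obtain ⟨k, hk⟩ := hn (s / t) (div_ne_zero hs ht0)
    have := hpow k
    rwa [← hk, div_mul_cancel₀ _ ht0] at this

theorem not_isSquare_generator [Finite F] (h2 : (2 : F) ≠ 0) {n : F}
    (hn : ∀ u : F, u ≠ 0 → ∃ k : ℕ, u = n ^ k) : ¬ IsSquare n := by
  have := Fintype.ofFinite F
  intro hsq
  obtain ⟨a, ha⟩ := FiniteField.exists_nonsquare (F := F) (by
    intro h
    have : CharP F 2 := ringChar.of_eq h
    exact h2 (CharTwo.two_eq_zero))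
  obtain ⟨k, rfl⟩ := hn a (by rintro rfl; exact ha (IsSquare.zero))
  exact ha (hsq.pow k)

theorem exists_odd_param (F : Type*) [Field F] [Finite F] (h2 : (2 : F) ≠ 0) :
    ∃ n : F, ¬ IsSquare n ∧ n ≠ 7 ∧ n ≠ -3 ∧
      ∀ A : AddSubgroup F, (∃ t ∈ A, t ≠ 0) → (∀ t ∈ A, n * t ∈ A) → A = ⊤ := by
  obtain ⟨n, hn0, hn⟩ := exists_generator_units F
  have hsq := not_isSquare_generator h2 hn
  by_cases h : n = 7 ∨ n = -3
  · have hint : ∃ k : ℤ, n = k := by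
      rcases h with h | h
      · exact ⟨7, by simp [h]⟩
      · exact ⟨-3, by simp [h]⟩
    refine ⟨4 * n, ?_, ?_, ?_, fun A hA _ => addSubgroup_eq_top hn A hA fun t ht => ?_⟩
    · rintro ⟨r, hr⟩
      refine hsq ⟨r / 2, ?_⟩
      field_simp
      linear_combination hr
    · intro h4
      rcases h with rfl | rfl
      · have h3 : (3 : F) = 0 := by
          have : (7 : F) * 3 = 0 := by linear_combination h4
          exact (mul_eq_zero.mp this).resolve_left hn0
        exact hsq ⟨1, by linear_combination 2 * h3⟩
      · exact hsq ⟨4, by linear_combination h4⟩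
    · intro h4
      rcases h with rfl | rfl
      · have h3 : (3 : F) ≠ 0 := fun h3 => hsq ⟨1, by linear_combination 2 * h3⟩
        refine hsq ⟨1 / 3, ?_⟩
        field_simp
        linear_combination 2 * h4
      · exact hn0 (mul_self_eq_zero.mp (by linear_combination -h4))
    · obtain ⟨k, rfl⟩ := hint
      rw [← zsmul_eq_mul]
      exact A.zsmul_mem ht k
  · push Not at h
    exact ⟨n, hsq, h.1, h.2, addSubgroup_eq_top hn⟩

theorem exists_generating_pair_of_two_ne_zero (F : Type*) [Field F] [Finite F] (h2 : (2 : F) ≠ 0) :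
    ∃ b c : F, Aniso b c ∧ b ^ 2 + 4 * c ≠ 0 ∧ ∃ x y : OG b c, x * x = 1 ∧ y ^ 3 = 1 ∧
      x * y ≠ y * x ∧ Subgroup.closure {x, y} = commutator (OG b c) := by
  obtain ⟨n, hsq, h7, h3, hgen⟩ := exists_odd_param F h2
  have h4 : (4 : F) ≠ 0 := by
    have : (4 : F) = 2 ^ 2 := by norm_num
    rw [this]; exact pow_ne_zero 2 h2
  obtain ⟨c, hc⟩ : ∃ c : F, 4 * c = n - 1 := ⟨(n - 1) / 4, by field_simp⟩
  have hn : (1 : F) ^ 2 + 4 * c ≠ 0 := fun h => hsq ⟨0, by linear_combination h - hc⟩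
  have hA : Aniso 1 c := by
    intro s t hst
    have ht : t = 0 := by
      by_contra ht
      refine hsq ⟨(2 * s - t) / t, ?_⟩
      field_simp
      linear_combination 4 * hst - t ^ 2 * hc
    subst ht
    exact ⟨by simpa using hst, rfl⟩
  have hc0 : c ≠ 0 := fun h => hsq ⟨1, by linear_combination 4 * h - hc⟩
  have hc1 : c + 1 ≠ 0 := fun h => h3 (by linear_combination 4 * h - hc)
  obtain ⟨x, hx⟩ := exists_x (1 : F) c 0 0
  obtain ⟨y, hy⟩ := exists_y (1 : F) c
  have hR : IsCoprime (quartPoly 1 c) (2 * X ^ 2 + C c * X + 2) := by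
    have hX : IsCoprime (2 * X ^ 2 + C c * X + 2) (X : F[X]) :=
      isCoprime_of_eq_C (u := 1) (v := -(2 * X + C c)) h2 (by simp only [map_ofNat]; ring)
    have hd : (c - 4) ^ 2 - 4 ≠ 0 := by
      intro h
      have : (c - 6) * (c - 2) = 0 := by linear_combination h
      rcases mul_eq_zero.mp this with h | h
      · exact hsq ⟨5, by linear_combination 4 * h - hc⟩
      · exact hsq ⟨3, by linear_combination 4 * h - hc⟩
    have h5 : IsCoprime (2 * X ^ 2 + C c * X + 2) (C (-((c - 4) ^ 2 - 4)) * X ^ 2) :=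
      IsCoprime.mul_right (isCoprime_of_eq_C (u := 0) (v := 1) (neg_ne_zero.mpr hd) (by ring))
        hX.pow_right
    have h6 : C (-((c - 4) ^ 2 - 4)) * X ^ 2 + (2 * X ^ 2 + C c * X + 2) *
        (2 * X ^ 2 + C c * X + 2) = C 4 * quartPoly 1 c := by
      simp only [quartPoly, map_add, map_sub, map_mul, map_pow, map_ofNat, map_one, map_neg]
      ring
    have h7 := h5.add_mul_left_right (2 * X ^ 2 + C c * X + 2)
    rw [h6] at h7
    exact h7.of_mul_right_right.symm
  have hsep : (quadPoly 0 * quartPoly 1 c).Separable := by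
    refine (quadPoly_separable ?_).mul (quartPoly_separable one_ne_zero hn hR)
      (quadPoly_quartPoly_isCoprime ?_)
    · simpa using h4
    · intro h
      exact h7 (by linear_combination 2 * h - hc)
  obtain ⟨N, t, -, ht, hz⟩ := exists_pow_eq_siegel hx hy
    (by
      intro h
      exact hc1 (pow_eq_zero_iff two_ne_zero |>.mp (by linear_combination -h)))
    (Or.inr h2) hsep
  refine ⟨1, c, hA, hn, x, y, x_mul_self hx, y_pow_three hy, act_mul_ne hx hy, le_antisymm ?_ ?_⟩
  · rw [Subgroup.closure_le]
    rintro g (rfl | rfl)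
    · exact x_mem_commutator_of_two_ne_zero h2 hx
    · exact y_mem_commutator hy
  · refine commutator_le_of_full hA hn (full_of_root_of_two_ne_zero one_ne_zero hc0
      (Subgroup.subset_closure (by simp)) (Subgroup.subset_closure (by simp)) hx hy ht
      (hasSiegel_closure hz) fun A h0 hA' => hgen A h0 fun s hs => ?_)
    have h1 := hA' s hs
    have h5 : n * s = (2 * c + 1 ^ 2) * s + (2 * c + 1 ^ 2) * s - s := by
      linear_combination (-s) * hc
    rw [h5]
    exact A.sub_mem (A.add_mem h1 h1) hs

theorem exists_even_param (F : Type*) [Field F] [Finite F] (h2 : (2 : F) = 0) :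
    ∃ b c : F, c ≠ 0 ∧ b ≠ 0 ∧ b ^ 2 ≠ c + 1 ∧ Aniso b c ∧
      ∀ A : AddSubgroup F, (∃ t ∈ A, t ≠ 0) → (∀ t ∈ A, c * t ∈ A) → A = ⊤ := by
  classical
  have : CharP F 2 := CharTwo.of_one_ne_zero_of_two_eq_zero one_ne_zero h2
  obtain ⟨c, hc0, hc⟩ := exists_generator_units F
  have hsurj : ∀ a : F, ∃ r, r ^ 2 = a := fun a => by
    obtain ⟨r, hr⟩ := (isSquare_iff_exists_sq a).mp (FiniteField.isSquare_of_char_two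
      (ringChar.eq_iff.mpr inferInstance) a)
    exact ⟨r, hr.symm⟩
  obtain ⟨r, hr⟩ := hsurj (c + 1)
  obtain ⟨r', hr'⟩ := hsurj c
  let f : F → F := fun s => if s = 0 then r else s + c / s
  have hf : ¬ Function.Surjective f := by
    intro h
    have hinj := Finite.injective_iff_surjective.mpr h
    by_cases h1 : c = 1
    · have hr0 : r = 0 := pow_eq_zero_iff two_ne_zero |>.mp (by
        rw [hr, h1]; linear_combination h2)
      have : f 0 = f 1 := by simp [f, hr0, h1, CharTwo.add_self_eq_zero]
      exact zero_ne_one (hinj this)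
    · have : f 1 = f c := by simp [f, hc0, add_comm]
      exact h1 (hinj this).symm
  simp only [Function.Surjective, not_forall, not_exists] at hf
  obtain ⟨b, hb⟩ := hf
  have hr'0 : r' ≠ 0 := by rintro rfl; exact hc0 (by rw [← hr']; simp)
  refine ⟨b, c, hc0, ?_, ?_, ?_, addSubgroup_eq_top hc⟩
  · rintro rfl
    apply hb r'
    simp only [f, hr'0, if_false]
    field_simp
    linear_combination hr' + c * h2
  · intro h
    apply hb 0
    simp only [f, if_true]
    rw [← hr] at h
    exact sub_eq_zero.mp (pow_eq_zero_iff two_ne_zero |>.mp (by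
      linear_combination -h + (b ^ 2 - r * b) * h2))
  · intro s t hst
    have ht : t = 0 := by
      by_contra ht
      have hs : s ≠ 0 := by
        rintro rfl
        simp [hc0, ht] at hst
      apply hb (s / t)
      simp only [f, div_ne_zero hs ht, if_false]
      field_simp
      linear_combination -hst + c * t ^ 2 * h2
    subst ht
    exact ⟨by simpa using hst, rfl⟩

theorem exists_generating_pair_of_two_eq_zero (F : Type*) [Field F] [Finite F] (h2 : (2 : F) = 0) :
    ∃ b c : F, Aniso b c ∧ b ^ 2 + 4 * c ≠ 0 ∧ ∃ x y : OG b c, x * x = 1 ∧ y ^ 3 = 1 ∧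
      x * y ≠ y * x ∧ Subgroup.closure {x, y} = commutator (OG b c) := by
  obtain ⟨b, c, hc0, hb, hbc, hA, hgen⟩ := exists_even_param F h2
  have hn : b ^ 2 + 4 * c ≠ 0 := fun h => hb (pow_eq_zero_iff two_ne_zero |>.mp (by
    linear_combination h - 2 * c * h2))
  have h1bc : 1 + b + c ≠ 0 := fun h => one_ne_zero (hA 1 1 (by linear_combination h - h2)).1
  have hθ : (1 - c) ^ 2 - b ^ 2 ≠ 0 := fun h => h1bc (pow_eq_zero_iff two_ne_zero |>.mp (by
    linear_combination h + (2 * c + b ^ 2 + b + b * c) * h2))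
  obtain ⟨d, hd⟩ : ∃ d : F, d * (2 * c + b ^ 2 - d - 1 ^ 2) - 1 ^ 2 - 3 * c * 1 - c ^ 2 -
      (2 * c + b ^ 2) ≠ 0 := by
    by_contra! h
    exact hb (pow_eq_zero_iff two_ne_zero |>.mp (by
      linear_combination h 1 - h 0 + (1 - c) * h2))
  obtain ⟨x, hx⟩ := exists_x b c 1 d
  obtain ⟨y, hy⟩ := exists_y b c
  have h2' : (2 : F[X]) = 0 := by rw [← map_ofNat C 2, h2, map_zero]
  have hR : IsCoprime (quartPoly b c) (2 * X ^ 2 + C c * X + 2) := by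
    rw [h2', zero_mul, zero_add, add_zero]
    refine IsCoprime.mul_right (isCoprime_of_eq_C (u := 0) (v := 1) hc0 (by ring)) ?_
    have h1 : IsCoprime (quartPoly b c) (X - C 0) := isCoprime_X_sub_C (by
      simp [quartPoly])
    simpa using h1
  have hsep : (quadPoly 1 * quartPoly b c).Separable := by
    refine (quadPoly_separable ?_).mul (quartPoly_separable hb hn hR)
      (quadPoly_quartPoly_isCoprime ?_)
    · exact fun h => one_ne_zero (α := F) (by linear_combination h - h2)
    · exact fun h => hbc (by linear_combination h + (1 - 2 * c) * h2)
  obtain ⟨N, t, hN, ht, hz⟩ := exists_pow_eq_siegel hx hy hd (Or.inl one_ne_zero) hsep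
  have hodd : Odd N := by
    rw [← Nat.not_even_iff_odd]
    rintro ⟨k, rfl⟩
    exact hN (by push_cast; linear_combination (k : F) * h2)
  refine ⟨b, c, hA, hn, x, y, x_mul_self hx, y_pow_three hy, act_mul_ne hx hy, le_antisymm ?_ ?_⟩
  · rw [Subgroup.closure_le]
    rintro g (rfl | rfl)
    · exact x_mem_commutator_of_odd hx hy hodd hz
    · exact y_mem_commutator hy
  · exact commutator_le_of_full hA hn (full_of_root_of_twisted hb hθ
      (Subgroup.subset_closure (by simp)) (Subgroup.subset_closure (by simp)) hx hy ht
      (hasSiegel_closure hz) hgen)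

end OrthEight

namespace OrthEight

variable {F : Type*} [Field F] {b c : F}

/-- An anisotropic binary form `-s² + b₀ s t + c₀ t²` over a finite field contains a basis
completing `(1, 0)` with prescribed parameters `b, c`, provided these are again anisotropic. -/
theorem exists_change_of_params [Finite F] {b₀ c₀ : F} (h : Aniso b c) (h₀ : Aniso b₀ c₀)
    (hd : b ^ 2 + 4 * c ≠ 0) :
    ∃ s t : F, -2 * s + b₀ * t = b ∧ -s ^ 2 + b₀ * s * t + c₀ * t ^ 2 = c := by
  have := Fintype.ofFinite F
  by_cases h2 : (2 : F) = 0
  · have : CharP F 2 := CharTwo.of_one_ne_zero_of_two_eq_zero one_ne_zero h2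
    have hb : b ≠ 0 := fun hb => hd (by rw [hb]; linear_combination 2 * c * h2)
    have hb₀ : b₀ ≠ 0 := by
      intro hb₀
      obtain ⟨r, hr⟩ := FiniteField.isSquare_of_char_two (ringChar.eq F 2 ▸ rfl) c₀
      have := h₀ r 1 (by rw [hb₀, hr]; ring)
      exact one_ne_zero this.2
    let φ : F →+ F :=
      { toFun := fun s => s ^ 2 + b * s
        map_zero' := by ring
        map_add' := fun s t => by linear_combination s * t * h2 }
    have hφ : ∀ s, φ s = s ^ 2 + b * s := fun s => rfl
    have hker : Nat.card φ.ker = 2 := by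
      have : (φ.ker : Set F) = {0, b} := by
        ext s
        simp only [SetLike.mem_coe, AddMonoidHom.mem_ker, hφ, Set.mem_insert_iff,
          Set.mem_singleton_iff]
        constructor
        · intro hs
          have : s * (s + b) = 0 := by linear_combination hs
          rcases mul_eq_zero.1 this with hs | hs
          · exact Or.inl hs
          · exact Or.inr (by linear_combination hs - b * h2)
        · rintro (rfl | rfl)
          · ring
          · linear_combination s ^ 2 * h2
      rw [← SetLike.coe_sort_coe, this, Nat.card_coe_set_eq, Set.ncard_pair hb.symm]
    have hindex : φ.range.index = 2 := by
      have h1 := φ.range.card_mul_index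
      have h3 := φ.ker.card_mul_index
      rw [AddSubgroup.index_ker, hker] at h3
      have hpos : 0 < Nat.card φ.range := Nat.card_pos
      rw [← h3, mul_comm 2] at h1
      exact Nat.eq_of_mul_eq_mul_left hpos h1
    have hc : c ∉ φ.range := by
      rintro ⟨s, hs⟩
      rw [hφ] at hs
      exact one_ne_zero (h s 1 (by linear_combination c * h2 - s ^ 2 * h2 + hs)).2
    have hc₀ : c₀ * (b / b₀) ^ 2 ∉ φ.range := by
      rintro ⟨s, hs⟩
      rw [hφ] at hs
      have ht := h₀ s (b / b₀) (by
        have hbb : b₀ * (b / b₀) = b := mul_div_cancel₀ _ hb₀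
        linear_combination hs + s * hbb - s ^ 2 * h2 + c₀ * (b / b₀) ^ 2 * h2 )
      exact div_ne_zero hb hb₀ ht.2
    obtain ⟨s, hs⟩ := ((AddSubgroup.add_mem_iff_of_index_two hindex (a := c)
      (b := c₀ * (b / b₀) ^ 2)).2 (iff_of_false hc hc₀))
    rw [hφ] at hs
    have hbb : b₀ * (b / b₀) = b := mul_div_cancel₀ _ hb₀
    refine ⟨s, b / b₀, by linear_combination hbb - s * h2, ?_⟩
    linear_combination hs + s * hbb - s ^ 2 * h2 + c₀ * (b / b₀) ^ 2 * h2
  · have hns : ∀ {b c : F}, Aniso b c → ¬ IsSquare (b ^ 2 + 4 * c) := by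
      rintro b c h ⟨r, hr⟩
      have := h (b + r) 2 (by linear_combination hr)
      exact h2 this.2
    have h0 : b₀ ^ 2 + 4 * c₀ ≠ 0 := fun h => hns h₀ (h ▸ IsSquare.zero)
    have hF : ringChar F ≠ 2 := fun hF => h2 (by
      have := ringChar.Nat.cast_ringChar (R := F)
      rw [hF] at this
      exact_mod_cast this)
    classical
    have hsq : IsSquare ((b ^ 2 + 4 * c) * (b₀ ^ 2 + 4 * c₀)) := by
      rw [← quadraticChar_one_iff_isSquare (mul_ne_zero hd h0), map_mul,
        quadraticChar_neg_one_iff_not_isSquare.2 (hns h),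
        quadraticChar_neg_one_iff_not_isSquare.2 (hns h₀)]
      norm_num
    obtain ⟨r, hr⟩ := hsq
    set n := b₀ ^ 2 + 4 * c₀ with hn
    have ht : (r / n) ^ 2 * n = b ^ 2 + 4 * c := by
      field_simp
      linear_combination -hr
    refine ⟨(b₀ * (r / n) - b) / 2, r / n, by field_simp; ring, ?_⟩
    have h4 : (4 : F) ≠ 0 := by
      have : (4 : F) = 2 * 2 := by norm_num
      rw [this]; exact mul_ne_zero h2 h2
    apply mul_left_cancel₀ h4
    have hs : 2 * ((b₀ * (r / n) - b) / 2) = b₀ * (r / n) - b := by field_simp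
    rw [hn] at ht
    generalize (b₀ * (r / n) - b) / 2 = s at *
    generalize r / n = t at *
    linear_combination ht - (2 * s - b₀ * t - b) * hs

/-- An anisotropic binary form over a finite field represents `-1`. -/
theorem exists_binary_eq_neg_one [Finite F] {a β γ : F}
    (h : ∀ s t, a * s ^ 2 + β * s * t + γ * t ^ 2 = 0 → s = 0 ∧ t = 0) :
    ∃ s t, a * s ^ 2 + β * s * t + γ * t ^ 2 = -1 := by
  have := Fintype.ofFinite F
  have ha : a ≠ 0 := fun ha => one_ne_zero (h 1 0 (by rw [ha]; ring)).1
  by_cases h2 : (2 : F) = 0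
  · have : CharP F 2 := CharTwo.of_one_ne_zero_of_two_eq_zero one_ne_zero h2
    obtain ⟨r, hr⟩ := FiniteField.isSquare_of_char_two (ringChar.eq F 2 ▸ rfl) (-a⁻¹)
    refine ⟨r, 0, ?_⟩
    have : a * -a⁻¹ = -1 := by field_simp
    linear_combination this - a * hr
  · have hodd : Fintype.card F % 2 = 1 := by
      refine FiniteField.odd_card_of_char_ne_two fun hF => h2 ?_
      have := ringChar.Nat.cast_ringChar (R := F)
      rw [hF] at this
      exact_mod_cast this
    have hD : β ^ 2 - 4 * a * γ ≠ 0 := fun hD => by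
      have h := (h (-β) (2 * a) (by linear_combination -a * hD)).2
      exact mul_ne_zero h2 ha h
    obtain ⟨X, T, hXT⟩ := FiniteField.exists_root_sum_quadratic
      (f := Polynomial.X ^ 2 + Polynomial.C (4 * a))
      (g := Polynomial.C (-(β ^ 2 - 4 * a * γ)) * Polynomial.X ^ 2)
      (by compute_degree!) (by compute_degree!; rwa [← neg_sub, neg_eq_zero]) hodd
    simp only [Polynomial.eval_add, Polynomial.eval_pow, Polynomial.eval_X, Polynomial.eval_C,
      Polynomial.eval_mul] at hXT
    refine ⟨(X - β * T) / (2 * a), T, ?_⟩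
    have h4 : 4 * a ≠ 0 := by
      have : 4 * a = 2 * (2 * a) := by ring
      rw [this]; exact mul_ne_zero h2 (mul_ne_zero h2 ha)
    apply mul_left_cancel₀ h4
    have hs : 2 * a * ((X - β * T) / (2 * a)) = X - β * T := by field_simp
    generalize (X - β * T) / (2 * a) = s at *
    linear_combination hXT + (2 * a * s + β * T + X) * hs

end OrthEight

namespace OrthEight

variable {F : Type*} [Field F] {b c : F}

open QuadraticMap

section normalForm

variable {Q : QuadraticForm F (Fin 8 → F)}

theorem exists_polar_eq
    (hnd : ∀ u : Fin 8 → F, (∀ v : Fin 8 → F, Q (u + v) = Q u + Q v) → u = 0)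
    {e : Fin 3 → Fin 8 → F} (he : LinearIndependent F e) (a : Fin 3 → F) :
    ∃ f, ∀ i, polar Q f (e i) = a i := by
  have hinj : Function.Injective (polarBilin Q) := by
    rw [injective_iff_map_eq_zero]
    intro u hu
    refine hnd u fun v => ?_
    have h := LinearMap.congr_fun hu v
    rw [polarBilin_apply_apply, LinearMap.zero_apply, polar] at h
    linear_combination h
  have hsurj : Function.Surjective (polarBilin Q) :=
    (LinearMap.injective_iff_surjective_of_finrank_eq_finrank
      (Subspace.dual_finrank_eq (K := F) (V := Fin 8 → F)).symm).1 hinj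
  obtain ⟨φ, hφ⟩ := LinearMap.exists_extend ((Module.Basis.span he).constr F a)
  obtain ⟨f, hf⟩ := hsurj φ
  refine ⟨f, fun i => ?_⟩
  rw [← polarBilin_apply_apply, hf]
  have := LinearMap.congr_fun hφ (Module.Basis.span he i)
  rw [Module.Basis.constr_basis, LinearMap.comp_apply, Submodule.subtype_apply,
    Module.Basis.span_apply] at this
  exact this

theorem exists_hyperbolic
    (hnd : ∀ u : Fin 8 → F, (∀ v : Fin 8 → F, Q (u + v) = Q u + Q v) → u = 0)
    {e : Fin 3 → Fin 8 → F} (he : LinearIndependent F e) (hQe : ∀ i, Q (e i) = 0)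
    (hee : ∀ i j, polar Q (e i) (e j) = 0) :
    ∃ f : Fin 3 → Fin 8 → F, (∀ i, Q (f i) = 0) ∧ (∀ i j, polar Q (f i) (f j) = 0) ∧
      ∀ i j, polar Q (f i) (e j) = if i = j then 1 else 0 := by
  choose f hf using fun i : Fin 3 => exists_polar_eq hnd he (fun j => if i = j then 1 else 0)
  have hf' : ∀ i j, polar Q (e j) (f i) = if i = j then 1 else 0 := fun i j => by
    rw [polar_comm, hf]
  have hQf : ∀ i, Q (![f 0 + -Q (f 0) • e 0,
      f 1 + -Q (f 1) • e 1 + -polar Q (f 0) (f 1) • e 0,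
      f 2 + -Q (f 2) • e 2 + -polar Q (f 0) (f 2) • e 0 + -polar Q (f 1) (f 2) • e 1] i) = 0 := by
    intro i
    fin_cases i <;> simp only [Fin.zero_eta, Fin.mk_one, Fin.reduceFinMk, Matrix.cons_val] <;>
      simp only [QuadraticMap.map_add Q, QuadraticMap.map_smul, polar_add_left, polar_smul_left,
        polar_smul_right, hf, hQe, hee, smul_eq_mul] <;> simp
  have hlt : ∀ i j, i < j → polar Q (![f 0 + -Q (f 0) • e 0,
      f 1 + -Q (f 1) • e 1 + -polar Q (f 0) (f 1) • e 0,
      f 2 + -Q (f 2) • e 2 + -polar Q (f 0) (f 2) • e 0 + -polar Q (f 1) (f 2) • e 1] i)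
      (![f 0 + -Q (f 0) • e 0,
      f 1 + -Q (f 1) • e 1 + -polar Q (f 0) (f 1) • e 0,
      f 2 + -Q (f 2) • e 2 + -polar Q (f 0) (f 2) • e 0 + -polar Q (f 1) (f 2) • e 1] j) = 0 := by
    intro i j hij
    fin_cases i <;> fin_cases j <;>
      simp [polar_add_left, polar_smul_left,
        polar_add_right, polar_smul_right, hf, hf', hee] at hij ⊢
  refine ⟨_, hQf, fun i j => ?_, fun i j => ?_⟩
  · rcases lt_trichotomy i j with h | rfl | h
    · exact hlt i j h
    · rw [polar_self, hQf, smul_zero]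
    · rw [polar_comm]; exact hlt j i h
  · fin_cases i <;> fin_cases j <;>
      simp [polar_add_left, polar_smul_left, hf, hee]

theorem eq_zero_of_singular_of_orthogonal
    (h4 : ¬ ∃ W : Submodule F (Fin 8 → F), Module.finrank F W = 4 ∧ ∀ w ∈ W, Q w = 0)
    {e f : Fin 3 → Fin 8 → F} (hQe : ∀ i, Q (e i) = 0)
    (hee : ∀ i j, polar Q (e i) (e j) = 0)
    (hfe : ∀ i j, polar Q (f i) (e j) = if i = j then 1 else 0)
    {u : Fin 8 → F} (hue : ∀ i, polar Q (e i) u = 0) (huf : ∀ i, polar Q (f i) u = 0)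
    (hQu : Q u = 0) : u = 0 := by
  by_contra hu
  have hli : LinearIndependent F ![e 0, e 1, e 2, u] := by
    rw [Fintype.linearIndependent_iff]
    intro g hg
    simp only [Fin.sum_univ_four] at hg
    have h0 := congrArg (polar Q (f 0)) hg
    have h1 := congrArg (polar Q (f 1)) hg
    have h2 := congrArg (polar Q (f 2)) hg
    simp [polar_add_right, polar_smul_right, hfe, huf] at h0 h1 h2
    simp [h0, h1, h2, hu] at hg
    intro i
    fin_cases i <;> assumption
  refine h4 ⟨Submodule.span F (Set.range ![e 0, e 1, e 2, u]), ?_, fun w hw => ?_⟩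
  · rw [finrank_span_eq_card hli, Fintype.card_fin]
  · obtain ⟨g, rfl⟩ := (Submodule.mem_span_range_iff_exists_fun F).1 hw
    simp [Fin.sum_univ_four, QuadraticMap.map_add Q, QuadraticMap.map_smul, polar_add_left,
      polar_smul_left, polar_smul_right, hQe, hee, hue, hQu]

/-- The orthogonal complement of the hyperbolic part contains two independent vectors. -/
theorem exists_pair_orthogonal (e f : Fin 3 → Fin 8 → F) :
    ∃ u : Fin 2 → Fin 8 → F, LinearIndependent F u ∧
      ∀ k i, polar Q (e i) (u k) = 0 ∧ polar Q (f i) (u k) = 0 := by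
  let T : (Fin 8 → F) →ₗ[F] (Fin 3 → F) × (Fin 3 → F) :=
    (LinearMap.pi fun i => polarBilin Q (e i)).prod (LinearMap.pi fun i => polarBilin Q (f i))
  have hrn := T.finrank_range_add_finrank_ker
  have hle : Module.finrank F (LinearMap.range T) ≤ 6 :=
    (Submodule.finrank_le _).trans (by simp)
  have hker : 2 ≤ Module.finrank F (LinearMap.ker T) := by
    simp at hrn
    omega
  obtain ⟨u, hu⟩ := exists_linearIndependent_of_le_finrank hker
  refine ⟨fun k => (u k : Fin 8 → F), hu.map' _ (Submodule.ker_subtype _), fun k i => ?_⟩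
  have h := LinearMap.mem_ker.1 (u k).2
  exact ⟨congrFun (congrArg Prod.fst h) i, congrFun (congrArg Prod.snd h) i⟩

/-- The orthogonal complement of the hyperbolic part contains a pair of vectors with any
prescribed anisotropic parameters. -/
theorem exists_pair_of_params [Finite F] (hbc : Aniso b c) (hd : b ^ 2 + 4 * c ≠ 0)
    {e f : Fin 3 → Fin 8 → F}
    (hani : ∀ v : Fin 8 → F, (∀ i, polar Q (e i) v = 0) → (∀ i, polar Q (f i) v = 0) →
      Q v = 0 → v = 0) :
    ∃ v w : Fin 8 → F, (∀ i, polar Q (e i) v = 0) ∧ (∀ i, polar Q (f i) v = 0) ∧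
      (∀ i, polar Q (e i) w = 0) ∧ (∀ i, polar Q (f i) w = 0) ∧
      Q v = -1 ∧ polar Q v w = b ∧ Q w = c := by
  obtain ⟨u, hu, huef⟩ := exists_pair_orthogonal (Q := Q) e f
  have hu_ind : ∀ s t : F, s • u 0 + t • u 1 = 0 → s = 0 ∧ t = 0 := fun s t h => by
    have := Fintype.linearIndependent_iff.1 hu ![s, t] (by simpa [Fin.sum_univ_two] using h)
    exact ⟨this 0, this 1⟩
  obtain ⟨s₀, t₀, hst⟩ := exists_binary_eq_neg_one (a := Q (u 0)) (β := polar Q (u 0) (u 1))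
    (γ := Q (u 1)) fun s t h => hu_ind s t <| hani _
      (fun i => by simp [polar_add_right, polar_smul_right, huef])
      (fun i => by simp [polar_add_right, polar_smul_right, huef])
      (by
        simp only [QuadraticMap.map_add Q, QuadraticMap.map_smul, polar_smul_left, polar_smul_right,
          smul_eq_mul]
        linear_combination h)
  obtain ⟨v₁, hv₁⟩ : ∃ v₁, v₁ = s₀ • u 0 + t₀ • u 1 := ⟨_, rfl⟩
  have hv₁e : ∀ i, polar Q (e i) v₁ = 0 := fun i => by
    simp [hv₁, polar_add_right, polar_smul_right, huef]
  have hv₁f : ∀ i, polar Q (f i) v₁ = 0 := fun i => by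
    simp [hv₁, polar_add_right, polar_smul_right, huef]
  have hQv₁ : Q v₁ = -1 := by
    simp only [hv₁, QuadraticMap.map_add Q, QuadraticMap.map_smul, polar_smul_left,
      polar_smul_right, smul_eq_mul]
    linear_combination hst
  obtain ⟨w₀, hw₀e, hw₀f, hw₀⟩ : ∃ w₀, (∀ i, polar Q (e i) w₀ = 0) ∧
      (∀ i, polar Q (f i) w₀ = 0) ∧ ∀ s t : F, s • v₁ + t • w₀ = 0 → s = 0 ∧ t = 0 := by
    by_cases hs : s₀ = 0
    · refine ⟨u 0, fun i => (huef 0 i).1, fun i => (huef 0 i).2, fun s t h => ?_⟩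
      have ht₀ : t₀ ≠ 0 := by rintro rfl; simp [hs] at hst
      have h := hu_ind t (s * t₀) (by rw [← h, hv₁, hs]; module)
      exact ⟨(mul_eq_zero.1 h.2).resolve_right ht₀, h.1⟩
    · refine ⟨u 1, fun i => (huef 1 i).1, fun i => (huef 1 i).2, fun s t h => ?_⟩
      have h := hu_ind (s * s₀) (s * t₀ + t) (by rw [← h, hv₁]; module)
      have hs0 := (mul_eq_zero.1 h.1).resolve_right hs
      exact ⟨hs0, by simpa [hs0] using h.2⟩
  obtain ⟨s, t, hst1, hst2⟩ := exists_change_of_params (b₀ := polar Q v₁ w₀) (c₀ := Q w₀) hbc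
    (fun s t h => hw₀ s t <| hani _
      (fun i => by simp [polar_add_right, polar_smul_right, hv₁e, hw₀e])
      (fun i => by simp [polar_add_right, polar_smul_right, hv₁f, hw₀f])
      (by
        simp only [QuadraticMap.map_add Q, QuadraticMap.map_smul, polar_smul_left, polar_smul_right,
          smul_eq_mul, hQv₁]
        linear_combination h)) hd
  refine ⟨v₁, s • v₁ + t • w₀, hv₁e, hv₁f, fun i => ?_, fun i => ?_, hQv₁, ?_, ?_⟩
  · simp [polar_add_right, polar_smul_right, hv₁e, hw₀e]
  · simp [polar_add_right, polar_smul_right, hv₁f, hw₀f]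
  · simp only [polar_add_right, polar_smul_right, polar_self, hQv₁, smul_eq_mul,
      nsmul_eq_mul, Nat.cast_ofNat]
    linear_combination hst1
  · simp only [QuadraticMap.map_add Q, QuadraticMap.map_smul, polar_smul_left, polar_smul_right,
      smul_eq_mul, hQv₁]
    linear_combination hst2

theorem injective_of_isometry (hd : b ^ 2 + 4 * c ≠ 0) {M : Matrix (Fin 8) (Fin 8) F}
    (hQM : ∀ x, Q (M.mulVec x) = qf b c x) : Function.Injective M.mulVec := by
  have : Function.Injective M.mulVecLin := by
    rw [injective_iff_map_eq_zero]
    intro x hx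
    rw [Matrix.mulVecLin_apply] at hx
    have hpol : ∀ y, bf b c x y = 0 := fun y => by
      have h := qf_add (b := b) (c := c) x y
      rw [← hQM, ← hQM, ← hQM, Matrix.mulVec_add, hx, zero_add, QuadraticMap.map_zero] at h
      linear_combination -h
    have h6 := hpol (ε 6)
    have h7 := hpol (ε 7)
    rw [bf_ε6] at h6
    rw [bf_ε7] at h7
    apply ext8
    · rw [← bf_ε3 (b := b) (c := c) x, hpol]; rfl
    · rw [← bf_ε4 (b := b) (c := c) x, hpol]; rfl
    · rw [← bf_ε5 (b := b) (c := c) x, hpol]; rfl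
    · rw [← bf_ε0 (b := b) (c := c) x, hpol]; rfl
    · rw [← bf_ε1 (b := b) (c := c) x, hpol]; rfl
    · rw [← bf_ε2 (b := b) (c := c) x, hpol]; rfl
    · refine mul_left_cancel₀ hd ?_
      rw [Pi.zero_apply]
      linear_combination -2 * c * h6 + b * h7
    · refine mul_left_cancel₀ hd ?_
      rw [Pi.zero_apply]
      linear_combination b * h6 + 2 * h7
  exact this

/-- Every form of Witt index `3` on `F⁸` is isometric to the model form with any prescribed
anisotropic parameters. -/
theorem exists_isometry [Finite F] (hbc : Aniso b c) (hd : b ^ 2 + 4 * c ≠ 0)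
    (hnd : ∀ u : Fin 8 → F, (∀ v : Fin 8 → F, Q (u + v) = Q u + Q v) → u = 0)
    (h3 : ∃ W : Submodule F (Fin 8 → F), Module.finrank F W = 3 ∧ ∀ w ∈ W, Q w = 0)
    (h4 : ¬ ∃ W : Submodule F (Fin 8 → F), Module.finrank F W = 4 ∧ ∀ w ∈ W, Q w = 0) :
    ∃ g : GL (Fin 8) F, ∀ v, Q ((g : Matrix (Fin 8) (Fin 8) F).mulVec v) = qf b c v := by
  obtain ⟨W, hW3, hW⟩ := h3
  obtain ⟨e, he, heW⟩ : ∃ e : Fin 3 → Fin 8 → F, LinearIndependent F e ∧ ∀ i, e i ∈ W := by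
    obtain ⟨u, hu⟩ := exists_linearIndependent_of_le_finrank hW3.ge
    exact ⟨fun i => (u i : Fin 8 → F), hu.map' _ (Submodule.ker_subtype _), fun i => (u i).2⟩
  have hQe : ∀ i, Q (e i) = 0 := fun i => hW _ (heW i)
  have hee : ∀ i j, polar Q (e i) (e j) = 0 := fun i j => by
    rw [polar, hW _ (W.add_mem (heW i) (heW j)), hQe, hQe]; ring
  obtain ⟨f, hQf, hff, hfe⟩ := exists_hyperbolic hnd he hQe hee
  obtain ⟨v, w, hve, hvf, hwe, hwf, hQv, hvw, hQw⟩ := exists_pair_of_params hbc hd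
    fun v => eq_zero_of_singular_of_orthogonal h4 hQe hee hfe
  have hef : ∀ i j, polar Q (e i) (f j) = if j = i then 1 else 0 := fun i j => by
    rw [polar_comm, hfe]
  have hM : ∀ x, ((Matrix.of ![e 0, e 1, e 2, f 0, f 1, f 2, v, w])ᵀ).mulVec x =
      x 0 • e 0 + x 1 • e 1 + x 2 • e 2 + x 3 • f 0 + x 4 • f 1 +
      x 5 • f 2 + x 6 • v + x 7 • w := fun x => by
    rw [Matrix.mulVec_transpose, Matrix.vecMul_eq_sum, Fin.sum_univ_eight]
    rfl
  have hQM : ∀ x, Q (((Matrix.of ![e 0, e 1, e 2, f 0, f 1, f 2, v, w])ᵀ).mulVec x) =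
      qf b c x := fun x => by
    rw [hM, qf]
    simp only [QuadraticMap.map_add Q, QuadraticMap.map_smul, polar_add_left, polar_smul_left,
      polar_smul_right, smul_eq_mul, hQe, hQf, hQv, hQw, hee, hff, hef, hve, hvf, hwe, hwf, hvw]
    simp
    ring
  obtain ⟨g, hg⟩ := Matrix.mulVec_injective_iff_isUnit.1 (injective_of_isometry hd hQM)
  exact ⟨g, fun v => by rw [hg, hQM]⟩

end normalForm

end OrthEight

namespace OrthEight

theorem isTwoThreeGenerated_of_closure {G : Type*} [Group G] {H : Subgroup G} {x y : G}
    (hx : x * x = 1) (hy : y ^ 3 = 1) (hxy : x * y ≠ y * x) (hc : Subgroup.closure {x, y} = H) :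
    IsTwoThreeGenerated (↥H ⧸ Subgroup.center ↥H) := by
  have hxH : x ∈ H := hc ▸ Subgroup.subset_closure (by simp)
  have hyH : y ∈ H := hc ▸ Subgroup.subset_closure (by simp)
  have hcl : Subgroup.closure {(⟨x, hxH⟩ : H), ⟨y, hyH⟩} = ⊤ := by
    apply Subgroup.map_injective H.subtype_injective
    rw [MonoidHom.map_closure, Set.image_pair, Subgroup.subtype_apply, Subgroup.subtype_apply, hc,
      ← MonoidHom.range_eq_map, Subgroup.range_subtype]
  refine ⟨QuotientGroup.mk' _ ⟨x, hxH⟩, QuotientGroup.mk' _ ⟨y, hyH⟩, ?_, ?_, ?_⟩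
  · refine orderOf_eq_prime ?_ fun h => hxy ?_
    · rw [← map_pow, show (⟨x, hxH⟩ : H) ^ 2 = 1 from Subtype.ext (by simpa [pow_two] using hx),
        map_one]
    · rw [QuotientGroup.mk'_apply, QuotientGroup.eq_one_iff, Subgroup.mem_center_iff] at h
      exact (congrArg Subtype.val (h ⟨y, hyH⟩)).symm
  · refine orderOf_eq_prime ?_ fun h => hxy ?_
    · rw [← map_pow, show (⟨y, hyH⟩ : H) ^ 3 = 1 from Subtype.ext hy, map_one]
    · rw [QuotientGroup.mk'_apply, QuotientGroup.eq_one_iff, Subgroup.mem_center_iff] at h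
      exact congrArg Subtype.val (h ⟨x, hxH⟩)
  · rw [← Set.image_pair, ← MonoidHom.map_closure, hcl,
      Subgroup.map_top_of_surjective _ (QuotientGroup.mk'_surjective _)]

theorem closure_pair_map_eq_commutator {G G' : Type*} [Group G] [Group G'] (ψ : G ≃* G') {x y : G}
    (hc : Subgroup.closure {x, y} = commutator G) :
    Subgroup.closure {ψ x, ψ y} = commutator G' := by
  have h := congrArg (Subgroup.map (ψ : G →* G')) hc
  rw [MonoidHom.map_closure, Set.image_pair, commutator_def, Subgroup.map_commutator,
    Subgroup.map_top_of_surjective _ ψ.surjective] at h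
  exact h

theorem conj_mem_orthogonalGroupOf {F : Type*} [Field F] {Q Q' : (Fin 8 → F) → F}
    {g : GL (Fin 8) F} (hg : ∀ v, Q ((g : Matrix (Fin 8) (Fin 8) F).mulVec v) = Q' v)
    {h : GL (Fin 8) F} (hh : h ∈ orthogonalGroupOf F Q') :
    g * h * g⁻¹ ∈ orthogonalGroupOf F Q := fun v => by
  rw [Units.val_mul, Units.val_mul, ← Matrix.mulVec_mulVec, ← Matrix.mulVec_mulVec, hg, hh, ← hg,
    Matrix.mulVec_mulVec, ← Units.val_mul, mul_inv_cancel, Units.val_one, Matrix.one_mulVec]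

/-- Isometric forms have isomorphic isometry groups. -/
theorem nonempty_mulEquiv_of_isometry {F : Type*} [Field F] {Q Q' : (Fin 8 → F) → F}
    {g : GL (Fin 8) F} (hg : ∀ v, Q ((g : Matrix (Fin 8) (Fin 8) F).mulVec v) = Q' v) :
    Nonempty (↥(orthogonalGroupOf F Q') ≃* ↥(orthogonalGroupOf F Q)) := by
  have hg' : ∀ v, Q' (((g⁻¹ : GL (Fin 8) F) : Matrix (Fin 8) (Fin 8) F).mulVec v) = Q v :=
    fun v => by
      rw [← hg, Matrix.mulVec_mulVec, ← Units.val_mul, mul_inv_cancel, Units.val_one,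
        Matrix.one_mulVec]
  have hmap : (orthogonalGroupOf F Q').map (MulAut.conj g).toMonoidHom =
      orthogonalGroupOf F Q := by
    ext h
    constructor
    · rintro ⟨k, hk, rfl⟩
      exact conj_mem_orthogonalGroupOf hg hk
    · intro hh
      exact ⟨g⁻¹ * h * g⁻¹⁻¹, conj_mem_orthogonalGroupOf hg' hh, by simp [mul_assoc]⟩
  exact ⟨((MulAut.conj g).subgroupMap _).trans (MulEquiv.subgroupCongr hmap)⟩

end OrthEight

/-- The finite simple orthogonal groups `PΩ₈⁻(q)` (the quotient by its center of
the derived subgroup of the orthogonal group of a nondegenerate minus-type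
quadratic form on `F⁸`) are `(2,3)`-generated for every prime power `q ≥ 2`. -/
theorem pomega8minus_two_three_generated
    (F : Type*) [Field F] [Fintype F] (q : ℕ) (hq : Fintype.card F = q)
    (Q : QuadraticForm F (Fin 8 → F))
    (hnd : ∀ u : Fin 8 → F, (∀ v : Fin 8 → F, Q (u + v) = Q u + Q v) → u = 0)
    (h3 : ∃ W : Submodule F (Fin 8 → F),
      Module.finrank F W = 3 ∧ ∀ w ∈ W, Q w = 0)
    (h4 : ¬ ∃ W : Submodule F (Fin 8 → F),
      Module.finrank F W = 4 ∧ ∀ w ∈ W, Q w = 0) :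
    IsTwoThreeGenerated
      (↥(commutator ↥(orthogonalGroupOf F (⇑Q))) ⧸
        Subgroup.center ↥(commutator ↥(orthogonalGroupOf F (⇑Q)))) := by
  obtain ⟨b, c, hbc, hd, x, y, hx, hy, hxy, hc⟩ : ∃ b c : F, OrthEight.Aniso b c ∧
      b ^ 2 + 4 * c ≠ 0 ∧ ∃ x y : OrthEight.OG b c, x * x = 1 ∧ y ^ 3 = 1 ∧ x * y ≠ y * x ∧
        Subgroup.closure {x, y} = commutator (OrthEight.OG b c) := by
    by_cases h2 : (2 : F) = 0
    · exact OrthEight.exists_generating_pair_of_two_eq_zero F h2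
    · exact OrthEight.exists_generating_pair_of_two_ne_zero F h2
  obtain ⟨g, hg⟩ := OrthEight.exists_isometry hbc hd hnd h3 h4
  obtain ⟨ψ⟩ := OrthEight.nonempty_mulEquiv_of_isometry hg
  refine OrthEight.isTwoThreeGenerated_of_closure (x := ψ x) (y := ψ y) ?_ ?_ ?_
    (OrthEight.closure_pair_map_eq_commutator ψ hc)
  · rw [← map_mul, hx, map_one]
  · rw [← map_pow, hy, map_one]
  · rw [← map_mul, ← map_mul]
    exact fun h => hxy (ψ.injective h)
end

section
/- Let q = 2^f ≥ 4, let a ∈ 𝔽_q be such that the subfield of 𝔽_q generated by a is all of 𝔽_q, and let K be an algebraic closure of 𝔽_q. Let x = x(a) and y be the 8×8 matrices over K with rows x: [0,0,0,0,0,1,0,0], [0,0,0,0,1,(a+1)²,(a+1)²,a], [0,0,0,0,0,(a+1)²,(a+1)²,a], [0,0,0,0,0,a,a,1], [0,1,1,0,0,0,0,0], [1,0,0,0,0,0,0,0], [1,0,1,a,0,0,0,0], [0,0,a,(a+1)²,0,0,0,0]; y: [1,0,0,0,0,0,0,0], [0,0,0,0,0,0,0,1], [0,0,0,0,0,1,0,0],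 [0,0,1,0,0,0,0,0], [0,0,0,0,1,0,0,0], [0,0,0,1,0,0,0,0], [0,1,0,0,0,0,0,0], [0,0,0,0,0,0,1,0]. Then the only K-subspaces W of K⁸ with x·W ⊆ W and y·W ⊆ W are {0} and K⁸; that is, the subgroup ⟨x, y⟩ of GL₈(K) is absolutely irreducible. -/
open Matrix

/-- The generator `x = x(a)` of order 2 for `Ω₈⁺(q)` in characteristic 2. -/
def xPlusEven (K : Type*) [Field K] (a : K) : Matrix (Fin 8) (Fin 8) K :=
  !![0, 0, 0, 0, 0, 1, 0, 0;
     0, 0, 0, 0, 1, (a+1)^2, (a+1)^2, a;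
     0, 0, 0, 0, 0, (a+1)^2, (a+1)^2, a;
     0, 0, 0, 0, 0, a, a, 1;
     0, 1, 1, 0, 0, 0, 0, 0;
     1, 0, 0, 0, 0, 0, 0, 0;
     1, 0, 1, a, 0, 0, 0, 0;
     0, 0, a, (a+1)^2, 0, 0, 0, 0]

/-- The generator `y` of order 3 for `Ω₈⁺(q)`. -/
def yPlus (K : Type*) [Field K] : Matrix (Fin 8) (Fin 8) K :=
  !![1, 0, 0, 0, 0, 0, 0, 0;
     0, 0, 0, 0, 0, 0, 0, 1;
     0, 0, 0, 0, 0, 1, 0, 0;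
     0, 0, 1, 0, 0, 0, 0, 0;
     0, 0, 0, 0, 1, 0, 0, 0;
     0, 0, 0, 1, 0, 0, 0, 0;
     0, 1, 0, 0, 0, 0, 0, 0;
     0, 0, 0, 0, 0, 0, 1, 0]

namespace PlusEven

section Compression

variable {K : Type*} [Field K]

/-- The inclusion of the fixed space of `y`, in the basis `e₀, e₄, e₁ + e₆ + e₇, e₂ + e₃ + e₅`. -/
def fixedIncl (K : Type*) [Field K] : Matrix (Fin 8) (Fin 4) K :=
  !![1, 0, 0, 0;
     0, 0, 1, 0;
     0, 0, 0, 1;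
     0, 0, 0, 1;
     0, 1, 0, 0;
     0, 0, 0, 1;
     0, 0, 1, 0;
     0, 0, 1, 0]

/-- In characteristic `2`, the operator `1 + y + y²` is a projection onto the fixed space of `y`;
this is its matrix with respect to the basis used in `fixedIncl`. -/
def fixedProj (K : Type*) [Field K] : Matrix (Fin 4) (Fin 8) K :=
  !![1, 0, 0, 0, 0, 0, 0, 0;
     0, 0, 0, 0, 1, 0, 0, 0;
     0, 1, 0, 0, 0, 0, 1, 1;
     0, 0, 1, 1, 0, 1, 0, 0]

/-- The compression of `x` to the fixed space of `y`. -/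
def compX (a : K) : Matrix (Fin 4) (Fin 4) K :=
  !![0, 0, 0, 1;
     0, 0, 1, 1;
     1, 1, a^2+a+1, 1;
     1, 0, a^2, a^2+a+1]

/-- The compression of `xyx` to the fixed space of `y`. -/
def compXYX (a : K) : Matrix (Fin 4) (Fin 4) K :=
  !![0, 0, a+1, a;
     1, 0, 0, a^2+a+1;
     1, a^2+1, 0, a^2+a;
     a+1, a^2+a+1, a^4+a^3+a^2, a^4+1]

/-- The compression of `xy²x` to the fixed space of `y`. -/
def compXYYX (a : K) : Matrix (Fin 4) (Fin 4) K :=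
  !![0, 0, a^2+a+1, a^2+1;
     1, 0, a+1, 1;
     a^2+a+1, a, a^4+1, a^2+a;
     0, a+1, a^4+a^3+a^2, 0]

theorem fixedIncl_mulVec_fixedProj_mulVec (h2 : (2 : K) = 0) (w : Fin 8 → K) :
    fixedIncl K *ᵥ (fixedProj K *ᵥ w) = w + yPlus K *ᵥ w + yPlus K *ᵥ (yPlus K *ᵥ w) := by
  ext i
  fin_cases i <;>
    simp [fixedIncl, fixedProj, yPlus, mulVec, dotProduct, Fin.sum_univ_succ, vecHead, vecTail] <;>
    grind

theorem fixedProj_mulVec_x (h2 : (2 : K) = 0) (a : K) (v : Fin 4 → K) :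
    fixedProj K *ᵥ (xPlusEven K a *ᵥ (fixedIncl K *ᵥ v)) = compX a *ᵥ v := by
  ext i
  fin_cases i <;>
    simp [fixedIncl, fixedProj, xPlusEven, compX, mulVec, dotProduct, Fin.sum_univ_succ] <;> grind

theorem fixedProj_mulVec_xyx (h2 : (2 : K) = 0) (a : K) (v : Fin 4 → K) :
    fixedProj K *ᵥ (xPlusEven K a *ᵥ (yPlus K *ᵥ (xPlusEven K a *ᵥ (fixedIncl K *ᵥ v)))) =
      compXYX a *ᵥ v := by
  ext i
  fin_cases i <;>
    simp [fixedIncl, fixedProj, xPlusEven, yPlus, compXYX, mulVec, dotProduct,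
      Fin.sum_univ_succ] <;> grind

theorem fixedProj_mulVec_xyyx (h2 : (2 : K) = 0) (a : K) (v : Fin 4 → K) :
    fixedProj K *ᵥ (xPlusEven K a *ᵥ
      (yPlus K *ᵥ (yPlus K *ᵥ (xPlusEven K a *ᵥ (fixedIncl K *ᵥ v))))) = compXYYX a *ᵥ v := by
  ext i
  fin_cases i <;>
    simp [fixedIncl, fixedProj, xPlusEven, yPlus, compXYYX, mulVec, dotProduct,
      Fin.sum_univ_succ] <;> grind

end Compression

section FixedSpace

variable {K : Type*} [Field K]

theorem compX_nilpotent_part (h2 : (2 : K) = 0) (a : K) (v : Fin 4 → K) :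
    (a+1)^2 • (compX a *ᵥ v) + compXYX a *ᵥ v + compXYYX a *ᵥ v =
      (a * v 2 + v 3) • ![a, a+1, 0, 0] +
        ((a+1) * v 0 + a * v 1 + (a+1)^2 * (a * v 2 + v 3)) • ![0, 0, 1, a] := by
  ext i
  fin_cases i <;>
    simp [compX, compXYX, compXYYX, dotProduct, Fin.sum_univ_succ] <;> grind

/-- A subspace of `K⁴` invariant under the three compressions and under a suitable auxiliary
operator `X` is zero or everything. -/
theorem eq_bot_or_eq_top_of_auxiliary (h2 : (2 : K) = 0) {a : K} (ha : a ≠ 1)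
    (T : Submodule K (Fin 4 → K))
    (hA : ∀ v ∈ T, compX a *ᵥ v ∈ T) (hB : ∀ v ∈ T, compXYX a *ᵥ v ∈ T)
    (hC : ∀ v ∈ T, compXYYX a *ᵥ v ∈ T)
    (X : Matrix (Fin 4) (Fin 4) K) (hX : ∀ v ∈ T, X *ᵥ v ∈ T)
    (c d e : K) (hk : (a+1) * c + a * d ≠ 0)
    (hXcol : X *ᵥ ![0, 0, 1, a] = ![c, d, e, a * e])
    (hXrow : ∀ v, a * (X *ᵥ v) 2 + (X *ᵥ v) 3 = d * v 0 + c * v 1 + e * (a * v 2 + v 3))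
    (hXu : (a+1) * (X *ᵥ ![a, a+1, 0, 0]) 0 + a * (X *ᵥ ![a, a+1, 0, 0]) 1 = 0) :
    T = ⊥ ∨ T = ⊤ := by
  have hb : a + 1 ≠ 0 := by grind
  by_cases hα : ∀ v ∈ T, a * v 2 + v 3 = 0
  · left
    rw [Submodule.eq_bot_iff]
    intro v hv
    have h₁ := hα v hv
    have hpq : ∀ w ∈ T, w 0 = 0 ∧ w 1 = 0 := by
      intro w hw
      have h₁ := hα w hw
      have h₂ := hα _ (hA w hw)
      have h₃ := hα _ (hX w hw)
      rw [hXrow] at h₃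
      simp [compX, mulVec, dotProduct, Fin.sum_univ_succ] at h₂
      have h₄ : (a+1) * w 0 + a * w 1 = 0 := by grind
      have h₅ : d * w 0 + c * w 1 = 0 := by grind
      constructor <;> refine (mul_eq_zero.mp ?_).resolve_left hk <;> grind
    have h₄ := (hpq _ (hA v hv)).2
    simp [compX, mulVec, dotProduct, Fin.sum_univ_succ] at h₄
    have h₅ : (a+1) * v 2 = 0 := by grind
    have h₆ : v 2 = 0 := (mul_eq_zero.mp h₅).resolve_left hb
    ext i
    fin_cases i
    · exact (hpq v hv).1
    · exact (hpq v hv).2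
    · exact h₆
    · simp; grind
  · right
    push Not at hα
    obtain ⟨v, hv, hαv⟩ := hα
    have hN : ∀ w ∈ T, (a * w 2 + w 3) • ![a, a+1, 0, 0] +
        ((a+1) * w 0 + a * w 1 + (a+1)^2 * (a * w 2 + w 3)) • ![0, 0, 1, a] ∈ T := fun w hw => by
      rw [← compX_nilpotent_part h2]
      exact T.add_mem (T.add_mem (T.smul_mem _ (hA w hw)) (hB w hw)) (hC w hw)
    have hu₂ : ![0, 0, 1, a] ∈ T := by
      have h₁ := hN v hv
      have h₂ := hN _ (hX _ h₁)
      have hne : ((a+1) * c + a * d) * (a+1)^2 * (a * v 2 + v 3) ≠ 0 :=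
        mul_ne_zero (mul_ne_zero hk (pow_ne_zero 2 hb)) hαv
      rw [← T.smul_mem_iff hne]
      convert T.add_mem (T.smul_mem ((a+1) * c + a * d) h₁) h₂ using 1
      rw [hXrow]
      simp only [mulVec_add, mulVec_smul, hXcol]
      set α := a * v 2 + v 3
      set γ := (a+1) * v 0 + a * v 1 + (a+1)^2 * α
      have hpoly : ((a+1) * c + a * d) * (a+1)^2 * α = ((a+1) * c + a * d) * γ +
          ((a+1) * (α * (X *ᵥ ![a, a+1, 0, 0]) 0 + γ * c) +
            a * (α * (X *ᵥ ![a, a+1, 0, 0]) 1 + γ * d) +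
            (a+1)^2 * (d * (α * a) + c * (α * (a+1)) + e * (a * γ + γ * a))) := by
        linear_combination (-((a+1) * c + a * d) * γ - a * (a+1)^2 * e * γ) * h2 - α * hXu
      ext i
      fin_cases i <;> simp
      · linear_combination
          (-((a+1) * c + a * d) * α * a - a^2 * e * γ) * h2
      · linear_combination
          (-((a+1) * c + a * d) * α * (a+1) - a * (a+1) * e * γ) * h2
      · exact hpoly
      · linear_combination a * hpoly
    have hu₁ : ![a, a+1, 0, 0] ∈ T := by
      convert T.add_mem (hA _ hu₂) (T.smul_mem ((a+1)^2) hu₂) using 1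
      ext i
      fin_cases i <;> simp [compX] <;> grind
    have hXu₂ := hX _ hu₂
    rw [hXcol] at hXu₂
    have h₀ : ![1, 0, 0, 0] ∈ T := by
      rw [← T.smul_mem_iff hk]
      convert T.add_mem (T.smul_mem d hu₁)
        (T.smul_mem (a+1) (T.add_mem hXu₂ (T.smul_mem e hu₂))) using 1
      ext i
      fin_cases i <;> simp <;> grind
    have h₁ : ![0, 1, 0, 0] ∈ T := by
      rw [← T.smul_mem_iff hk]
      convert T.add_mem (T.smul_mem c hu₁)
        (T.smul_mem a (T.add_mem hXu₂ (T.smul_mem e hu₂))) using 1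
      ext i
      fin_cases i <;> simp <;> grind
    have h₂₃ := hA _ h₀
    have h₃ : ![0, 0, 0, 1] ∈ T := by
      rw [← T.smul_mem_iff hb]
      convert T.add_mem hu₂ h₂₃ using 1
      ext i
      fin_cases i <;> simp [compX]
      grind
    rw [eq_top_iff]
    intro w _
    convert T.add_mem (T.add_mem (T.smul_mem (w 0) h₀) (T.smul_mem (w 1) h₁))
      (T.add_mem (T.smul_mem (w 2) hu₂) (T.smul_mem (w 3 + a * w 2) h₃)) using 1
    ext i
    fin_cases i <;> simp
    grind

theorem fixedSpace_eq_bot_or_eq_top (h2 : (2 : K) = 0) {a : K} (ha : a ≠ 1)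
    (T : Submodule K (Fin 4 → K))
    (hA : ∀ v ∈ T, compX a *ᵥ v ∈ T) (hB : ∀ v ∈ T, compXYX a *ᵥ v ∈ T)
    (hC : ∀ v ∈ T, compXYYX a *ᵥ v ∈ T) : T = ⊥ ∨ T = ⊤ := by
  by_cases hk : (a+1) * (a^4+a^3+a^2+a+1) + a * (a^6+a^4+a^3+1) = 0
  · have hk' : (a+1) * (a^7+a^6+a^5+a) + a * (a^5+a^3+a^2+1) ≠ 0 := by
      have hb : a + 1 ≠ 0 := by grind
      have h₁ : (a+1)^2 * (a^5+a^3+a^2+a+1) = 0 := by grind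
      have h₂ := (mul_eq_zero.mp h₁).resolve_left (pow_ne_zero 2 hb)
      intro h
      have h₃ : (a+1)^2 * (a^2 * (a^4+a+1)) = 0 := by grind
      have h₄ := (mul_eq_zero.mp h₃).resolve_left (pow_ne_zero 2 hb)
      grind
    refine eq_bot_or_eq_top_of_auxiliary h2 ha T hA hB hC (compXYYX a * compXYX a)
      (fun v hv => ?_) _ _ (a^6+1) hk' ?_ (fun v => ?_) ?_
    · rw [← mulVec_mulVec]
      exact hC _ (hB v hv)
    · rw [← mulVec_mulVec]
      ext i
      fin_cases i <;>
        simp [compXYX, compXYYX, mulVec, dotProduct, Fin.sum_univ_succ] <;> grind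
    all_goals
      rw [← mulVec_mulVec]
      simp [compXYX, compXYYX, mulVec, dotProduct, Fin.sum_univ_succ]
      grind
  · refine eq_bot_or_eq_top_of_auxiliary h2 ha T hA hB hC (compXYX a * compXYYX a)
      (fun v hv => ?_) _ _ (a^6) hk ?_ (fun v => ?_) ?_
    · rw [← mulVec_mulVec]
      exact hB _ (hC v hv)
    · rw [← mulVec_mulVec]
      ext i
      fin_cases i <;>
        simp [compXYX, compXYYX, mulVec, dotProduct, Fin.sum_univ_succ] <;> grind
    all_goals
      rw [← mulVec_mulVec]
      simp [compXYX, compXYYX, mulVec, dotProduct, Fin.sum_univ_succ]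
      grind

end FixedSpace

section Invariant

variable {K : Type*} [Field K] {a : K} {W : Submodule K (Fin 8 → K)}

theorem eq_bot_of_fixedProj_eq_zero (hxW : ∀ w ∈ W, xPlusEven K a *ᵥ w ∈ W)
    (hyW : ∀ w ∈ W, yPlus K *ᵥ w ∈ W) (h : ∀ w ∈ W, fixedProj K *ᵥ w = 0) : W = ⊥ := by
  have h₀ : ∀ w ∈ W, w 0 = 0 := fun w hw => by
    simpa [fixedProj, mulVec, dotProduct, Fin.sum_univ_succ] using congrFun (h w hw) 0
  have h₄ : ∀ w ∈ W, w 4 = 0 := fun w hw => by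
    simpa [fixedProj, mulVec, dotProduct, Fin.sum_univ_succ] using congrFun (h w hw) 1
  have h₅ : ∀ w ∈ W, w 5 = 0 := fun w hw => by
    simpa [xPlusEven, mulVec, dotProduct, Fin.sum_univ_succ] using h₀ _ (hxW w hw)
  have h₃ : ∀ w ∈ W, w 3 = 0 := fun w hw => by
    simpa [yPlus, mulVec, dotProduct, Fin.sum_univ_succ] using h₅ _ (hyW w hw)
  have h₂ : ∀ w ∈ W, w 2 = 0 := fun w hw => by
    simpa [yPlus, mulVec, dotProduct, Fin.sum_univ_succ] using h₃ _ (hyW w hw)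
  have h₁ : ∀ w ∈ W, w 1 = 0 := fun w hw => by
    simpa [xPlusEven, mulVec, dotProduct, Fin.sum_univ_succ, h₂ w hw] using h₄ _ (hxW w hw)
  have h₇ : ∀ w ∈ W, w 7 = 0 := fun w hw => by
    simpa [yPlus, mulVec, dotProduct, Fin.sum_univ_succ] using h₁ _ (hyW w hw)
  have h₆ : ∀ w ∈ W, w 6 = 0 := fun w hw => by
    simpa [yPlus, mulVec, dotProduct, Fin.sum_univ_succ] using h₇ _ (hyW w hw)
  rw [Submodule.eq_bot_iff]
  intro w hw
  ext i
  fin_cases i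
  exacts [h₀ w hw, h₁ w hw, h₂ w hw, h₃ w hw, h₄ w hw, h₅ w hw, h₆ w hw, h₇ w hw]

theorem eq_top_of_fixedIncl_mem (hxW : ∀ w ∈ W, xPlusEven K a *ᵥ w ∈ W)
    (hyW : ∀ w ∈ W, yPlus K *ᵥ w ∈ W) (h : ∀ v, fixedIncl K *ᵥ v ∈ W) : W = ⊤ := by
  have h₀ : Pi.single 0 1 ∈ W := by
    convert h ![1, 0, 0, 0] using 1
    ext i
    fin_cases i <;> simp [fixedIncl, mulVec, dotProduct, Fin.sum_univ_succ]
  have h₄ : Pi.single 4 1 ∈ W := by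
    convert h ![0, 1, 0, 0] using 1
    ext i
    fin_cases i <;> simp [fixedIncl, mulVec, dotProduct, Fin.sum_univ_succ]
  have h₁ : Pi.single 1 1 ∈ W := by
    convert hxW _ h₄ using 1
    ext i
    fin_cases i <;> simp [xPlusEven]
  have h₆ : Pi.single 6 1 ∈ W := by
    convert hyW _ h₁ using 1
    ext i
    fin_cases i <;> simp [yPlus]
  have h₇ : Pi.single 7 1 ∈ W := by
    convert hyW _ h₆ using 1
    ext i
    fin_cases i <;> simp [yPlus]
  have h₅ : Pi.single 5 1 ∈ W := by
    convert W.sub_mem (hxW _ h₀) h₆ using 1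
    ext i
    fin_cases i <;> simp [xPlusEven]
  have h₂ : Pi.single 2 1 ∈ W := by
    convert hyW _ h₅ using 1
    ext i
    fin_cases i <;> simp [yPlus]
  have h₃ : Pi.single 3 1 ∈ W := by
    convert hyW _ h₂ using 1
    ext i
    fin_cases i <;> simp [yPlus]
  have hall : ∀ i, Pi.single i 1 ∈ W := by
    intro i
    fin_cases i
    exacts [h₀, h₁, h₂, h₃, h₄, h₅, h₆, h₇]
  rw [eq_top_iff]
  intro w _
  rw [pi_eq_sum_univ' w]
  exact W.sum_mem fun i _ => W.smul_mem _ (hall i)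

theorem eq_bot_or_eq_top (h2 : (2 : K) = 0) (ha : a ≠ 1)
    (hxW : ∀ w ∈ W, xPlusEven K a *ᵥ w ∈ W) (hyW : ∀ w ∈ W, yPlus K *ᵥ w ∈ W) :
    W = ⊥ ∨ W = ⊤ := by
  have hP : ∀ w ∈ W, fixedIncl K *ᵥ (fixedProj K *ᵥ w) ∈ W := fun w hw => by
    rw [fixedIncl_mulVec_fixedProj_mulVec h2]
    exact W.add_mem (W.add_mem hw (hyW _ hw)) (hyW _ (hyW _ hw))
  have hT := fixedSpace_eq_bot_or_eq_top h2 ha (W.comap (fixedIncl K).mulVecLin)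
    (fun v hv => by
      rw [Submodule.mem_comap, mulVecLin_apply] at hv ⊢
      rw [← fixedProj_mulVec_x h2]
      exact hP _ (hxW _ hv))
    (fun v hv => by
      rw [Submodule.mem_comap, mulVecLin_apply] at hv ⊢
      rw [← fixedProj_mulVec_xyx h2]
      exact hP _ (hxW _ (hyW _ (hxW _ hv))))
    (fun v hv => by
      rw [Submodule.mem_comap, mulVecLin_apply] at hv ⊢
      rw [← fixedProj_mulVec_xyyx h2]
      exact hP _ (hxW _ (hyW _ (hyW _ (hxW _ hv)))))
  refine hT.imp (fun hbot => ?_) (fun htop => ?_)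
  · refine eq_bot_of_fixedProj_eq_zero hxW hyW fun w hw => ?_
    exact (Submodule.eq_bot_iff _).mp hbot _ (hP w hw)
  · refine eq_top_of_fixedIncl_mem hxW hyW fun v => ?_
    exact (htop ▸ Submodule.mem_top : v ∈ W.comap (fixedIncl K).mulVecLin)

end Invariant

/-- A generator of a finite field of characteristic `2` with at least four elements is not `1`. -/
theorem generator_ne_one {F : Type*} [Field F] [Fintype F] (h2 : (2 : F) = 0)
    (hq : 4 ≤ Fintype.card F) {a : F} (ha : Subfield.closure {a} = ⊤) : a ≠ 1 := by
  classical
  rintro rfl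
  have : CharP F 2 := CharTwo.of_one_ne_zero_of_two_eq_zero one_ne_zero h2
  have hle : Subfield.closure {(1 : F)} ≤ (ZMod.castHom (dvd_refl 2) F).fieldRange := by
    rw [Subfield.closure_le, Set.singleton_subset_iff]
    exact one_mem _
  rw [ha] at hle
  have hsurj : Function.Surjective (ZMod.castHom (dvd_refl 2) F) := fun z =>
    hle (Subfield.mem_top z)
  have := Fintype.card_le_of_surjective _ hsurj
  rw [ZMod.card] at this
  omega

end PlusEven

/-- `⟨x(a), y⟩` is absolutely irreducible for `q = 2^f ≥ 4` and `a` a generator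
of `𝔽_q`: the only subspaces of `K⁸` (`K` an algebraic closure of `𝔽_q`)
invariant under both `x(a)` and `y` are `{0}` and `K⁸`. -/
theorem xPlusEven_yPlus_absolutely_irreducible
    (f : ℕ) (F : Type*) [Field F] [Fintype F]
    (hcard : Fintype.card F = 2 ^ f) (hq : 4 ≤ Fintype.card F)
    (a : F) (ha : Subfield.closure {a} = ⊤)
    (K : Type*) [Field K] [Algebra F K] [IsAlgClosure F K]
    (W : Submodule K (Fin 8 → K))
    (hxW : ∀ w ∈ W, (xPlusEven K (algebraMap F K a)).mulVec w ∈ W)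
    (hyW : ∀ w ∈ W, (yPlus K).mulVec w ∈ W) :
    W = ⊥ ∨ W = ⊤ := by
  have h2 : (2 : F) = 0 := by
    have h : ((Fintype.card F : ℕ) : F) = 0 := Nat.cast_card_eq_zero F
    rw [hcard, Nat.cast_pow, Nat.cast_ofNat] at h
    exact eq_zero_of_pow_eq_zero h
  have ha1 : algebraMap F K a ≠ 1 := fun h =>
    PlusEven.generator_ne_one h2 hq ha ((algebraMap F K).injective (h.trans (map_one _).symm))
  have h2K : (2 : K) = 0 := by
    rw [← map_ofNat (algebraMap F K) 2, h2, map_zero]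
  exact PlusEven.eq_bot_or_eq_top h2K ha1 hxW hyW
end

section
/- Let q = 2^f ≥ 4, let a ∈ 𝔽_q be such that the subfield of 𝔽_q generated by a is all of 𝔽_q, and let K be an algebraic closure of 𝔽_q. Let x' and y' be the 8×8 matrices over K with rows x': [0,a,a,0,1,0,0,0], [a,0,0,0,0,1,0,1], [0,0,0,0,0,0,0,1], [0,0,0,0,0,1,1,0], [a²+1,0,0,0,0,a,0,0], [0,a²+1,a²+1,0,a,0,0,0], [0,a²+1,a²+1,1,a,0,0,0], [0,0,1,0,0,0,0,0]; y': [0,0,0,−1,0,0,0,0], [0,0,0,0,1,0,0,0], [0,0,−1,0,0,0,0,0], [0,0,0,0,0,1,0,0], [0,0,0,0,0,0,0,−1], [1,0,0,0,0,0,0,0], [0,0,0,0,0,0,−1,0], [0,1,0,0,0,0,0,0]. Then the only K-subspaces W of K⁸ with x'·W ⊆ W and y'·W ⊆ W are {0} and K⁸; that is, the subgroup ⟨x', y'⟩ of GL₈(K) is absolutely irreducible. -/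
open Matrix

/-- The image `x' = τ(x(a))` under triality of the order-2 generator of
`Ω₈⁺(q)` in characteristic 2. -/
def xPlusEvenTau (K : Type*) [Field K] (a : K) : Matrix (Fin 8) (Fin 8) K :=
  !![0, a, a, 0, 1, 0, 0, 0;
     a, 0, 0, 0, 0, 1, 0, 1;
     0, 0, 0, 0, 0, 0, 0, 1;
     0, 0, 0, 0, 0, 1, 1, 0;
     a^2+1, 0, 0, 0, 0, a, 0, 0;
     0, a^2+1, a^2+1, 0, a, 0, 0, 0;
     0, a^2+1, a^2+1, 1, a, 0, 0, 0;
     0, 0, 1, 0, 0, 0, 0, 0]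

/-- The image `y' = τ(y)` under triality of the order-3 generator of `Ω₈⁺(q)`. -/
def yPlusTau (K : Type*) [Field K] : Matrix (Fin 8) (Fin 8) K :=
  !![0, 0, 0, -1, 0, 0, 0, 0;
     0, 0, 0, 0, 1, 0, 0, 0;
     0, 0, -1, 0, 0, 0, 0, 0;
     0, 0, 0, 0, 0, 1, 0, 0;
     0, 0, 0, 0, 0, 0, 0, -1;
     1, 0, 0, 0, 0, 0, 0, 0;
     0, 0, 0, 0, 0, 0, -1, 0;
     0, 1, 0, 0, 0, 0, 0, 0]

section Helpers

variable {K : Type*} [Field K]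

lemma xPlusEvenTau_mulVec (a : K) (w : Fin 8 → K) :
    (xPlusEvenTau K a).mulVec w =
      ![a * w 1 + a * w 2 + w 4, a * w 0 + w 5 + w 7, w 7, w 5 + w 6,
        (a ^ 2 + 1) * w 0 + a * w 5, (a ^ 2 + 1) * w 1 + (a ^ 2 + 1) * w 2 + a * w 4,
        (a ^ 2 + 1) * w 1 + (a ^ 2 + 1) * w 2 + w 3 + a * w 4, w 2] := by
  ext i
  fin_cases i <;> simp [xPlusEvenTau, Matrix.mulVec, dotProduct, Fin.sum_univ_eight]

lemma yPlusTau_mulVec [CharP K 2] (w : Fin 8 → K) :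
    (yPlusTau K).mulVec w = ![w 3, w 4, w 2, w 5, w 7, w 0, w 6, w 1] := by
  ext i
  fin_cases i <;>
    simp [yPlusTau, Matrix.mulVec, dotProduct, Fin.sum_univ_eight, CharTwo.neg_eq]

/-- The vector with coordinates `p, q` in the `o`-eigenspace of `yPlusTau`,
where `o` is a primitive cube root of unity. -/
def eigenVec (o p q : K) : Fin 8 → K :=
  ![o * p, q, 0, o ^ 2 * p, o * q, p, 0, o ^ 2 * q]

lemma eigenVec_linear (o c d p q p' q' : K) :
    eigenVec o (c * p + d * p') (c * q + d * q') =
      c • eigenVec o p q + d • eigenVec o p' q' := by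
  ext i
  fin_cases i <;> simp [eigenVec] <;> ring

variable {a o : K} {W : Submodule K (Fin 8 → K)}

/-- Two independent vectors of the eigenspace lying in `W` force the whole eigenspace into `W`. -/
lemma eigenVec_mem_of_det_ne_zero {p q p' q' : K} (h : eigenVec o p q ∈ W)
    (h' : eigenVec o p' q' ∈ W) (hdet : p * q' - q * p' ≠ 0) (r s : K) :
    eigenVec o r s ∈ W := by
  have key := eigenVec_linear o ((r * q' - s * p') / (p * q' - q * p'))
    ((p * s - q * r) / (p * q' - q * p')) p q p' q'
  have hr : (r * q' - s * p') / (p * q' - q * p') * p +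
      (p * s - q * r) / (p * q' - q * p') * p' = r := by
    rw [div_mul_eq_mul_div, div_mul_eq_mul_div, ← add_div, div_eq_iff hdet]; ring
  have hs : (r * q' - s * p') / (p * q' - q * p') * q +
      (p * s - q * r) / (p * q' - q * p') * q' = s := by
    rw [div_mul_eq_mul_div, div_mul_eq_mul_div, ← add_div, div_eq_iff hdet]; ring
  rw [hr, hs] at key
  rw [key]
  exact W.add_mem (W.smul_mem _ h) (W.smul_mem _ h')

variable [CharP K 2]

lemma eigenVec_proj_mem (ho : o ^ 2 + o + 1 = 0)
    (hyW : ∀ w ∈ W, (yPlusTau K).mulVec w ∈ W) {w : Fin 8 → K} (hw : w ∈ W) :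
    eigenVec o (w 5 + o ^ 2 * w 0 + o * w 3) (w 1 + o ^ 2 * w 4 + o * w 7) ∈ W := by
  have h2 : (2 : K) = 0 := CharTwo.two_eq_zero
  have hy := hyW w hw
  have key : eigenVec o (w 5 + o ^ 2 * w 0 + o * w 3) (w 1 + o ^ 2 * w 4 + o * w 7) =
      w + o ^ 2 • (yPlusTau K).mulVec w + o • (yPlusTau K).mulVec ((yPlusTau K).mulVec w) := by
    rw [yPlusTau_mulVec, yPlusTau_mulVec]
    ext i
    fin_cases i <;> simp [eigenVec, -Matrix.add_cons] <;> grind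
  rw [key]
  exact W.add_mem (W.add_mem hw (W.smul_mem _ hy)) (W.smul_mem _ (hyW _ hy))

/-- The quadratic equations satisfied by an eigenvector common to the compressions of
`x`, `xyx`, `xy²xyx` and `xyxyx` to the eigenspace have only the trivial solution. -/
lemma eq_zero_of_quadratic_relations (h0 : a ≠ 0) (h1 : a ≠ 1)
    {p q : K} (e₁ : (a + a ^ 2) * (p ^ 2 + q ^ 2) + p * q = 0)
    (e₂ : p ^ 2 + a ^ 4 * (p * q) + (1 + a ^ 2) * q ^ 2 = 0)
    (e₃ : (1 + a ^ 2 + a ^ 5 + a ^ 6) * p ^ 2 + (a ^ 2 + a ^ 4) * (p * q) + q ^ 2 = 0)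
    (e₄ : (o * (1 + a + a ^ 2 + a ^ 3 + a ^ 4) + a ^ 2) * p ^ 2 +
      (o * (1 + a ^ 2 + a ^ 4) + a ^ 2 + a ^ 3) * (p * q) +
      (o * (1 + a + a ^ 3 + a ^ 4) + 1) * q ^ 2 = 0) :
    p = 0 ∧ q = 0 := by
  have h2 : (2 : K) = 0 := CharTwo.two_eq_zero
  have hpq : p * q = (a + a ^ 2) * (p ^ 2 + q ^ 2) := by grind
  rw [hpq] at e₂ e₃ e₄
  have f₂ : (1 + a ^ 5 + a ^ 6) * (p ^ 2 + q ^ 2) + a ^ 2 * q ^ 2 = 0 := by grind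
  have f₃ : (1 + a ^ 2 + a ^ 3 + a ^ 4) * (p ^ 2 + q ^ 2) + (a ^ 2 + a ^ 5 + a ^ 6) * q ^ 2 = 0 := by
    grind
  have d₃ : a ^ 4 * (1 + a ^ 3 + a ^ 4 + a ^ 6 + a ^ 8) * (p ^ 2 + q ^ 2) = 0 := by grind
  have d₄ : (1 + a + a ^ 2 + a ^ 3 + a ^ 4) ^ 2 * (p ^ 2 + q ^ 2) = 0 := by grind
  have hr : p ^ 2 + q ^ 2 = 0 := by
    by_contra hr
    have s₃ : 1 + a ^ 3 + a ^ 4 + a ^ 6 + a ^ 8 = 0 := by simp_all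
    have s₄ : 1 + a + a ^ 2 + a ^ 3 + a ^ 4 = 0 := by simp_all
    have : a ^ 2 * (a - 1) = 0 := by grind
    simp_all [sub_eq_zero]
  have hq : q = 0 := by simp_all
  exact ⟨by simp_all, hq⟩

lemma eigenVec_mem_or_eq_zero (ho : o ^ 2 + o + 1 = 0) (h0 : a ≠ 0) (h1 : a ≠ 1)
    (hxW : ∀ w ∈ W, (xPlusEvenTau K a).mulVec w ∈ W)
    (hyW : ∀ w ∈ W, (yPlusTau K).mulVec w ∈ W) :
    (∀ r s, eigenVec o r s ∈ W) ∨ ∀ p q, eigenVec o p q ∈ W → p = 0 ∧ q = 0 := by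
  by_contra! hcon
  obtain ⟨⟨r, s, hrs⟩, p, q, hpq, hne⟩ := hcon
  have h2 : (2 : K) = 0 := CharTwo.two_eq_zero
  have hdet : ∀ w ∈ W, p * (w 1 + o ^ 2 * w 4 + o * w 7) -
      q * (w 5 + o ^ 2 * w 0 + o * w 3) = 0 := fun w hw ↦ by
    by_contra hd
    exact hrs (eigenVec_mem_of_det_ne_zero hpq (eigenVec_proj_mem ho hyW hw) hd r s)
  have g₁ := hxW _ hpq
  have g₂ := hxW _ (hyW _ g₁)
  have g₃ := hxW _ (hyW _ (hyW _ g₂))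
  have g₄ := hxW _ (hyW _ g₂)
  have d₁ := hdet _ g₁
  have d₂ := hdet _ g₂
  have d₃ := hdet _ g₃
  have d₄ := hdet _ g₄
  simp [xPlusEvenTau_mulVec, yPlusTau_mulVec, eigenVec] at d₁ d₂ d₃ d₄
  have e₁ : (a + a ^ 2) * (p ^ 2 + q ^ 2) + p * q = 0 := by grind
  have e₂ : p ^ 2 + a ^ 4 * (p * q) + (1 + a ^ 2) * q ^ 2 = 0 := by grind
  have e₃ : (1 + a ^ 2 + a ^ 5 + a ^ 6) * p ^ 2 + (a ^ 2 + a ^ 4) * (p * q) + q ^ 2 = 0 := by grind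
  have e₄ : (o * (1 + a + a ^ 2 + a ^ 3 + a ^ 4) + a ^ 2) * p ^ 2 +
      (o * (1 + a ^ 2 + a ^ 4) + a ^ 2 + a ^ 3) * (p * q) +
      (o * (1 + a + a ^ 3 + a ^ 4) + 1) * q ^ 2 = 0 := by grind
  have := eq_zero_of_quadratic_relations h0 h1 e₁ e₂ e₃ e₄
  exact hne this.1 this.2

lemma one_add_sq_ne_zero (h1 : a ≠ 1) : (1 + a) ^ 2 ≠ 0 := by
  rw [← CharTwo.sub_eq_add]
  exact pow_ne_zero 2 (sub_ne_zero.mpr h1.symm)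

lemma mem_of_eigenVec_mem (ho : o ^ 2 + o + 1 = 0) (h : ∀ r s, eigenVec o r s ∈ W)
    (h' : ∀ r s, eigenVec (o + 1) r s ∈ W) {l : Fin 8 → K} (h2 : l 2 = 0) (h6 : l 6 = 0)
    (h035 : l 0 + l 3 + l 5 = 0) (h147 : l 1 + l 4 + l 7 = 0) : l ∈ W := by
  have htwo : (2 : K) = 0 := CharTwo.two_eq_zero
  have key : l = eigenVec o (l 5 + l 0 + o * l 5) (l 4 + (o + 1) * l 1) +
      eigenVec (o + 1) (l 0 + o * l 5) (l 4 + o * l 1) := by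
    ext i
    fin_cases i <;> simp [eigenVec] <;> grind
  rw [key]
  exact W.add_mem (h _ _) (h' _ _)

lemma eq_top_of_eigenVec_mem (ho : o ^ 2 + o + 1 = 0) (h1 : a ≠ 1)
    (hxW : ∀ w ∈ W, (xPlusEvenTau K a).mulVec w ∈ W)
    (h : ∀ r s, eigenVec o r s ∈ W) (h' : ∀ r s, eigenVec (o + 1) r s ∈ W) : W = ⊤ := by
  have htwo : (2 : K) = 0 := CharTwo.two_eq_zero
  have ha : (1 + a) ^ 2 ≠ 0 := one_add_sq_ne_zero h1
  rw [eq_top_iff]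
  intro z _
  obtain ⟨c, hc⟩ : ∃ c, (1 + a) ^ 2 * c = z 1 + z 4 + z 7 + z 2 +
      a ^ 2 * (z 0 + z 3 + z 5 + z 2 + z 6) + (1 + a) * (z 6 + a * z 2) :=
    ⟨_, mul_div_cancel₀ _ ha⟩
  obtain ⟨β, hβ⟩ : ∃ β, β = z 6 + a * z 2 + (a ^ 2 + a + 1) * c := ⟨_, rfl⟩
  obtain ⟨α, hα⟩ : ∃ α, α = z 0 + z 3 + z 5 + z 2 + z 6 + (1 + a) * c := ⟨_, rfl⟩
  have hm : ![α, c, 0, β, c + z 2, α + β, 0, z 2] ∈ W := by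
    apply mem_of_eigenVec_mem ho h h' <;> simp <;> grind
  have hl : z - (xPlusEvenTau K a).mulVec ![α, c, 0, β, c + z 2, α + β, 0, z 2] ∈ W := by
    rw [xPlusEvenTau_mulVec]
    apply mem_of_eigenVec_mem ho h h' <;> simp <;> grind
  simpa using W.add_mem hl (hxW _ hm)

lemma eq_bot_of_eigenVec_eq_zero (ho : o ^ 2 + o + 1 = 0) (h1 : a ≠ 1)
    (hxW : ∀ w ∈ W, (xPlusEvenTau K a).mulVec w ∈ W)
    (hyW : ∀ w ∈ W, (yPlusTau K).mulVec w ∈ W)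
    (h : ∀ p q, eigenVec o p q ∈ W → p = 0 ∧ q = 0)
    (h' : ∀ p q, eigenVec (o + 1) p q ∈ W → p = 0 ∧ q = 0) : W = ⊥ := by
  have htwo : (2 : K) = 0 := CharTwo.two_eq_zero
  have ho' : (o + 1) ^ 2 + (o + 1) + 1 = 0 := by grind
  have hfix : ∀ w ∈ W, w 3 = w 0 ∧ w 5 = w 0 ∧ w 4 = w 1 ∧ w 7 = w 1 := fun w hw ↦ by
    have e := h _ _ (eigenVec_proj_mem ho hyW hw)
    have e' := h' _ _ (eigenVec_proj_mem ho' hyW hw)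
    grind
  rw [eq_bot_iff]
  intro w hw
  have e := hfix w hw
  have e' := hfix _ (hxW w hw)
  simp [xPlusEvenTau_mulVec] at e'
  have hd : (1 + a) ^ 2 * w 0 = 0 := by grind
  have ha : (1 + a) ^ 2 ≠ 0 := one_add_sq_ne_zero h1
  have hw0 : w 0 = 0 := by simpa [ha] using hd
  rw [Submodule.mem_bot]
  ext i
  fin_cases i <;> simp <;> grind

lemma not_eigenVec_mem_and_eq_zero (ho : o ^ 2 + o + 1 = 0)
    (hxW : ∀ w ∈ W, (xPlusEvenTau K a).mulVec w ∈ W)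
    (hyW : ∀ w ∈ W, (yPlusTau K).mulVec w ∈ W)
    (h : ∀ r s, eigenVec o r s ∈ W)
    (h' : ∀ p q, eigenVec (o + 1) p q ∈ W → p = 0 ∧ q = 0) : False := by
  have htwo : (2 : K) = 0 := CharTwo.two_eq_zero
  have ho' : (o + 1) ^ 2 + (o + 1) + 1 = 0 := by grind
  have e := (h' _ _ (eigenVec_proj_mem ho' hyW (hxW _ (h 1 0)))).1
  simp [xPlusEvenTau_mulVec, eigenVec] at e
  grind

/-- Away from `a = 0, 1` the pair is irreducible over any field of characteristic two that
contains a primitive cube root of unity. -/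
lemma eq_bot_or_eq_top_of_invariant (ho : o ^ 2 + o + 1 = 0) (h0 : a ≠ 0) (h1 : a ≠ 1)
    (hxW : ∀ w ∈ W, (xPlusEvenTau K a).mulVec w ∈ W)
    (hyW : ∀ w ∈ W, (yPlusTau K).mulVec w ∈ W) : W = ⊥ ∨ W = ⊤ := by
  have htwo : (2 : K) = 0 := CharTwo.two_eq_zero
  have ho' : (o + 1) ^ 2 + (o + 1) + 1 = 0 := by grind
  have hoo : o + 1 + 1 = o := by grind
  rcases eigenVec_mem_or_eq_zero ho h0 h1 hxW hyW with h | h <;>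
    rcases eigenVec_mem_or_eq_zero ho' h0 h1 hxW hyW with h' | h'
  · exact .inr (eq_top_of_eigenVec_mem ho h1 hxW h h')
  · exact (not_eigenVec_mem_and_eq_zero ho hxW hyW h h').elim
  · exact (not_eigenVec_mem_and_eq_zero ho' hxW hyW h' (by rwa [hoo])).elim
  · exact .inl (eq_bot_of_eigenVec_eq_zero ho h1 hxW hyW h h')

end Helpers

/-- An element fixed by the Frobenius cannot generate a field with more than two elements. -/
lemma sq_ne_self_of_closure_eq_top {F : Type*} [Field F] [Fintype F] [CharP F 2]
    (hq : 4 ≤ Fintype.card F) {a : F} (ha : Subfield.closure {a} = ⊤) : a ^ 2 ≠ a := by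
  intro h
  have hle : Subfield.closure {a} ≤ (frobenius F 2).eqLocusField (RingHom.id F) := by
    rw [Subfield.closure_le, Set.singleton_subset_iff]
    exact h
  have hall (z : F) : z = 0 ∨ z = 1 := by
    have hz : z ^ 2 = z := hle (ha ▸ Subfield.mem_top z)
    rw [pow_two] at hz
    exact IsIdempotentElem.iff_eq_zero_or_one.mp hz
  classical
  have hcard : Fintype.card F ≤ ({0, 1} : Finset F).card := by
    rw [← Finset.card_univ]
    exact Finset.card_le_card fun z _ ↦ by simpa using hall z
  have := Finset.card_le_two (a := (0 : F)) (b := 1)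
  omega

/-- `⟨τ(x), τ(y)⟩` is absolutely irreducible for `q = 2^f ≥ 4` and `a` a
generator of `𝔽_q`: the only subspaces of `K⁸` (`K` an algebraic closure of
`𝔽_q`) invariant under both `τ(x)` and `τ(y)` are `{0}` and `K⁸`. -/
theorem xPlusEvenTau_yPlusTau_absolutely_irreducible
    (f : ℕ) (F : Type*) [Field F] [Fintype F]
    (hcard : Fintype.card F = 2 ^ f) (hq : 4 ≤ Fintype.card F)
    (a : F) (ha : Subfield.closure {a} = ⊤)
    (K : Type*) [Field K] [Algebra F K] [IsAlgClosure F K]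
    (W : Submodule K (Fin 8 → K))
    (hxW : ∀ w ∈ W, (xPlusEvenTau K (algebraMap F K a)).mulVec w ∈ W)
    (hyW : ∀ w ∈ W, (yPlusTau K).mulVec w ∈ W) :
    W = ⊥ ∨ W = ⊤ := by
  have hF : CharP F 2 := charP_of_card_eq_prime_pow (f := f) (by rw [hcard])
  have hK : CharP K 2 := charP_of_injective_algebraMap (algebraMap F K).injective 2
  have hsq := sq_ne_self_of_closure_eq_top hq ha
  have h0 : algebraMap F K a ≠ 0 := by
    rw [Ne, map_eq_zero]; rintro rfl; simp at hsq
  have h1 : algebraMap F K a ≠ 1 := by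
    rw [Ne, map_eq_one_iff _ (algebraMap F K).injective]; rintro rfl; simp at hsq
  have : IsAlgClosed K := IsAlgClosure.isAlgClosed F
  obtain ⟨o, ho⟩ := IsAlgClosed.exists_root
    (Polynomial.X ^ 2 + Polynomial.X + 1 : Polynomial K) (by
      rw [show (Polynomial.X ^ 2 + Polynomial.X + 1 : Polynomial K).degree = 2 by compute_degree!]
      decide)
  have ho : o ^ 2 + o + 1 = 0 := by simpa using ho
  exact eq_bot_or_eq_top_of_invariant ho h0 h1 hxW hyW
end
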